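/- arXiv:1711.10480 — 3 statements merged into one kernel-verified Lean document; each statement's English description precedes it below -/
import Mathlib

section
/- Let ν be real and 0 < a < 1. Then for every natural number M there exist constants C > 0 and T > 0 such that for all real t ≥ T: | (i t/2)^{−ν−1} L_ν(i t; a) − (1/π) Σ_{k=0}^{M−1} Γ(k + 1/2) · (t²/4)^{−k−1} / Γ(ν + 3/2 − a(k+1)) | ≤ C · t^{−2M−2}, where (i t/2)^{−ν−1} is the principal power and 1/Γ(ν+3/2−a(k+1)) is interpreted via the entire reciprocal Gamma function. That is, on the imaginary axis L_ν has the complete algebraic asymptotic expansion (i t/2)^{−ν−1} L_ν(i t;a) ∼ (1/π) Σ_{k≥0} Γ(k+1/2)(t²/4)^{−k−1}/Γ(ν+3/2−a(1+k)) as t → +∞. -/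
open Filter Topology


/-- The generalised Struve function
`L_ν(z;a) = (z/2)^{ν+1} Σ_{n≥0} (z/2)^{2n} / (Γ(n+3/2) Γ(an+ν+3/2))`,
with principal branch power and the entire reciprocal Gamma function
(`Complex.Gamma` vanishes at the poles, so division realises `1/Γ`). -/
noncomputable def struveL (ν a : ℝ) (z : ℂ) : ℂ :=
  (z / 2) ^ ((ν : ℂ) + 1) *
    ∑' n : ℕ, (z / 2) ^ (2 * n) /
      (Complex.Gamma ((n : ℂ) + 3 / 2) *
        Complex.Gamma ((a : ℂ) * (n : ℂ) + (ν : ℂ) + 3 / 2))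


theorem sv_polybound (P : Polynomial ℂ) (δ : ℝ) (hδ : 0 < δ) :
    ∃ C : ℝ, 0 ≤ C ∧ ∀ z : ℂ, ‖P.eval z‖ ≤ C * Real.exp (δ * ‖z‖) := by
  induction P using Polynomial.induction_on' with
  | add p q hp hq =>
    obtain ⟨C1, h1, H1⟩ := hp
    obtain ⟨C2, h2, H2⟩ := hq
    refine ⟨C1 + C2, by positivity, fun z => ?_⟩
    rw [Polynomial.eval_add, add_mul]
    exact (norm_add_le _ _).trans (add_le_add (H1 z) (H2 z))
  | monomial n c =>
    refine ⟨‖c‖ * (n.factorial / δ ^ n), by positivity, fun z => ?_⟩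
    rw [Polynomial.eval_monomial, norm_mul, norm_pow, mul_assoc]
    gcongr
    have := Real.pow_div_factorial_le_exp (δ * ‖z‖) (by positivity) n
    rw [div_le_iff₀ (by positivity), mul_pow] at this
    rw [div_mul_eq_mul_div, le_div_iff₀ (by positivity)]
    linarith

theorem sv_polyexp (N : ℕ) : ∀ P : Polynomial ℂ, P.natDegree < N → ∃ Q : Polynomial ℂ,
    ∀ y : ℂ, HasSum (fun n : ℕ => P.eval (n : ℂ) * y ^ n / (n.factorial : ℂ))
      (Q.eval y * Complex.exp y) := by
  have hexp : ∀ (c y : ℂ), HasSum (fun n : ℕ => c * y ^ n / (n.factorial : ℂ))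
      (c * Complex.exp y) := by
    intro c y
    have := (NormedSpace.expSeries_div_hasSum_exp (𝔸 := ℂ) y).mul_left c
    rw [← Complex.exp_eq_exp_ℂ] at this
    simpa [mul_div_assoc] using this
  induction N with
  | zero => intro P h; omega
  | succ N ih =>
    intro P hP
    by_cases h0 : P.natDegree = 0
    · refine ⟨Polynomial.C (P.coeff 0), fun y => ?_⟩
      rw [Polynomial.eq_C_of_natDegree_eq_zero h0]
      simpa using hexp (P.coeff 0) y
    · obtain ⟨Q, hQ⟩ := ih (P.divX.comp (Polynomial.X + 1)) (by
        rw [Polynomial.natDegree_comp, Polynomial.natDegree_divX_eq_natDegree_tsub_one]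
        have : (Polynomial.X + 1 : Polynomial ℂ).natDegree = 1 := by
          simpa using Polynomial.natDegree_X_add_C (1 : ℂ)
        rw [this]; omega)
      refine ⟨Polynomial.X * Q + Polynomial.C (P.coeff 0), fun y => ?_⟩
      have h1 : HasSum (fun n : ℕ => (n : ℂ) * P.divX.eval (n : ℂ) * y ^ n / (n.factorial : ℂ))
          (y * (Q.eval y * Complex.exp y)) := by
        rw [← hasSum_nat_add_iff' 1]
        have := (hQ y).mul_left y
        simp only [Finset.range_one, Finset.sum_singleton, Nat.cast_zero, zero_mul, zero_div,
          sub_zero]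
        refine this.congr_fun ?_ |> id
        intro n
        have hn : ((n : ℂ) + 1) ≠ 0 := by exact_mod_cast Nat.succ_ne_zero n
        have hf : (n.factorial : ℂ) ≠ 0 := by exact_mod_cast n.factorial_ne_zero
        rw [Nat.factorial_succ]
        push_cast
        simp only [Polynomial.eval_comp, Polynomial.eval_add, Polynomial.eval_X,
          Polynomial.eval_one]
        field_simp
        ring
      have h2 := h1.add (hexp (P.coeff 0) y)
      convert h2 using 1
      · funext n
        conv_lhs => rw [← Polynomial.divX_mul_X_add P]
        simp only [Polynomial.eval_add, Polynomial.eval_mul, Polynomial.eval_X, Polynomial.eval_C]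
        ring
      · simp only [Polynomial.eval_add, Polynomial.eval_mul, Polynomial.eval_X, Polynomial.eval_C]
        ring

noncomputable def svRho (s : ℝ) : ℝ := (1 - s) ^ (-1 / 2 : ℝ)

theorem sv_rho_nonneg {s : ℝ} (hs : s ∈ Set.Ioo (0 : ℝ) 1) : 0 ≤ svRho s :=
  Real.rpow_nonneg (by linarith [hs.2]) _

theorem sv_rho_int : MeasureTheory.IntegrableOn svRho (Set.Ioo 0 1) := by
  have h : IntervalIntegrable (fun x : ℝ => x ^ (-1 / 2 : ℝ)) MeasureTheory.volume 0 1 :=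
    intervalIntegral.intervalIntegrable_rpow' (by norm_num)
  have h2 := (h.comp_sub_left 1).symm
  simp only [sub_self, sub_zero] at h2
  rw [intervalIntegrable_iff_integrableOn_Ioo_of_le zero_le_one] at h2
  exact h2

theorem sv_beta (n : ℕ) : ∫ s in Set.Ioo (0 : ℝ) 1, (svRho s : ℂ) * (s : ℂ) ^ n =
    (n.factorial : ℂ) * Complex.Gamma (1 / 2) / Complex.Gamma ((n : ℂ) + 3 / 2) := by
  have h := Complex.Gamma_mul_Gamma_eq_betaIntegral (s := (n : ℂ) + 1) (t := 1 / 2)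
    (by simp; positivity) (by norm_num)
  rw [Complex.Gamma_nat_eq_factorial, show (n : ℂ) + 1 + 1 / 2 = (n : ℂ) + 3 / 2 by ring] at h
  have hne : Complex.Gamma ((n : ℂ) + 3 / 2) ≠ 0 :=
    Complex.Gamma_ne_zero_of_re_pos (by simp; positivity)
  rw [h, mul_div_cancel_left₀ _ hne, Complex.betaIntegral,
    intervalIntegral.integral_of_le zero_le_one, MeasureTheory.integral_Ioc_eq_integral_Ioo]
  refine MeasureTheory.setIntegral_congr_fun measurableSet_Ioo fun s hs => ?_
  simp only [svRho, add_sub_cancel_right, Complex.cpow_natCast]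
  rw [Complex.ofReal_cpow (by linarith [hs.2]), mul_comm]
  push_cast
  norm_num

theorem sv_Gamma_ge : ∃ c : ℝ, 0 < c ∧ ∀ n : ℕ,
    c * n.factorial ≤ ‖Complex.Gamma ((n : ℂ) + 3 / 2)‖ := by
  refine ⟨‖Complex.Gamma (3 / 2)‖, norm_pos_iff.2
    (Complex.Gamma_ne_zero_of_re_pos (by norm_num)), fun n => ?_⟩
  induction n with
  | zero => simp
  | succ n ih =>
    have hne : (n : ℂ) + 3 / 2 ≠ 0 := by
      intro h; have := congrArg Complex.re h; simp at this; have h3 : (0 : ℝ) ≤ n := Nat.cast_nonneg n; linarith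
    rw [show ((n + 1 : ℕ) : ℂ) + 3 / 2 = ((n : ℂ) + 3 / 2) + 1 by push_cast; ring,
      Complex.Gamma_add_one _ hne, norm_mul, Nat.factorial_succ]
    have : ((n : ℝ) + 1) ≤ ‖(n : ℂ) + 3 / 2‖ := by
      refine le_trans ?_ (Complex.re_le_norm _)
      simp; norm_num
    push_cast
    calc _ = ((n : ℝ) + 1) * (‖Complex.Gamma (3 / 2)‖ * n.factorial) := by ring
      _ ≤ _ := by gcongr

noncomputable def svG (P : Polynomial ℂ) (w : ℂ) : ℂ :=
  ∑' n : ℕ, P.eval (n : ℂ) * (-w) ^ n / Complex.Gamma ((n : ℂ) + 3 / 2)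

theorem sv_summ0 (P : Polynomial ℂ) (r : ℝ) (hr : 0 ≤ r) :
    Summable (fun n : ℕ => ‖P.eval (n : ℂ)‖ * r ^ n / (n.factorial : ℝ)) := by
  obtain ⟨C, hC, h⟩ := sv_polybound P 1 one_pos
  refine Summable.of_nonneg_of_le (fun n => by positivity) (fun n => ?_)
    ((Real.summable_pow_div_factorial (Real.exp 1 * r)).mul_left C)
  have h1 := h (n : ℂ)
  rw [Complex.norm_natCast, one_mul] at h1
  rw [mul_pow, ← Real.exp_nat_mul, mul_one, ← mul_div_assoc, ← mul_assoc]
  gcongr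

theorem sv_summ (P : Polynomial ℂ) (r : ℝ) (hr : 0 ≤ r) :
    Summable (fun n : ℕ => ‖P.eval (n : ℂ)‖ * r ^ n / ‖Complex.Gamma ((n : ℂ) + 3 / 2)‖) := by
  obtain ⟨c, hc, h⟩ := sv_Gamma_ge
  refine Summable.of_nonneg_of_le (fun n => by positivity) (fun n => ?_)
    ((sv_summ0 P r hr).mul_left (1 / c))
  calc _ ≤ ‖P.eval (n : ℂ)‖ * r ^ n / (c * n.factorial) := by
        gcongr
        exact h n
    _ = _ := by field_simp

theorem sv_summG (P : Polynomial ℂ) (w : ℂ) :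
    Summable (fun n : ℕ => P.eval (n : ℂ) * (-w) ^ n / Complex.Gamma ((n : ℂ) + 3 / 2)) := by
  refine Summable.of_norm ?_
  simpa using sv_summ P ‖w‖ (norm_nonneg _)

theorem sv_repr (P : Polynomial ℂ) : ∃ Q : Polynomial ℂ, ∀ w : ℂ,
    svG P w * Complex.Gamma (1 / 2) = ∫ s in Set.Ioo (0 : ℝ) 1,
      (svRho s : ℂ) * (Q.eval (-w * s) * Complex.exp (-w * s)) := by
  obtain ⟨Q, hQ⟩ := sv_polyexp (P.natDegree + 1) P (Nat.lt_succ_self _)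
  refine ⟨Q, fun w => ?_⟩
  have hint : ∀ n : ℕ, MeasureTheory.IntegrableOn (fun s : ℝ => (svRho s : ℂ) * (s : ℂ) ^ n)
      (Set.Ioo 0 1) := by
    intro n
    have h1 : MeasureTheory.IntegrableOn (fun s : ℝ => (svRho s : ℂ)) (Set.Ioo 0 1) :=
      sv_rho_int.ofReal
    refine MeasureTheory.Integrable.mul_bdd (c := 1) h1
      (by fun_prop) ?_
    filter_upwards [MeasureTheory.ae_restrict_mem measurableSet_Ioo] with s hs
    rw [norm_pow, Complex.norm_real, Real.norm_of_nonneg hs.1.le]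
    exact pow_le_one₀ hs.1.le hs.2.le
  have key := MeasureTheory.hasSum_integral_of_summable_integral_norm
    (μ := MeasureTheory.volume.restrict (Set.Ioo (0 : ℝ) 1))
    (F := fun (n : ℕ) (s : ℝ) => (P.eval (n : ℂ) * (-w) ^ n / (n.factorial : ℂ)) *
      ((svRho s : ℂ) * (s : ℂ) ^ n)) (fun n => (hint n).const_mul _) (by
      refine Summable.of_nonneg_of_le (fun n => by positivity) (fun n => ?_)
        ((sv_summ0 P ‖w‖ (norm_nonneg _)).mul_right (∫ s in Set.Ioo (0 : ℝ) 1, svRho s))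
      simp_rw [norm_mul _ ((svRho _ : ℂ) * _)]
      rw [MeasureTheory.integral_const_mul]
      have : ‖P.eval (n : ℂ) * (-w) ^ n / (n.factorial : ℂ)‖ =
          ‖P.eval (n : ℂ)‖ * ‖w‖ ^ n / (n.factorial : ℝ) := by simp
      rw [this]
      refine mul_le_mul_of_nonneg_left ?_ (by positivity)
      refine MeasureTheory.setIntegral_mono_on (hint n).norm sv_rho_int measurableSet_Ioo ?_
      intro s hs
      rw [norm_mul, norm_pow, Complex.norm_real, Complex.norm_real, Real.norm_of_nonneg hs.1.le,
        Real.norm_of_nonneg (sv_rho_nonneg hs)]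
      exact mul_le_of_le_one_right (sv_rho_nonneg hs) (pow_le_one₀ hs.1.le hs.2.le))
  have e1 : ∀ s : ℝ, ∑' n : ℕ, (P.eval (n : ℂ) * (-w) ^ n / (n.factorial : ℂ)) *
      ((svRho s : ℂ) * (s : ℂ) ^ n) =
      (svRho s : ℂ) * (Q.eval (-w * s) * Complex.exp (-w * s)) := by
    intro s
    rw [← ((hQ (-w * s)).mul_left (svRho s : ℂ)).tsum_eq]
    refine tsum_congr fun n => ?_
    rw [mul_pow]; ring
  simp_rw [e1] at key
  rw [← key.tsum_eq, svG, ← tsum_mul_right]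
  refine tsum_congr fun n => ?_
  rw [MeasureTheory.integral_const_mul, sv_beta]
  have hf : (n.factorial : ℂ) ≠ 0 := by exact_mod_cast n.factorial_ne_zero
  field_simp

theorem sv_rho_exp (r : ℝ) (hr : 0 < r) :
    MeasureTheory.IntegrableOn (fun s => svRho s * Real.exp (-r * s)) (Set.Ioo 0 1) ∧ 
    ∃ A : ℝ, 0 < A ∧ ∀ r : ℝ, 0 < r → 
    ∫ s in Set.Ioo (0 : ℝ) 1, svRho s * Real.exp (-r * s) ≤ A / r := by
  have hI : ∀ r : ℝ, 0 < r → 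
      MeasureTheory.IntegrableOn (fun s => svRho s * Real.exp (-r * s)) (Set.Ioo 0 1) := by
    intro r hr
    refine MeasureTheory.Integrable.mul_bdd (c := 1) sv_rho_int (by fun_prop) ?_
    filter_upwards [MeasureTheory.ae_restrict_mem measurableSet_Ioo] with s hs
    rw [Real.norm_of_nonneg (Real.exp_pos _).le]
    exact Real.exp_le_one_iff.2 (by nlinarith [hs.1])
  refine ⟨hI r hr, 2 + 2 * (∫ s in Set.Ioo (0 : ℝ) 1, svRho s), ?_, fun r hr => ?_⟩
  · have : 0 ≤ ∫ s in Set.Ioo (0 : ℝ) 1, svRho s :=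
      MeasureTheory.setIntegral_nonneg measurableSet_Ioo fun s hs => sv_rho_nonneg hs
    positivity
  have hIr : 0 ≤ ∫ s in Set.Ioo (0 : ℝ) 1, svRho s :=
      MeasureTheory.setIntegral_nonneg measurableSet_Ioo fun s hs => sv_rho_nonneg hs
  have hexp : MeasureTheory.IntegrableOn (fun s => Real.exp (-r * s)) (Set.Ioi 0) :=
    integrableOn_exp_mul_Ioi (by linarith) 0
  have hexp' := hexp.mono_set (show Set.Ioo (0 : ℝ) 1 ⊆ Set.Ioi 0 from Set.Ioo_subset_Ioi_self)
  calc _ ≤ ∫ s in Set.Ioo (0 : ℝ) 1, (2 * Real.exp (-r * s) + Real.exp (-r / 2) * svRho s) := by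
        refine MeasureTheory.setIntegral_mono_on (hI r hr) 
          ((hexp'.const_mul _).add (sv_rho_int.const_mul _)) measurableSet_Ioo fun s hs => ?_
        have h0 := sv_rho_nonneg hs
        rcases le_total s (1 / 2) with h | h
        · have : svRho s ≤ 2 := by
            calc svRho s ≤ (1 / 2 : ℝ) ^ (-1 / 2 : ℝ) := 
                  Real.rpow_le_rpow_of_nonpos (by norm_num) (by linarith) (by norm_num)
              _ ≤ (1 / 2 : ℝ) ^ (-1 : ℝ) :=
                  Real.rpow_le_rpow_of_exponent_ge (by norm_num) (by norm_num) (by norm_num)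
              _ = 2 := by rw [Real.rpow_neg_one]; norm_num
          have h1 := mul_le_mul_of_nonneg_right this (Real.exp_pos (-r * s)).le
          have h2 := mul_nonneg (Real.exp_pos (-r / 2)).le h0
          linarith
        · have : Real.exp (-r * s) ≤ Real.exp (-r / 2) := Real.exp_le_exp.2 (by nlinarith)
          have h1 := mul_le_mul_of_nonneg_left this h0
          have h2 := Real.exp_pos (-r * s)
          linarith
    _ = 2 * (∫ s in Set.Ioo (0 : ℝ) 1, Real.exp (-r * s)) + 
        Real.exp (-r / 2) * ∫ s in Set.Ioo (0 : ℝ) 1, svRho s := by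
        rw [MeasureTheory.integral_add (hexp'.const_mul _) (sv_rho_int.const_mul _),
          MeasureTheory.integral_const_mul, MeasureTheory.integral_const_mul]
    _ ≤ 2 * (1 / r) + (2 / r) * ∫ s in Set.Ioo (0 : ℝ) 1, svRho s := by
        gcongr
        · calc _ ≤ ∫ s in Set.Ioi (0 : ℝ), Real.exp (-r * s) := 
                MeasureTheory.setIntegral_mono_set hexp 
                  (Eventually.of_forall fun s => (Real.exp_pos _).le)
                  (Set.Ioo_subset_Ioi_self).eventuallyLE
            _ = 1 / r := by
                rw [integral_exp_mul_Ioi (by linarith)]; simp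
        · rw [show -r / 2 = -(r / 2) by ring, Real.exp_neg, inv_eq_one_div, 
            div_le_div_iff₀ (Real.exp_pos _) hr]
          linarith [Real.add_one_le_exp (r / 2)]
    _ = _ := by ring

theorem sv_G_bound (P : Polynomial ℂ) (c : ℝ) (hc : 0 < c) :
    ∃ C : ℝ, 0 ≤ C ∧ ∀ w : ℂ, w ≠ 0 → c * ‖w‖ ≤ w.re → ‖svG P w‖ ≤ C / ‖w‖ := by
  obtain ⟨Q, hQ⟩ := sv_repr P
  obtain ⟨B, hB, hQB⟩ := sv_polybound Q (c / 2) (by positivity)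
  obtain ⟨-, A, hA, hAr⟩ := sv_rho_exp 1 one_pos
  have hg : 0 < ‖Complex.Gamma (1 / 2)‖ := norm_pos_iff.2
    (Complex.Gamma_ne_zero_of_re_pos (by norm_num))
  refine ⟨B * (A * (2 / c)) / ‖Complex.Gamma (1 / 2)‖, by positivity, fun w hw hwc => ?_⟩
  have hw' : 0 < ‖w‖ := norm_pos_iff.2 hw
  have hr : 0 < c / 2 * ‖w‖ := by positivity
  have h1 : ‖svG P w * Complex.Gamma (1 / 2)‖ ≤ B * (A / (c / 2 * ‖w‖)) := by
    rw [hQ]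
    calc _ ≤ ∫ s in Set.Ioo (0 : ℝ) 1, B * (svRho s * Real.exp (-(c / 2 * ‖w‖) * s)) := by
          refine MeasureTheory.norm_integral_le_of_norm_le 
            ((sv_rho_exp _ hr).1.const_mul B) ?_
          filter_upwards [MeasureTheory.ae_restrict_mem measurableSet_Ioo] with s hs
          rw [norm_mul, norm_mul, Complex.norm_real, Real.norm_of_nonneg (sv_rho_nonneg hs),
            Complex.norm_exp]
          have h2 := hQB (-w * s)
          have h3 : ‖-w * (s : ℂ)‖ = ‖w‖ * s := by
            rw [norm_mul, norm_neg, Complex.norm_real, Real.norm_of_nonneg hs.1.le]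
          have h4 : (-w * (s : ℂ)).re = - w.re * s := by simp
          rw [h3] at h2
          rw [h4]
          calc _ ≤ svRho s * (B * Real.exp (c / 2 * (‖w‖ * s)) * Real.exp (-(c * ‖w‖) * s)) := by
                have := sv_rho_nonneg hs
                have := hs.1.le
                gcongr
            _ = _ := by
                rw [mul_assoc B, ← Real.exp_add]
                ring_nf
      _ = B * ∫ s in Set.Ioo (0 : ℝ) 1, svRho s * Real.exp (-(c / 2 * ‖w‖) * s) :=
          MeasureTheory.integral_const_mul _ _
      _ ≤ _ := by gcongr; exact hAr _ hr
  rw [norm_mul, ← le_div_iff₀ hg] at h1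
  refine h1.trans (le_of_eq ?_)
  field_simp

noncomputable def svc (k : ℕ) : ℂ := Complex.Gamma ((k : ℂ) + 1 / 2) / Real.pi

theorem svc_succ (k : ℕ) : svc (k + 1) = ((k : ℂ) + 1 / 2) * svc k := by
  have hne : (k : ℂ) + 1 / 2 ≠ 0 := by
    intro h; have := congrArg Complex.re h; simp at this
    have h3 : (0 : ℝ) ≤ k := Nat.cast_nonneg k; linarith
  rw [svc, svc, show ((k + 1 : ℕ) : ℂ) + 1 / 2 = ((k : ℂ) + 1 / 2) + 1 by push_cast; ring,
      Complex.Gamma_add_one _ hne]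
  ring

theorem svc_zero : svc 0 = 1 / Complex.Gamma (1 / 2) := by
  have h := Complex.Gamma_mul_Gamma_one_sub (1 / 2)
  rw [show (1 : ℂ) - 1 / 2 = 1 / 2 by norm_num, show (Real.pi : ℂ) * (1 / 2) = Real.pi / 2 by ring,
    Complex.sin_pi_div_two] at h
  have hg : Complex.Gamma (1 / 2) ≠ 0 := (Complex.Gamma_ne_zero_of_re_pos (by norm_num))
  have hp : (Real.pi : ℂ) ≠ 0 := by exact_mod_cast Real.pi_ne_zero
  rw [svc, Nat.cast_zero, zero_add, div_eq_div_iff hp hg, h]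
  ring

theorem sv_G_rec (P : Polynomial ℂ) (w : ℂ) :
    svG ((Polynomial.X + Polynomial.C (1 / 2)) * P) w =
      P.eval 0 * svc 0 - w * svG (P.comp (Polynomial.X + 1)) w := by
  have hs := sv_summG ((Polynomial.X + Polynomial.C (1 / 2)) * P) w
  rw [svG, hs.tsum_eq_zero_add, svG, ← tsum_mul_left, sub_eq_add_neg, ← tsum_neg]
  congr 1
  · rw [svc_zero]
    have h2 := Complex.Gamma_add_one (1 / 2) (by norm_num)
    rw [show (1 / 2 : ℂ) + 1 = 3 / 2 by norm_num] at h2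
    have hg : Complex.Gamma (1 / 2) ≠ 0 := (Complex.Gamma_ne_zero_of_re_pos (by norm_num))
    simp only [Polynomial.eval_mul, Polynomial.eval_add, Polynomial.eval_X, Polynomial.eval_C,
      Nat.cast_zero, zero_add, pow_zero, h2]
    field_simp
  · refine tsum_congr fun n => ?_
    have hne : (n : ℂ) + 3 / 2 ≠ 0 := by
      intro h; have := congrArg Complex.re h; simp at this
      have h3 : (0 : ℝ) ≤ n := Nat.cast_nonneg n; linarith
    have hg : Complex.Gamma ((n : ℂ) + 3 / 2) ≠ 0 := 
      Complex.Gamma_ne_zero_of_re_pos (by simp; positivity)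
    rw [show ((n + 1 : ℕ) : ℂ) + 3 / 2 = ((n : ℂ) + 3 / 2) + 1 by push_cast; ring,
      Complex.Gamma_add_one _ hne]
    simp only [Polynomial.eval_mul, Polynomial.eval_add, Polynomial.eval_X, Polynomial.eval_C,
      Polynomial.eval_comp, Polynomial.eval_one]
    rw [div_eq_iff (mul_ne_zero hne hg)]
    push_cast
    rw [pow_succ]
    have hgg : (Complex.Gamma ((n : ℂ) + 3 / 2))⁻¹ * Complex.Gamma ((n : ℂ) + 3 / 2) = 1 :=
      inv_mul_cancel₀ hg
    linear_combination (w * P.eval ((n : ℂ) + 1) * (-w) ^ n * ((n : ℂ) + 3 / 2)) * hgg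

theorem sv_G_exp (c : ℝ) (hc : 0 < c) (M : ℕ) : ∀ P : Polynomial ℂ,
    ∃ C : ℝ, 0 ≤ C ∧ ∀ w : ℂ, w ≠ 0 → c * ‖w‖ ≤ w.re →
      ‖svG P w - ∑ k ∈ Finset.range M, P.eval (-(k : ℂ) - 1) * svc k / w ^ (k + 1)‖
        ≤ C / ‖w‖ ^ (M + 1) := by
  induction M with
  | zero => intro P; simpa using sv_G_bound P c hc
  | succ M ih =>
    intro P
    set R := P.comp (Polynomial.X - 1) with hR
    obtain ⟨C, hC, h⟩ := ih ((Polynomial.X + Polynomial.C (1 / 2)) * R)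
    refine ⟨C, hC, fun w hw hwc => ?_⟩
    have hw' : 0 < ‖w‖ := norm_pos_iff.2 hw
    have h1 := h w hw hwc
    have hRP : R.comp (Polynomial.X + 1) = P := by
      rw [hR, Polynomial.comp_assoc]; simp
    rw [sv_G_rec, hRP] at h1
    rw [pow_succ _ (M + 1), ← div_div, le_div_iff₀ hw', ← norm_mul, ← norm_neg]
    refine le_trans (le_of_eq ?_) h1
    congr 1
    rw [Finset.sum_range_succ', sub_mul, add_mul, Finset.sum_mul, neg_sub]
    have e0 : P.eval (-((0 : ℕ) : ℂ) - 1) * svc 0 / w ^ (0 + 1) * w = R.eval 0 * svc 0 := by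
      simp [hR, hw]
    have e1 : ∀ k ∈ Finset.range M, 
        P.eval (-((k + 1 : ℕ) : ℂ) - 1) * svc (k + 1) / w ^ (k + 1 + 1) * w = 
        -(((Polynomial.X + Polynomial.C (1 / 2)) * R).eval (-(k : ℂ) - 1) * svc k 
          / w ^ (k + 1)) := by
      intro k _
      rw [svc_succ]
      simp only [hR, Polynomial.eval_mul, Polynomial.eval_add, Polynomial.eval_X, 
        Polynomial.eval_C, Polynomial.eval_comp, Polynomial.eval_one, Polynomial.eval_sub]
      rw [show (-((k + 1 : ℕ) : ℂ) - 1) = -(k : ℂ) - 1 - 1 by push_cast; ring]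
      field_simp
      ring
    rw [e0, Finset.sum_congr rfl e1, Finset.sum_neg_distrib]
    ring

theorem sv_laplace_int (s : ℝ) (hs : 0 < s) (u : ℂ) (hu : 0 < u.re) :
    MeasureTheory.IntegrableOn (fun v : ℝ => ((v ^ (s - 1) : ℝ) : ℂ) * Complex.exp (-u * v))
      (Set.Ioi 0) := by
  have h := integrableOn_rpow_mul_exp_neg_mul_rpow (p := 1) (s := s - 1) (b := u.re)
    (by linarith) one_pos hu
  refine MeasureTheory.Integrable.mono' h (by fun_prop) ?_
  filter_upwards [MeasureTheory.ae_restrict_mem measurableSet_Ioi] with v hv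
  have hv' : (0 : ℝ) < v := hv
  rw [norm_mul, Complex.norm_real, Real.norm_of_nonneg (by positivity), Complex.norm_exp]
  simp

theorem sv_laplace (s : ℝ) (hs : 0 < s) (u : ℂ) (hu : 0 < u.re) :
    ∫ v in Set.Ioi (0 : ℝ), ((v ^ (s - 1) : ℝ) : ℂ) * Complex.exp (-u * v) =
      u ^ (-(s : ℂ)) * Complex.Gamma s := by
  set h : ℂ → ℂ := fun u => ∫ v in Set.Ioi (0 : ℝ), ((v ^ (s - 1) : ℝ) : ℂ) * Complex.exp (-u * v)
    with hh
  set U : Set ℂ := {u | 0 < u.re} with hU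
  have hUo : IsOpen U := isOpen_lt continuous_const Complex.continuous_re
  have hd : DifferentiableOn ℂ h U := by
    intro u0 hu0
    have hu0' : 0 < u0.re := hu0
    have hint := integrableOn_rpow_mul_exp_neg_mul_rpow (p := 1) (s := s) (b := u0.re / 2)
      (by linarith) one_pos (by positivity)
    have key := hasDerivAt_integral_of_dominated_loc_of_deriv_le
      (μ := MeasureTheory.volume.restrict (Set.Ioi (0 : ℝ)))
      (F := fun (u : ℂ) (v : ℝ) => ((v ^ (s - 1) : ℝ) : ℂ) * Complex.exp (-u * v))
      (F' := fun (u : ℂ) (v : ℝ) => ((v ^ (s - 1) : ℝ) : ℂ) * (Complex.exp (-u * v) * (-v)))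
      (x₀ := u0) (s := Metric.ball u0 (u0.re / 2))
      (bound := fun v : ℝ => v ^ s * Real.exp (-(u0.re / 2) * v ^ (1 : ℝ)))
      (Metric.ball_mem_nhds _ (by positivity))
      (Eventually.of_forall fun u => by fun_prop)
      (sv_laplace_int s hs u0 hu0)
      (by fun_prop)
      (by
        filter_upwards [MeasureTheory.ae_restrict_mem measurableSet_Ioi] with v hv u hu
        have hv' : (0 : ℝ) < v := hv
        have h1 : u0.re / 2 ≤ u.re := by
          have h2 := Complex.abs_re_le_norm (u - u0)
          rw [Metric.mem_ball, dist_eq_norm] at hu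
          have h3 := abs_le.1 (h2.trans hu.le)
          simp at h3
          linarith [h3.1]
        rw [norm_mul, norm_mul, Complex.norm_real, Real.norm_of_nonneg (by positivity),
          Complex.norm_exp, norm_neg, Complex.norm_real, Real.norm_of_nonneg hv'.le]
        have h4 : (-u * (v : ℂ)).re = -u.re * v := by simp
        have h5 : v ^ s = v ^ (s - 1) * v := by
          rw [Real.rpow_sub_one hv'.ne']; field_simp
        rw [h4, h5, Real.rpow_one, mul_assoc, mul_comm v]
        gcongr)
      hint
      (by
        refine Eventually.of_forall fun v u hu => ?_
        have : HasDerivAt (fun u : ℂ => -u * (v : ℂ)) (-v) u := by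
          simpa using (hasDerivAt_id u).neg.mul_const (v : ℂ)
        exact this.cexp.const_mul _)
    exact key.2.differentiableAt.differentiableWithinAt
  have hg : DifferentiableOn ℂ (fun u : ℂ => u ^ (-(s : ℂ)) * Complex.Gamma s) U := by
    intro u0 hu0
    refine DifferentiableAt.differentiableWithinAt ?_
    refine DifferentiableAt.mul_const ?_ _
    exact differentiableAt_id.cpow_const (Or.inl hu0)
  have hpre : IsPreconnected U := (convex_halfSpace_re_gt 0).isPreconnected
  have hreal : ∀ r : ℝ, 0 < r → h r = (r : ℂ) ^ (-(s : ℂ)) * Complex.Gamma s := by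
    intro r hr
    have h1 := Complex.integral_cpow_mul_exp_neg_mul_Ioi (a := s) (r := r) (by simpa) hr
    rw [one_div, Complex.inv_cpow _ _ (by
      rw [Complex.arg_ofReal_of_nonneg hr.le]; exact Real.pi_pos.ne), ← Complex.cpow_neg] at h1
    rw [← h1]
    refine MeasureTheory.setIntegral_congr_fun measurableSet_Ioi fun v hv => ?_
    have hv' : (0 : ℝ) < v := hv
    rw [Complex.ofReal_cpow hv'.le]
    push_cast
    ring_nf
  refine (hd.analyticOnNhd hUo).eqOn_of_preconnected_of_frequently_eq (hg.analyticOnNhd hUo) hpre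
    (z₀ := 1) (by simp [hU]) ?_ hu
  have ht : Tendsto (fun n : ℕ => ((1 + 1 / ((n : ℝ) + 1) : ℝ) : ℂ)) atTop (𝓝[≠] 1) := by
    refine tendsto_nhdsWithin_iff.2 ⟨?_, Eventually.of_forall fun n => ?_⟩
    · have := (tendsto_one_div_add_atTop_nhds_zero_nat (𝕜 := ℝ)).const_add 1
      rw [add_zero] at this
      exact_mod_cast (Complex.continuous_ofReal.tendsto 1).comp this
    · have : (0 : ℝ) < 1 / ((n : ℝ) + 1) := by positivity
      intro h
      rw [Set.mem_singleton_iff, ← Complex.ofReal_one] at h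
      have h2 : (1 + 1 / ((n : ℝ) + 1) : ℝ) = 1 := Complex.ofReal_injective h
      linarith
  exact ht.frequently (Frequently.of_forall fun n => hreal _ (by positivity))

noncomputable def svu (y : ℝ) : ℂ := 1 + ((2 * Real.pi * y : ℝ) : ℂ) * Complex.I

theorem svu_re (y : ℝ) : (svu y).re = 1 := by simp [svu]

theorem svu_ne (y : ℝ) : svu y ≠ 0 := by
  intro h; have := svu_re y; rw [h] at this; simp at this

theorem svu_meas : Measurable svu := by unfold svu; fun_prop

theorem svu_norm (y : ℝ) (s : ℝ) : ‖svu y‖ ^ (-s) = (1 + ‖2 * Real.pi * y‖ ^ 2) ^ (-s / 2) := by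
  have : ‖svu y‖ = (1 + ‖2 * Real.pi * y‖ ^ 2) ^ (1 / 2 : ℝ) := by
    rw [← Real.sqrt_eq_rpow, svu, ← Complex.ofReal_one, Complex.norm_add_mul_I, Real.norm_eq_abs, sq_abs,
      one_pow]
  rw [this, ← Real.rpow_mul (by positivity)]
  congr 1; ring

theorem svu_one_le (y : ℝ) : 1 ≤ ‖svu y‖ := by
  have := Complex.re_le_norm (svu y); rwa [svu_re] at this

theorem svu_int (s : ℝ) (hs : 1 < s) : MeasureTheory.Integrable (fun y : ℝ => ‖svu y‖ ^ (-s)) := by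
  have h := integrable_rpow_neg_one_add_norm_sq (E := ℝ) (μ := MeasureTheory.volume) (r := s)
    (by simpa using hs)
  have h2 := h.comp_mul_left' (R := 2 * Real.pi) (by positivity)
  simpa only [svu_norm] using h2

theorem svu_cpow_int (s : ℝ) (hs : 1 < s) :
    MeasureTheory.Integrable (fun y : ℝ => Complex.exp (svu y) * svu y ^ (-(s : ℂ))) := by
  have hm := svu_meas
  refine MeasureTheory.Integrable.mono' ((svu_int s hs).const_mul (Real.exp 1)) (by fun_prop) ?_
  refine Eventually.of_forall fun y => ?_
  rw [norm_mul, Complex.norm_exp, svu_re, ← Complex.ofReal_neg, Complex.norm_cpow_real]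

open FourierTransform in
theorem sv_inv (s : ℝ) (hs : 1 < s) :
    ∫ y : ℝ, Complex.exp (svu y) * svu y ^ (-(s : ℂ)) = 1 / Complex.Gamma s := by
  set f : ℝ → ℂ := Set.indicator (Set.Ioi 0)
    (fun v : ℝ => ((v ^ (s - 1) : ℝ) : ℂ) * Complex.exp (-1 * v)) with hf
  have hfi : MeasureTheory.Integrable f :=
    (MeasureTheory.integrable_indicator_iff measurableSet_Ioi).2
      (sv_laplace_int s (by linarith) 1 (by simp))
  have hF : 𝓕 f = fun y => svu y ^ (-(s : ℂ)) * Complex.Gamma s := by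
    funext y
    rw [Real.fourier_real_eq_integral_exp_smul, ← sv_laplace s (by linarith) (svu y)
      (by rw [svu_re]; exact one_pos), ← MeasureTheory.integral_indicator measurableSet_Ioi]
    congr 1
    funext v
    by_cases hv : v ∈ Set.Ioi (0 : ℝ)
    · rw [hf, Set.indicator_of_mem hv, Set.indicator_of_mem hv, smul_eq_mul, mul_left_comm,
        ← Complex.exp_add]
      congr 2
      simp only [svu]; push_cast; ring
    · rw [hf, Set.indicator_of_notMem hv, Set.indicator_of_notMem hv, smul_zero]
  have hm := svu_meas
  have hFi : MeasureTheory.Integrable (𝓕 f) := by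
    rw [hF]
    refine MeasureTheory.Integrable.mul_const ?_ _
    refine MeasureTheory.Integrable.mono' (svu_int s hs)
      (hm.pow_const _).aestronglyMeasurable ?_
    refine Eventually.of_forall fun y => ?_
    rw [← Complex.ofReal_neg, Complex.norm_cpow_real]
  have hc : ContinuousAt f 1 := by
    have : f =ᶠ[𝓝 1] (fun v : ℝ => ((v ^ (s - 1) : ℝ) : ℂ) * Complex.exp (-1 * v)) := by
      filter_upwards [Ioi_mem_nhds (zero_lt_one' ℝ)] with v hv
      rw [hf, Set.indicator_of_mem hv]
    refine ContinuousAt.congr ?_ this.symm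
    refine ContinuousAt.mul ?_ (by fun_prop)
    exact Complex.continuous_ofReal.continuousAt.comp
      (Real.continuousAt_rpow_const _ _ (Or.inl one_ne_zero))
  have key := hfi.fourierInv_fourier_eq hFi hc
  rw [Real.fourierInv_eq', hF] at key
  have hg : Complex.Gamma s ≠ 0 := Complex.Gamma_ne_zero_of_re_pos (by simp; linarith)
  rw [eq_div_iff hg, ← MeasureTheory.integral_mul_const]
  have e : ∀ y : ℝ, Complex.exp (svu y) * svu y ^ (-(s : ℂ)) * Complex.Gamma s =
      Complex.exp 1 * (Complex.exp (((2 * Real.pi * inner ℝ y (1 : ℝ) : ℝ) : ℂ) * Complex.I) •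
        (svu y ^ (-(s : ℂ)) * Complex.Gamma s)) := by
    intro y
    rw [smul_eq_mul, ← mul_assoc (Complex.exp 1), ← Complex.exp_add, mul_assoc]
    congr 2
    simp [svu]
  simp_rw [e]
  rw [MeasureTheory.integral_const_mul, key, hf, Set.indicator_of_mem (by simp)]
  simp [← Complex.exp_add]

theorem sv_cpow_sum (a β : ℝ) (y : ℝ) (n : ℕ) :
    svu y ^ (-((a * n + β : ℝ) : ℂ)) = svu y ^ (-(β : ℂ)) * (svu y ^ (-(a : ℂ))) ^ n := by
  rw [← Complex.cpow_nat_mul, ← Complex.cpow_add _ _ (svu_ne y)]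
  congr 1; push_cast; ring

theorem sv_cpow_sub (a β : ℝ) (y : ℝ) (n : ℕ) :
    svu y ^ (-((β - a * n : ℝ) : ℂ)) = svu y ^ (-(β : ℂ)) / (svu y ^ (-(a : ℂ))) ^ n := by
  rw [← Complex.cpow_nat_mul, ← Complex.cpow_sub _ _ (svu_ne y)]
  congr 1; push_cast; ring

theorem svu_norm_le_one (y a : ℝ) (ha : 0 ≤ a) : ‖svu y ^ (-(a : ℂ))‖ ≤ 1 := by
  rw [← Complex.ofReal_neg, Complex.norm_cpow_real]
  exact Real.rpow_le_one_of_one_le_of_nonpos (svu_one_le y) (by linarith)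

theorem sv_swap (P : Polynomial ℂ) (a β x : ℝ) (ha : 0 < a) (hβ : 1 < β) (hx : 0 < x) :
    MeasureTheory.Integrable (fun y : ℝ => Complex.exp (svu y) * svu y ^ (-(β : ℂ)) *
      svG P (x * svu y ^ (-(a : ℂ)))) ∧
    ∑' n : ℕ, P.eval (n : ℂ) * (-(x : ℂ)) ^ n / Complex.Gamma ((n : ℂ) + 3 / 2) *
      (1 / Complex.Gamma ((a * n + β : ℝ) : ℂ)) =
    ∫ y : ℝ, Complex.exp (svu y) * svu y ^ (-(β : ℂ)) * svG P (x * svu y ^ (-(a : ℂ))) := by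
  have hs := sv_summ P x hx.le
  set F : ℕ → ℝ → ℂ := fun n y =>
    P.eval (n : ℂ) * (-(x : ℂ)) ^ n / Complex.Gamma ((n : ℂ) + 3 / 2) *
      (Complex.exp (svu y) * svu y ^ (-((a * n + β : ℝ) : ℂ))) with hF
  have hβn : ∀ n : ℕ, 1 < a * n + β := fun n => by
    have : 0 ≤ a * n := by positivity
    linarith
  have hFi : ∀ n, MeasureTheory.Integrable (F n) := fun n =>
    (svu_cpow_int _ (hβn n)).const_mul _
  have hFn : ∀ n y, ‖F n y‖ ≤ ‖P.eval (n : ℂ)‖ * x ^ n / ‖Complex.Gamma ((n : ℂ) + 3 / 2)‖ *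
      (Real.exp 1 * ‖svu y‖ ^ (-β)) := by
    intro n y
    have h1 : ‖svu y ^ (-((a * n + β : ℝ) : ℂ))‖ ≤ ‖svu y‖ ^ (-β) := by
      rw [← Complex.ofReal_neg, Complex.norm_cpow_real]
      exact Real.rpow_le_rpow_of_exponent_le (svu_one_le y) (by
        have : 0 ≤ a * n := by positivity
        linarith)
    simp only [hF]
    rw [norm_mul, norm_mul (Complex.exp _), norm_div, norm_mul, norm_pow, norm_neg,
      Complex.norm_real, Real.norm_of_nonneg hx.le, Complex.norm_exp, svu_re]
    gcongr
  have hFs : ∀ y, HasSum (fun n => F n y) (Complex.exp (svu y) * svu y ^ (-(β : ℂ)) *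
      svG P (x * svu y ^ (-(a : ℂ)))) := by
    intro y
    have := (sv_summG P (x * svu y ^ (-(a : ℂ)))).hasSum.mul_left
      (Complex.exp (svu y) * svu y ^ (-(β : ℂ)))
    refine this.congr_fun ?_ |> id
    intro n
    simp only [hF]
    rw [sv_cpow_sum, neg_mul_eq_neg_mul, mul_pow]
    ring
  have hI := (svu_int β hβ).const_mul (Real.exp 1)
  constructor
  · refine MeasureTheory.Integrable.mono' (hI.const_mul
      (∑' n : ℕ, ‖P.eval (n : ℂ)‖ * x ^ n / ‖Complex.Gamma ((n : ℂ) + 3 / 2)‖)) ?_ ?_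
    · refine aestronglyMeasurable_of_tendsto_ae atTop
        (f := fun N y => ∑ n ∈ Finset.range N, F n y) (fun N => ?_)
        (Eventually.of_forall fun y => (hFs y).tendsto_sum_nat)
      exact (MeasureTheory.integrable_finsetSum _ fun n _ => hFi n).aestronglyMeasurable
    · refine Eventually.of_forall fun y => ?_
      rw [← (hFs y).tsum_eq]
      exact tsum_of_norm_bounded (hs.hasSum.mul_right _) fun n => hFn n y
  · have key := MeasureTheory.hasSum_integral_of_summable_integral_norm hFi (by
      refine Summable.of_nonneg_of_le (fun n => by positivity) (fun n => ?_)
        (hs.mul_right (∫ y : ℝ, Real.exp 1 * ‖svu y‖ ^ (-β)))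
      rw [← MeasureTheory.integral_const_mul]
      exact MeasureTheory.integral_mono (hFi n).norm (hI.const_mul _) (hFn n))
    have e : ∀ y, ∑' n, F n y = Complex.exp (svu y) * svu y ^ (-(β : ℂ)) *
      svG P (x * svu y ^ (-(a : ℂ))) := fun y => (hFs y).tsum_eq
    simp_rw [e] at key
    rw [← key.tsum_eq]
    refine tsum_congr fun n => ?_
    simp only [hF]
    rw [MeasureTheory.integral_const_mul, sv_inv _ (hβn n)]

theorem sv_sector (a x y : ℝ) (ha0 : 0 < a) (ha1 : a < 1) (hx : 0 < x) :
    Real.cos (a * (Real.pi / 2)) * ‖(x : ℂ) * svu y ^ (-(a : ℂ))‖ ≤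
      ((x : ℂ) * svu y ^ (-(a : ℂ))).re := by
  rw [norm_mul, Complex.norm_real, Real.norm_of_nonneg hx.le, Complex.re_ofReal_mul,
    ← Complex.ofReal_neg, Complex.norm_cpow_real, Complex.cpow_ofReal_re]
  have h : |(svu y).arg| < Real.pi / 2 :=
    Complex.abs_arg_lt_pi_div_two_iff.2 (Or.inl (by rw [svu_re]; exact one_pos))
  have hcos : Real.cos (a * (Real.pi / 2)) ≤ Real.cos ((svu y).arg * -a) := by
    rw [← Real.cos_abs ((svu y).arg * -a), abs_mul, abs_neg, abs_of_pos ha0]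
    refine Real.cos_le_cos_of_nonneg_of_le_pi (by positivity) (by nlinarith [Real.pi_pos]) ?_
    rw [mul_comm]
    exact mul_le_mul_of_nonneg_left h.le ha0.le
  have hp : 0 ≤ x * ‖svu y‖ ^ (-a) := by positivity
  calc _ ≤ Real.cos ((svu y).arg * -a) * (x * ‖svu y‖ ^ (-a)) :=
        mul_le_mul_of_nonneg_right hcos hp
    _ = _ := by ring

theorem sv_poch (a b : ℝ) (m : ℕ) : ∃ P : Polynomial ℂ, ∀ z : ℂ,
    P.eval z * (1 / Complex.Gamma ((a : ℂ) * z + b + m)) = 1 / Complex.Gamma ((a : ℂ) * z + b) := by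
  induction m with
  | zero => exact ⟨1, fun z => by simp⟩
  | succ m ih =>
    obtain ⟨P, hP⟩ := ih
    refine ⟨P * (Polynomial.C (a : ℂ) * Polynomial.X + Polynomial.C ((b : ℂ) + m)), fun z => ?_⟩
    rw [← hP z, one_div, one_div,
      Complex.one_div_Gamma_eq_self_mul_one_div_Gamma_add_one ((a : ℂ) * z + b + m)]
    simp only [Polynomial.eval_mul, Polynomial.eval_add, Polynomial.eval_X, Polynomial.eval_C]
    push_cast
    rw [← add_assoc, ← add_assoc, mul_assoc]

theorem sv_main (a b : ℝ) (ha0 : 0 < a) (ha1 : a < 1) (M : ℕ) :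
    ∃ C : ℝ, 0 ≤ C ∧ ∀ x : ℝ, 0 < x →
      ‖(∑' n : ℕ, (-(x : ℂ)) ^ n / (Complex.Gamma ((n : ℂ) + 3 / 2) *
          Complex.Gamma ((a : ℂ) * n + b))) -
        ∑ k ∈ Finset.range M, svc k / (x : ℂ) ^ (k + 1) *
          (1 / Complex.Gamma ((b - a * (k + 1) : ℝ) : ℂ))‖ ≤ C / x ^ (M + 1) := by
  obtain ⟨m, hm⟩ := exists_nat_gt (1 + a * (M + 1) - b)
  obtain ⟨P, hP⟩ := sv_poch a b m
  have hc : 0 < Real.cos (a * (Real.pi / 2)) := by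
    refine Real.cos_pos_of_mem_Ioo ⟨?_, ?_⟩ <;> nlinarith [Real.pi_pos]
  obtain ⟨C, hC, hG⟩ := sv_G_exp _ hc M P
  set β : ℝ := b + m with hβ
  have hβk : ∀ k : ℕ, k ≤ M → 1 < β - a * ((k + 1 : ℕ) : ℝ) := by
    intro k hk
    have : (k : ℝ) ≤ M := by exact_mod_cast hk
    push_cast
    nlinarith
  have hβ1 : 1 < β := by
    have := hβk 0 (Nat.zero_le _)
    push_cast at this
    linarith
  set K : ℝ := ∫ y : ℝ, Real.exp 1 * ‖svu y‖ ^ (-(β - a * ((M + 1 : ℕ) : ℝ))) with hK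
  have hK0 : 0 ≤ K := MeasureTheory.integral_nonneg fun y => by positivity
  refine ⟨C * K, by positivity, fun x hx => ?_⟩
  obtain ⟨hI, hS⟩ := sv_swap P a β x ha0 hβ1 hx
  have e1 : (∑' n : ℕ, (-(x : ℂ)) ^ n / (Complex.Gamma ((n : ℂ) + 3 / 2) *
          Complex.Gamma ((a : ℂ) * n + b))) =
      ∫ y : ℝ, Complex.exp (svu y) * svu y ^ (-(β : ℂ)) * svG P (x * svu y ^ (-(a : ℂ))) := by
    rw [← hS]
    refine tsum_congr fun n => ?_
    rw [← div_div, div_eq_mul_one_div _ (Complex.Gamma ((a : ℂ) * n + b)), ← hP n]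
    rw [show ((a * n + β : ℝ) : ℂ) = (a : ℂ) * n + b + m by rw [hβ]; push_cast; ring]
    ring
  set B : ℕ → ℝ → ℂ := fun k y => P.eval (-(k : ℂ) - 1) * svc k / (x : ℂ) ^ (k + 1) *
    (Complex.exp (svu y) * svu y ^ (-((β - a * ((k + 1 : ℕ) : ℝ) : ℝ) : ℂ))) with hB
  have hBi : ∀ k ∈ Finset.range M, MeasureTheory.Integrable (B k) := fun k hk =>
    (svu_cpow_int _ (hβk k (Finset.mem_range.1 hk).le)).const_mul _
  have e2 : ∀ k ∈ Finset.range M, svc k / (x : ℂ) ^ (k + 1) *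
          (1 / Complex.Gamma ((b - a * (k + 1) : ℝ) : ℂ)) = ∫ y : ℝ, B k y := by
    intro k hk
    simp only [hB]
    rw [MeasureTheory.integral_const_mul, sv_inv _ (hβk k (Finset.mem_range.1 hk).le)]
    have := hP (-(k : ℂ) - 1)
    rw [show (a : ℂ) * (-(k : ℂ) - 1) + b + m = ((β - a * ((k + 1 : ℕ) : ℝ) : ℝ) : ℂ) by
      rw [hβ]; push_cast; ring, show (a : ℂ) * (-(k : ℂ) - 1) + b =
        ((b - a * (k + 1) : ℝ) : ℂ) by push_cast; ring] at this
    rw [← this]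
    ring
  rw [e1, Finset.sum_congr rfl e2, ← MeasureTheory.integral_finsetSum _ hBi,
    ← MeasureTheory.integral_sub hI (MeasureTheory.integrable_finsetSum _ hBi)]
  have hbd : ∀ y : ℝ, ‖Complex.exp (svu y) * svu y ^ (-(β : ℂ)) *
      svG P (x * svu y ^ (-(a : ℂ))) - ∑ k ∈ Finset.range M, B k y‖ ≤
      C / x ^ (M + 1) * (Real.exp 1 * ‖svu y‖ ^ (-(β - a * ((M + 1 : ℕ) : ℝ)))) := by
    intro y
    set w : ℂ := x * svu y ^ (-(a : ℂ)) with hw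
    have hxc : (x : ℂ) ≠ 0 := by exact_mod_cast hx.ne'
    have hua : svu y ^ (-(a : ℂ)) ≠ 0 := by
      rw [Complex.cpow_ne_zero_iff]; exact Or.inl (svu_ne y)
    have hw0 : w ≠ 0 := mul_ne_zero hxc hua
    have h1 := hG w hw0 (sv_sector a x y ha0 ha1 hx)
    have e3 : ∀ k ∈ Finset.range M, B k y = Complex.exp (svu y) * svu y ^ (-(β : ℂ)) *
        (P.eval (-(k : ℂ) - 1) * svc k / w ^ (k + 1)) := by
      intro k _
      simp only [hB]
      rw [sv_cpow_sub, hw, mul_pow]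
      field_simp
    rw [Finset.sum_congr rfl e3, ← Finset.mul_sum, ← mul_sub, norm_mul]
    have e4 : ‖Complex.exp (svu y) * svu y ^ (-(β : ℂ))‖ * (C / ‖w‖ ^ (M + 1)) =
        C / x ^ (M + 1) * (Real.exp 1 * ‖svu y‖ ^ (-(β - a * ((M + 1 : ℕ) : ℝ)))) := by
      have h5 := congrArg norm (sv_cpow_sub a β y (M + 1))
      rw [← Complex.ofReal_neg, Complex.norm_cpow_real] at h5
      rw [h5, hw, norm_mul, norm_mul, norm_div, norm_pow, Complex.norm_exp, svu_re,
        Complex.norm_real, Real.norm_of_nonneg hx.le, mul_pow]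
      have : ‖svu y ^ (-(a : ℂ))‖ ≠ 0 := norm_ne_zero_iff.2 hua
      field_simp
    rw [← e4]
    exact mul_le_mul_of_nonneg_left h1 (norm_nonneg _)
  calc _ ≤ ∫ y : ℝ, C / x ^ (M + 1) *
        (Real.exp 1 * ‖svu y‖ ^ (-(β - a * ((M + 1 : ℕ) : ℝ)))) :=
      MeasureTheory.norm_integral_le_of_norm_le
        (((svu_int _ (hβk M le_rfl)).const_mul _).const_mul _) (Eventually.of_forall hbd)
    _ = _ := by rw [MeasureTheory.integral_const_mul]; ring

/-- Complete algebraic asymptotic expansion of `L_ν(it;a)` on the imaginary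
axis for `0 < a < 1`:
`(it/2)^{−ν−1} L_ν(it;a) ∼ (1/π) Σ_k Γ(k+1/2)(t²/4)^{−k−1}/Γ(ν+3/2−a(1+k))`
as `t → +∞`, with error after `M` terms of order `t^{−2M−2}`. -/
theorem struveL_imaginary_axis_algebraic_expansion (ν a : ℝ)
    (ha0 : 0 < a) (ha1 : a < 1) :
    ∀ M : ℕ, ∃ C > (0 : ℝ), ∃ T > (0 : ℝ), ∀ t : ℝ, T ≤ t →
      ‖(Complex.I * (t : ℂ) / 2) ^ (-(ν : ℂ) - 1) *
          struveL ν a (Complex.I * (t : ℂ)) -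
        ((1 / Real.pi * ∑ k ∈ Finset.range M,
          Real.Gamma ((k : ℝ) + 1 / 2) * (t ^ 2 / 4) ^ (-(k : ℝ) - 1) /
            Real.Gamma (ν + 3 / 2 - a * ((k : ℝ) + 1)) : ℝ) : ℂ)‖
        ≤ C * t ^ (-2 * (M : ℝ) - 2) := by
  intro M
  obtain ⟨C, hC, h⟩ := sv_main a (ν + 3 / 2) ha0 ha1 M
  refine ⟨C * 4 ^ (M + 1) + 1, by positivity, 1, one_pos, fun t ht => ?_⟩
  have ht0 : 0 < t := by linarith
  have hx : 0 < t ^ 2 / 4 := by positivity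
  have h1 := h (t ^ 2 / 4) hx
  have hz : Complex.I * (t : ℂ) / 2 ≠ 0 := by
    have : (t : ℂ) ≠ 0 := by exact_mod_cast ht0.ne'
    simp [this]
  have e1 : (Complex.I * (t : ℂ) / 2) ^ (-(ν : ℂ) - 1) * struveL ν a (Complex.I * (t : ℂ)) =
      ∑' n : ℕ, (-((t ^ 2 / 4 : ℝ) : ℂ)) ^ n / (Complex.Gamma ((n : ℂ) + 3 / 2) *
          Complex.Gamma ((a : ℂ) * n + ((ν + 3 / 2 : ℝ) : ℂ))) := by
    rw [struveL, ← mul_assoc, ← Complex.cpow_add _ _ hz,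
      show -(ν : ℂ) - 1 + ((ν : ℂ) + 1) = 0 by ring, Complex.cpow_zero, one_mul]
    refine tsum_congr fun n => ?_
    have e : (Complex.I * (t : ℂ) / 2) ^ 2 = -((t ^ 2 / 4 : ℝ) : ℂ) := by
      rw [div_pow, mul_pow, Complex.I_sq]; push_cast; ring
    rw [pow_mul, e]
    congr 3
    push_cast
    ring
  have e2 : ((1 / Real.pi * ∑ k ∈ Finset.range M,
          Real.Gamma ((k : ℝ) + 1 / 2) * (t ^ 2 / 4) ^ (-(k : ℝ) - 1) /
            Real.Gamma (ν + 3 / 2 - a * ((k : ℝ) + 1)) : ℝ) : ℂ) =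
      ∑ k ∈ Finset.range M, svc k / ((t ^ 2 / 4 : ℝ) : ℂ) ^ (k + 1) *
          (1 / Complex.Gamma ((ν + 3 / 2 - a * (k + 1) : ℝ) : ℂ)) := by
    rw [Finset.mul_sum, Complex.ofReal_sum]
    refine Finset.sum_congr rfl fun k _ => ?_
    have e3 : (t ^ 2 / 4) ^ (-(k : ℝ) - 1) = ((t ^ 2 / 4) ^ (k + 1))⁻¹ := by
      rw [← Real.rpow_natCast (t ^ 2 / 4), ← Real.rpow_neg hx.le]
      congr 1; push_cast; ring
    rw [e3, svc, show (k : ℂ) + 1 / 2 = ((k + 1 / 2 : ℝ) : ℂ) by push_cast; ring,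
      Complex.Gamma_ofReal, Complex.Gamma_ofReal, ← Complex.ofReal_pow, ← Complex.ofReal_div,
      ← Complex.ofReal_div, ← Complex.ofReal_one, ← Complex.ofReal_div, ← Complex.ofReal_mul]
    congr 1
    ring
  rw [e1, e2]
  refine h1.trans ?_
  have e4 : t ^ (-2 * (M : ℝ) - 2) = (t ^ (2 * (M + 1)))⁻¹ := by
    rw [← Real.rpow_natCast, ← Real.rpow_neg ht0.le]
    congr 1; push_cast; ring
  have e5 : C / (t ^ 2 / 4) ^ (M + 1) = C * 4 ^ (M + 1) * (t ^ (2 * (M + 1)))⁻¹ := by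
    rw [div_pow, ← pow_mul, div_div_eq_mul_div, div_eq_mul_inv]
  rw [e4, e5]
  have : 0 ≤ (t ^ (2 * (M + 1)))⁻¹ := by positivity
  linarith
end

section
/- Let ν be real and a > 1. Set κ = 1 + a, h = a^{−a}, ϑ = −ν − 3/2, A₀ = (κ/a)^{ν+1}/√(2π), and for t > 0 set X(t) = κ (h t²/4)^{1/κ}. Then, as t → +∞ through positive real values, (i t/2)^{−ν−1} L_ν(i t; a) · X(t)^{ν+3/2} · e^{−X(t) cos(π/κ)} − 2 A₀ cos( X(t) sin(π/κ) + πϑ/κ ) → 0, where (i t/2)^{−ν−1} is the principal power. In particular, since cos(π/κ) > 0, L_ν(i t;a) is exponentially large as t → +∞ when a > 1. -/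
open Filter Topology

/-- The variable `X = κ (h t²/4)^{1/κ}` with `κ = 1 + a`, `h = a^{−a}`. -/
noncomputable def struveX (a t : ℝ) : ℝ :=
  (1 + a) * (a ^ (-a) * t ^ 2 / 4) ^ (1 / (1 + a))


open MeasureTheory Set in
lemma rpow_exp_integrable {α r : ℝ} (hα : 0 < α) (hr : 0 < r) :
    IntegrableOn (fun t : ℝ => t ^ (α - 1) * Real.exp (-(r * t))) (Ioi 0) := by
  have h := (integrableOn_rpow_mul_exp_neg_mul_rpow (s := α - 1) (p := 1) (by linarith) one_pos hr)
  refine h.congr_fun (fun t ht => ?_) measurableSet_Ioi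
  simp

open MeasureTheory Set in
lemma gammaC_norm (α : ℝ) (r : ℂ) {t : ℝ} (ht : 0 < t) :
    ‖((t ^ (α - 1) : ℝ) : ℂ) * Complex.exp (-(r * t))‖ = t ^ (α - 1) * Real.exp (-(r.re * t)) := by
  rw [norm_mul, Complex.norm_exp, Complex.norm_real, Real.norm_of_nonneg (by positivity)]
  simp

open MeasureTheory Set in
lemma gammaC_meas (α : ℝ) (r : ℂ) : AEStronglyMeasurable
    (fun t : ℝ => ((t ^ (α - 1) : ℝ) : ℂ) * Complex.exp (-(r * t))) (volume.restrict (Ioi 0)) := by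
  apply Measurable.aestronglyMeasurable
  fun_prop

open MeasureTheory Set in
lemma gammaC_integrable {α : ℝ} {r : ℂ} (hα : 0 < α) (hr : 0 < r.re) :
    IntegrableOn (fun t : ℝ => ((t ^ (α - 1) : ℝ) : ℂ) * Complex.exp (-(r * t))) (Ioi 0) := by
  refine (rpow_exp_integrable hα hr).mono' (gammaC_meas α r) ?_
  filter_upwards [ae_restrict_mem measurableSet_Ioi] with t ht
  exact (gammaC_norm α r ht).le

open MeasureTheory Set in
lemma gammaC_diff {α : ℝ} {r : ℂ} (hα : 0 < α) (hr : 0 < r.re) :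
    DifferentiableAt ℂ (fun r : ℂ => ∫ t in Ioi (0:ℝ),
      ((t ^ (α - 1) : ℝ) : ℂ) * Complex.exp (-(r * t))) r := by
  have hs : {z : ℂ | r.re / 2 < z.re} ∈ 𝓝 r :=
    (isOpen_lt continuous_const Complex.continuous_re).mem_nhds (by simp; linarith)
  have := hasDerivAt_integral_of_dominated_loc_of_deriv_le (𝕜 := ℂ)
    (μ := volume.restrict (Ioi (0:ℝ))) (F := fun r t => ((t ^ (α - 1) : ℝ) : ℂ) * Complex.exp (-(r * t)))
    (F' := fun r t => ((t ^ (α - 1) : ℝ) : ℂ) * (Complex.exp (-(r * t)) * (-(t:ℂ))))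
    (x₀ := r) (bound := fun t => t ^ ((α + 1) - 1) * Real.exp (-((r.re/2) * t))) hs
    (Eventually.of_forall fun z => gammaC_meas α z) (gammaC_integrable hα hr)
    (by apply Measurable.aestronglyMeasurable; fun_prop)
    (by
      filter_upwards [ae_restrict_mem measurableSet_Ioi] with t ht z hz
      have ht : 0 < t := ht
      rw [← mul_assoc, norm_mul, gammaC_norm α z ht, norm_neg, Complex.norm_real,
        Real.norm_of_nonneg ht.le, mul_right_comm]
      rw [show t ^ (α - 1) * t = t ^ (α + 1 - 1) by
        rw [← Real.rpow_add_one ht.ne']; ring_nf]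
      gcongr)
    (rpow_exp_integrable (by linarith) (by linarith))
    (by
      filter_upwards [] with t z hz
      refine HasDerivAt.const_mul _ ?_
      have : HasDerivAt (fun z : ℂ => -(z * t)) (-(t:ℂ)) z := by
        simpa using ((hasDerivAt_id' z).mul_const (t:ℂ)).fun_neg
      exact this.cexp)
  exact this.2.differentiableAt

open MeasureTheory Set in
lemma gammaC {α : ℝ} {r : ℂ} (hα : 0 < α) (hr : 0 < r.re) :
    ∫ t in Ioi (0:ℝ), ((t ^ (α - 1) : ℝ) : ℂ) * Complex.exp (-(r * t))
      = r ^ (-(α:ℂ)) * (Real.Gamma α : ℂ) := by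
  let U : Set ℂ := {z | 0 < z.re}
  have hU : IsOpen U := isOpen_lt continuous_const Complex.continuous_re
  have h1 : AnalyticOnNhd ℂ (fun r : ℂ => ∫ t in Ioi (0:ℝ),
      ((t ^ (α - 1) : ℝ) : ℂ) * Complex.exp (-(r * t))) U :=
    DifferentiableOn.analyticOnNhd
      (fun z hz => (gammaC_diff hα hz).differentiableWithinAt) hU
  have h2 : AnalyticOnNhd ℂ (fun r : ℂ => r ^ (-(α:ℂ)) * (Real.Gamma α : ℂ)) U := by
    refine DifferentiableOn.analyticOnNhd (fun z hz => ?_) hU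
    apply DifferentiableAt.differentiableWithinAt
    apply DifferentiableAt.mul_const
    exact differentiableAt_id.cpow (differentiableAt_const _) (Or.inl hz)
  have hc : IsPreconnected U := (convex_halfSpace_re_gt 0).isPreconnected
  refine h1.eqOn_of_preconnected_of_frequently_eq h2 hc (z₀ := 1) (by simp [U]) ?_ hr
  have key : ∀ x : ℝ, 0 < x → ∫ t in Ioi (0:ℝ), ((t ^ (α - 1) : ℝ) : ℂ) * Complex.exp (-((x:ℂ) * t))
      = (x:ℂ) ^ (-(α:ℂ)) * (Real.Gamma α : ℂ) := by
    intro x hx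
    have := Real.integral_rpow_mul_exp_neg_mul_Ioi hα hx
    have h3 := congrArg (fun y : ℝ => (y:ℂ)) this
    rw [← integral_complex_ofReal] at h3
    push_cast at h3 ⊢
    rw [h3]
    congr 1
    rw [Complex.cpow_neg, ← Complex.ofReal_cpow hx.le]
    rw [one_div, Real.inv_rpow hx.le]; push_cast; rfl
  rw [frequently_nhdsWithin_iff]
  have ht : Tendsto (fun n : ℕ => (((1 + 1/((n:ℝ)+1) : ℝ)) : ℂ)) atTop (𝓝 1) := by
    have : Tendsto (fun n : ℕ => ((1 + 1/((n:ℝ)+1) : ℝ))) atTop (𝓝 (1 + 0)) :=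
      tendsto_const_nhds.add tendsto_one_div_add_atTop_nhds_zero_nat
    have h4 := (Complex.continuous_ofReal.tendsto _).comp this
    simpa [Function.comp_def] using h4
  refine ht.frequently (Eventually.frequently (Eventually.of_forall fun n => ⟨key _ (by positivity), ?_⟩))
  simp only [mem_compl_iff, mem_singleton_iff]
  have : (0:ℝ) < 1/((n:ℝ)+1) := by positivity
  intro h
  have := Complex.ofReal_injective (h.trans Complex.ofReal_one.symm)
  linarith


lemma norm_w_ge (c τ : ℝ) : c ≤ ‖(c:ℂ) + τ * Complex.I‖ := by
  have := Complex.re_le_norm ((c:ℂ) + τ * Complex.I)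
  simpa using this

lemma norm_w_ge' (c τ : ℝ) : |τ| ≤ ‖(c:ℂ) + τ * Complex.I‖ := by
  have := Complex.abs_im_le_norm ((c:ℂ) + τ * Complex.I)
  simpa using this

lemma w_ne {c : ℝ} (hc : 0 < c) (τ : ℝ) : (c:ℂ) + τ * Complex.I ≠ 0 := by
  rw [← norm_pos_iff]; exact hc.trans_le (norm_w_ge c τ)

lemma w_re (c τ : ℝ) : ((c:ℂ) + τ * Complex.I).re = c := by simp
lemma w_im (c τ : ℝ) : ((c:ℂ) + τ * Complex.I).im = τ := by simp

lemma w_slit {c : ℝ} (hc : 0 < c) (τ : ℝ) : (c:ℂ) + τ * Complex.I ∈ Complex.slitPlane :=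
  Or.inl (by simpa using hc)

lemma cont_wpow {c : ℝ} (hc : 0 < c) (s : ℂ) :
    Continuous (fun τ : ℝ => ((c:ℂ) + τ * Complex.I) ^ s) := by
  refine Continuous.cpow (by fun_prop) continuous_const (fun τ => w_slit hc τ)

open MeasureTheory in
lemma integrable_norm_w {c s : ℝ} (hc : 0 < c) (hs : 1 < s) :
    Integrable (fun τ : ℝ => ‖(c:ℂ) + τ * Complex.I‖ ^ (-s)) := by
  have h := integrable_one_add_norm (E := ℝ) (μ := volume) (r := s) (by simpa using hs)
  set k := min c 1 / 2 with hk
  have hk0 : 0 < k := by positivity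
  refine (h.const_mul (k ^ (-s))).mono' ?_ (Eventually.of_forall fun τ => ?_)
  · apply Continuous.aestronglyMeasurable
    refine Continuous.rpow_const (by fun_prop) fun τ => Or.inl ?_
    exact norm_ne_zero_iff.2 (w_ne hc τ)
  · rw [Real.norm_of_nonneg (by positivity), ← Real.mul_rpow hk0.le (by positivity)]
    refine Real.rpow_le_rpow_of_nonpos (by positivity) ?_ (by linarith)
    have h1 := norm_w_ge c τ
    have h2 := norm_w_ge' c τ
    have h3 := min_le_left c 1
    have h4 := min_le_right c 1
    rw [Real.norm_eq_abs]
    have := mul_le_mul_of_nonneg_right h4 (abs_nonneg τ)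
    rw [hk]; linarith

open MeasureTheory in
lemma integrable_wpow {c s : ℝ} (hc : 0 < c) (hs : 1 < s) :
    Integrable (fun τ : ℝ => ((c:ℂ) + τ * Complex.I) ^ ((-s : ℝ) : ℂ)) := by
  refine (integrable_norm_w hc hs).mono' (cont_wpow hc _).aestronglyMeasurable
    (Eventually.of_forall fun τ => ?_)
  rw [Complex.norm_cpow_real]

open MeasureTheory Set in
lemma inv_laplace {c s R : ℝ} (hc : 0 < c) (hs : 1 < s) (hR : 0 < R) :
    ∫ τ : ℝ, Complex.exp (R * ((c:ℂ) + τ * Complex.I)) * ((c:ℂ) + τ * Complex.I) ^ ((-s : ℝ) : ℂ)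
      = ((2 * Real.pi * R ^ (s - 1) / Real.Gamma s : ℝ) : ℂ) := by
  let f : ℝ → ℂ := (Ioi (0:ℝ)).indicator
    (fun t : ℝ => ((t ^ (s - 1) : ℝ) : ℂ) * Complex.exp (-((c:ℂ) * t)))
  have hfi : Integrable f := by
    rw [integrable_indicator_iff measurableSet_Ioi]
    exact gammaC_integrable (by linarith) (by simpa using hc)
  have hF : ∀ ξ : ℝ, FourierTransform.fourier f ξ =
      ((c:ℂ) + (2 * Real.pi * ξ : ℝ) * Complex.I) ^ ((-s : ℝ) : ℂ) * (Real.Gamma s : ℂ) := by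
    intro ξ
    rw [Real.fourier_real_eq_integral_exp_smul]
    have h := gammaC (α := s) (r := (c:ℂ) + (2 * Real.pi * ξ : ℝ) * Complex.I) (by linarith)
      (by rw [w_re]; exact hc)
    rw [Complex.ofReal_neg, ← h, ← integral_indicator measurableSet_Ioi]
    congr 1
    ext v
    by_cases hv : v ∈ Ioi (0:ℝ)
    · simp only [f, indicator_of_mem hv, smul_eq_mul]
      rw [mul_left_comm, ← Complex.exp_add]
      congr 2
      push_cast; ring
    · simp [f, indicator_of_notMem hv]
  have hpi := Real.pi_pos
  have hFi : Integrable (FourierTransform.fourier f) := by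
    have h1 := (integrable_wpow hc hs).comp_mul_left' (R := 2 * Real.pi) (by positivity)
    refine (h1.mul_const (Real.Gamma s : ℂ)).congr (Eventually.of_forall fun ξ => ?_)
    simp only [hF]
  have hcont : ContinuousAt f R := by
    have : f =ᶠ[𝓝 R] (fun t : ℝ => ((t ^ (s - 1) : ℝ) : ℂ) * Complex.exp (-((c:ℂ) * t))) := by
      filter_upwards [Ioi_mem_nhds hR] with t ht
      exact indicator_of_mem (s := Ioi (0:ℝ)) ht _
    rw [continuousAt_congr this]
    have : ContinuousAt (fun t : ℝ => t ^ (s - 1)) R := Real.continuousAt_rpow_const _ _ (Or.inl hR.ne')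
    fun_prop
  have hinv := hfi.fourierInv_fourier_eq hFi hcont
  rw [Real.fourierInv_eq'] at hinv
  have hfR : f R = ((R ^ (s - 1) : ℝ) : ℂ) * Complex.exp (-((c:ℂ) * R)) :=
    indicator_of_mem (s := Ioi (0:ℝ)) hR _
  rw [hfR] at hinv
  have hG : Real.Gamma s ≠ 0 := (Real.Gamma_pos_of_pos (by linarith)).ne'
  have hcv := Measure.integral_comp_mul_left (fun τ : ℝ => Complex.exp (R * ((c:ℂ) + τ * Complex.I)) *
    ((c:ℂ) + τ * Complex.I) ^ ((-s : ℝ) : ℂ)) (2 * Real.pi)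
  rw [abs_of_pos (by positivity)] at hcv
  have h2 : ∫ v : ℝ, Complex.exp (((2 * Real.pi * inner ℝ v R : ℝ) : ℂ) * Complex.I) • FourierTransform.fourier f v
      = Real.Gamma s * Complex.exp (-((c:ℂ) * R)) *
        ∫ x : ℝ, Complex.exp (R * ((c:ℂ) + ((2 * Real.pi * x : ℝ) : ℂ) * Complex.I)) *
          ((c:ℂ) + ((2 * Real.pi * x : ℝ) : ℂ) * Complex.I) ^ ((-s : ℝ) : ℂ) := by
    rw [← integral_const_mul]
    congr 1
    ext v
    rw [hF, smul_eq_mul]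
    have : Complex.exp (((2 * Real.pi * inner ℝ v R : ℝ) : ℂ) * Complex.I) =
        Complex.exp (-((c:ℂ) * R)) * Complex.exp (R * ((c:ℂ) + ((2 * Real.pi * v : ℝ) : ℂ) * Complex.I)) := by
      rw [← Complex.exp_add]
      congr 1
      simp
      ring
    rw [this]; ring
  rw [h2, hcv] at hinv
  have he : Complex.exp (-((c:ℂ) * R)) ≠ 0 := Complex.exp_ne_zero _
  set J := ∫ τ : ℝ, Complex.exp (R * ((c:ℂ) + τ * Complex.I)) *
    ((c:ℂ) + τ * Complex.I) ^ ((-s : ℝ) : ℂ)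
  have h3 : (Real.Gamma s : ℂ) * (((2 * Real.pi)⁻¹ : ℝ) * J) = ((R ^ (s - 1) : ℝ) : ℂ) := by
    apply mul_right_cancel₀ he
    rw [← hinv, Complex.real_smul]; ring
  have hG' : (Real.Gamma s : ℂ) ≠ 0 := by exact_mod_cast hG
  have hp : (Real.pi : ℂ) ≠ 0 := by exact_mod_cast hpi.ne'
  rw [Complex.ofReal_div, Complex.ofReal_mul, ← h3]
  push_cast
  field_simp


open MeasureTheory Set in
/-- Un-normalised incomplete gamma type integral. -/
noncomputable def Ii (α : ℝ) (y : ℂ) : ℂ :=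
  ∫ v in Ioc (0:ℝ) 1, ((v ^ (α - 1) : ℝ) : ℂ) * Complex.exp (-(y * v))

open MeasureTheory Set in
lemma rpow_integrableOn {α : ℝ} (hα : 0 < α) :
    IntegrableOn (fun v : ℝ => v ^ (α - 1)) (Ioc 0 1) := by
  rw [← intervalIntegrable_iff_integrableOn_Ioc_of_le zero_le_one]
  exact intervalIntegral.intervalIntegrable_rpow' (by linarith)

open MeasureTheory Set in
lemma rpow_integral {α : ℝ} (hα : 0 < α) :
    ∫ v in Ioc (0:ℝ) 1, v ^ (α - 1) = 1 / α := by
  rw [← intervalIntegral.integral_of_le zero_le_one, integral_rpow (Or.inl (by linarith))]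
  simp [Real.zero_rpow hα.ne']

open MeasureTheory Set in
lemma hasSum_Ii {α : ℝ} (hα : 0 < α) (y : ℂ) :
    HasSum (fun m : ℕ => y ^ m / ((Real.Gamma (m + α + 1) : ℝ) : ℂ))
      (Complex.exp y * Ii α y / (Real.Gamma α : ℝ)) := by
  have hint : ∀ m : ℕ, Integrable (fun v : ℝ => ((v ^ (α - 1) : ℝ) : ℂ) *
      ((((1 - v : ℝ) : ℂ) * y) ^ m / (m.factorial : ℂ))) (volume.restrict (Ioc 0 1)) := by
    intro m
    refine ((rpow_integrableOn hα).mul_const (‖y‖ ^ m / m.factorial)).mono' ?_ ?_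
    · apply Measurable.aestronglyMeasurable; fun_prop
    · filter_upwards [ae_restrict_mem measurableSet_Ioc] with v hv
      rw [norm_mul, Complex.norm_real, Real.norm_of_nonneg (by have := hv.1; positivity), norm_div,
        norm_pow, norm_mul, Complex.norm_real, Real.norm_of_nonneg (by linarith [hv.2]), Complex.norm_natCast]
      have := hv.1
      have h0 := norm_nonneg y
      have h1 : (1 - v) * ‖y‖ ≤ ‖y‖ := by nlinarith [hv.1, hv.2]
      have h2 : 0 ≤ (1 - v) * ‖y‖ := mul_nonneg (by linarith [hv.2]) h0
      gcongr
  have hsum : Summable (fun m : ℕ => ∫ v in Ioc (0:ℝ) 1, ‖((v ^ (α - 1) : ℝ) : ℂ) *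
      ((((1 - v : ℝ) : ℂ) * y) ^ m / (m.factorial : ℂ))‖) := by
    refine Summable.of_nonneg_of_le (fun m => integral_nonneg fun v => norm_nonneg _) (fun m => ?_)
      ((Real.summable_pow_div_factorial ‖y‖).mul_left (1 / α))
    rw [← rpow_integral hα, ← integral_mul_const]
    refine setIntegral_mono_on (hint m).norm ((rpow_integrableOn hα).mul_const _) measurableSet_Ioc fun v hv => ?_
    rw [norm_mul, Complex.norm_real, Real.norm_of_nonneg (by have := hv.1; positivity), norm_div,
      norm_pow, norm_mul, Complex.norm_real, Real.norm_of_nonneg (by linarith [hv.2]), Complex.norm_natCast]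
    have := hv.1
    have h0 := norm_nonneg y
    have h1 : (1 - v) * ‖y‖ ≤ ‖y‖ := by nlinarith [hv.1, hv.2]
    have h2 : 0 ≤ (1 - v) * ‖y‖ := mul_nonneg (by linarith [hv.2]) h0
    gcongr
  have H := hasSum_integral_of_summable_integral_norm hint hsum
  have hG : (Real.Gamma α : ℂ) ≠ 0 := by exact_mod_cast (Real.Gamma_pos_of_pos hα).ne'
  have H2 := H.div_const (Real.Gamma α : ℂ)
  have e2 : Complex.exp y * Ii α y / (Real.Gamma α : ℂ) = (∫ v in Ioc (0:ℝ) 1, ∑' m : ℕ, ((v ^ (α - 1) : ℝ) : ℂ) *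
      ((((1 - v : ℝ) : ℂ) * y) ^ m / (m.factorial : ℂ))) / (Real.Gamma α : ℂ) := by
    congr 1
    rw [Ii, ← integral_const_mul]
    refine setIntegral_congr_fun measurableSet_Ioc fun v hv => ?_
    rw [tsum_mul_left, mul_left_comm, ← Complex.exp_add, Complex.exp_eq_exp_ℂ, NormedSpace.exp_eq_tsum_div]
    rw [show y + -(y * (v:ℂ)) = ((1 - v : ℝ) : ℂ) * y by push_cast; ring]
  rw [e2]
  refine (congrArg (fun f => HasSum f _) (funext fun m => ?_)).mpr H2
  ·
    have hb := Complex.Gamma_mul_Gamma_eq_betaIntegral (s := (α:ℂ)) (t := (m:ℂ) + 1) (by simpa using hα)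
      (by simp only [Complex.add_re, Complex.natCast_re, Complex.one_re]; positivity)
    rw [Complex.betaIntegral, intervalIntegral.integral_of_le zero_le_one, Complex.Gamma_nat_eq_factorial] at hb
    have h3 : ∫ v in Ioc (0:ℝ) 1, ((v ^ (α - 1) : ℝ) : ℂ) *
        ((((1 - v : ℝ) : ℂ) * y) ^ m / (m.factorial : ℂ)) = y ^ m / (m.factorial : ℂ) *
        ∫ v in Ioc (0:ℝ) 1, (v:ℂ) ^ ((α:ℂ) - 1) * (1 - (v:ℂ)) ^ ((m:ℂ) + 1 - 1) := by
      rw [← integral_const_mul]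
      refine setIntegral_congr_fun measurableSet_Ioc fun v hv => ?_
      rw [Complex.ofReal_cpow hv.1.le, add_sub_cancel_right, Complex.cpow_natCast, mul_pow]
      push_cast
      ring
    rw [h3]
    have hG2 : (Real.Gamma (m + α + 1) : ℂ) ≠ 0 := by
      exact_mod_cast (Real.Gamma_pos_of_pos (by positivity)).ne'
    have hG3 : Complex.Gamma ((α:ℂ) + (m + 1)) = ((Real.Gamma (m + α + 1) : ℝ) : ℂ) := by
      rw [← Complex.Gamma_ofReal]; push_cast; ring_nf
    rw [hG3, Complex.Gamma_ofReal] at hb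
    have hm : (m.factorial : ℂ) ≠ 0 := by exact_mod_cast m.factorial_ne_zero
    field_simp
    linear_combination y ^ m * hb

open MeasureTheory Set in
lemma expIi_bound {α : ℝ} (hα : 0 < α) (y : ℂ) :
    ‖Complex.exp y * Ii α y‖ ≤ Real.exp (max y.re 0) / α := by
  rw [Ii, ← integral_const_mul, ← one_div_mul_eq_div, ← rpow_integral hα, ← integral_mul_const]
  refine norm_integral_le_of_norm_le ((rpow_integrableOn hα).mul_const _) ?_
  filter_upwards [ae_restrict_mem measurableSet_Ioc] with v hv
  rw [norm_mul, gammaC_norm _ _ hv.1, Complex.norm_exp, mul_left_comm, ← Real.exp_add]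
  have := hv.1
  gcongr
  have h1 := le_max_left y.re 0
  have h2 := le_max_right y.re 0
  nlinarith [hv.1, hv.2]

open MeasureTheory Set in
lemma Ii_bound {α : ℝ} (hα : 0 < α) {y : ℂ} (hy : 0 < y.re) :
    ‖Ii α y‖ ≤ (1 / y.re) ^ α * Real.Gamma α := by
  rw [← Real.integral_rpow_mul_exp_neg_mul_Ioi hα hy, Ii]
  calc _ ≤ ∫ v in Ioc (0:ℝ) 1, v ^ (α - 1) * Real.exp (-(y.re * v)) := by
        refine norm_integral_le_of_norm_le ((rpow_exp_integrable hα hy).mono_set Ioc_subset_Ioi_self) ?_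
        filter_upwards [ae_restrict_mem measurableSet_Ioc] with v hv
        exact (gammaC_norm _ _ hv.1).le
    _ ≤ _ := by
        refine setIntegral_mono_set (rpow_exp_integrable hα hy) ?_ (Eventually.of_forall Ioc_subset_Ioi_self)
        filter_upwards [ae_restrict_mem measurableSet_Ioi] with v hv
        have : 0 < v := hv
        simp only [Pi.zero_apply]
        positivity

open MeasureTheory Set in
lemma Ii_asymp {α : ℝ} (hα : 0 < α) {y : ℂ} (hy : 0 < y.re) :
    ‖y ^ (-(α:ℂ)) * (Real.Gamma α : ℂ) - Ii α y‖ ≤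
      Real.exp (-(y.re / 2)) * ((1 / (y.re / 2)) ^ α * Real.Gamma α) := by
  have hi := gammaC_integrable hα hy
  rw [← gammaC hα hy, ← Ioc_union_Ioi_eq_Ioi (zero_le_one (α := ℝ)),
    setIntegral_union (Ioc_disjoint_Ioi le_rfl) measurableSet_Ioi
      (hi.mono_set Ioc_subset_Ioi_self) (hi.mono_set (Ioi_subset_Ioi zero_le_one)), Ii, add_sub_cancel_left,
    ← Real.integral_rpow_mul_exp_neg_mul_Ioi hα (half_pos hy), ← integral_const_mul]
  have hi2 := (rpow_exp_integrable hα (half_pos hy)).const_mul (Real.exp (-(y.re / 2)))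
  calc _ ≤ ∫ v in Ioi (1:ℝ), Real.exp (-(y.re / 2)) * (v ^ (α - 1) * Real.exp (-(y.re / 2 * v))) := by
        refine norm_integral_le_of_norm_le (IntegrableOn.mono_set hi2 (Ioi_subset_Ioi zero_le_one)) ?_
        filter_upwards [ae_restrict_mem measurableSet_Ioi] with v hv
        have hv1 : 1 < v := hv
        rw [gammaC_norm _ _ (by linarith), mul_left_comm, ← Real.exp_add]
        gcongr
        nlinarith
    _ ≤ _ := by
        refine setIntegral_mono_set hi2 ?_ (Eventually.of_forall (Ioi_subset_Ioi zero_le_one))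
        filter_upwards [ae_restrict_mem measurableSet_Ioi] with v hv
        have : 0 < v := hv
        simp only [Pi.zero_apply]
        positivity


/-- `q = - w^{-a}` on the line `Re w = c`. -/
noncomputable def qf (a c τ : ℝ) : ℂ := -((c:ℂ) + τ * Complex.I) ^ ((-a : ℝ) : ℂ)

/-- integrand of the inverse Laplace representation -/
noncomputable def Hf (a b c R : ℝ) (N : ℕ) (τ : ℝ) : ℂ :=
  Complex.exp (R * ((c:ℂ) + τ * Complex.I)) * ((c:ℂ) + τ * Complex.I) ^ ((-b : ℝ) : ℂ) *
    ((((R / a : ℝ) : ℂ) * qf a c τ) ^ N *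
      (Complex.exp (((R / a : ℝ) : ℂ) * qf a c τ) * Ii (N + 1/2) (((R / a : ℝ) : ℂ) * qf a c τ) /
        (Real.Gamma (N + 1/2) : ℝ)))

lemma summable_aux {α r : ℝ} (hα : 0 < α) (hr : 0 ≤ r) :
    Summable (fun m : ℕ => r ^ m / Real.Gamma (m + α + 1)) := by
  have h := (hasSum_Ii hα (r:ℂ)).summable.norm
  refine h.congr fun m => ?_
  have : 0 < Real.Gamma (m + α + 1) := Real.Gamma_pos_of_pos (by positivity)
  rw [norm_div, norm_pow, Complex.norm_real, Complex.norm_real, Real.norm_of_nonneg hr,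
    Real.norm_of_nonneg this.le]

lemma wpow_q {a b c : ℝ} (hc : 0 < c) (n : ℕ) (τ : ℝ) :
    ((c:ℂ) + τ * Complex.I) ^ ((-b : ℝ) : ℂ) * (qf a c τ) ^ n =
      (-1) ^ n * ((c:ℂ) + τ * Complex.I) ^ ((-(b + a * n) : ℝ) : ℂ) := by
  rw [qf, neg_pow, ← Complex.cpow_nat_mul, mul_left_comm, ← Complex.cpow_add _ _ (w_ne hc τ)]
  congr 2
  push_cast; ring

open MeasureTheory Set in
lemma tail_hasSum {a b c R : ℝ} {N : ℕ} (ha : 1 < a) (hc : 0 < c) (hR : 0 < R) (hN : 1 < b + a * N) :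
    HasSum (fun m : ℕ => (-((R ^ (1 + a) / a : ℝ) : ℂ)) ^ (m + N) /
      (((Real.Gamma (((m + N : ℕ) : ℝ) + 3 / 2) : ℝ) : ℂ) * ((Real.Gamma (a * ((m + N : ℕ) : ℝ) + b) : ℝ) : ℂ)))
      (((R ^ (1 - b) / (2 * Real.pi) : ℝ) : ℂ) * ∫ τ : ℝ, Hf a b c R N τ) := by
  have hα : (0:ℝ) < N + 1/2 := by positivity
  have ha0 : 0 < a := by linarith
  have hpi := Real.pi_pos
  let F : ℕ → ℝ → ℂ := fun m τ =>
    ((((-(R / a)) ^ (N + m) / Real.Gamma (m + (N + 1/2) + 1) : ℝ)) : ℂ) *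
    (Complex.exp (R * ((c:ℂ) + τ * Complex.I)) *
      ((c:ℂ) + τ * Complex.I) ^ ((-(b + a * (N + m : ℕ)) : ℝ) : ℂ))
  have hs : ∀ m : ℕ, 1 < b + a * ((N + m : ℕ) : ℝ) := by
    intro m
    push_cast
    have : 0 ≤ a * m := by positivity
    linarith
  have hbd : ∀ (m : ℕ) (τ : ℝ), ‖Complex.exp (R * ((c:ℂ) + τ * Complex.I)) *
      ((c:ℂ) + τ * Complex.I) ^ ((-(b + a * (N + m : ℕ)) : ℝ) : ℂ)‖ =
      Real.exp (R * c) * ‖(c:ℂ) + τ * Complex.I‖ ^ (-(b + a * (N + m : ℕ))) := by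
    intro m τ
    rw [norm_mul, Complex.norm_cpow_real, Complex.norm_exp]
    simp
  have hint0 : ∀ m : ℕ, Integrable (fun τ : ℝ => Complex.exp (R * ((c:ℂ) + τ * Complex.I)) *
      ((c:ℂ) + τ * Complex.I) ^ ((-(b + a * (N + m : ℕ)) : ℝ) : ℂ)) := by
    intro m
    refine ((integrable_norm_w hc (hs m)).const_mul (Real.exp (R * c))).mono' ?_
      (Eventually.of_forall fun τ => (hbd m τ).le)
    have := cont_wpow hc ((-(b + a * (N + m : ℕ)) : ℝ) : ℂ)
    apply Continuous.aestronglyMeasurable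
    fun_prop
  have hint : ∀ m, Integrable (F m) := fun m => (hint0 m).const_mul _
  have hsum : Summable (fun m => ∫ τ, ‖F m τ‖) := by
    refine Summable.of_nonneg_of_le (fun m => integral_nonneg fun τ => norm_nonneg _) (fun m => ?_)
      ((summable_aux hα (r := R / a * c ^ (-a)) (by positivity)).mul_left
        ((R / a) ^ N * Real.exp (R * c) * ∫ τ : ℝ, ‖(c:ℂ) + τ * Complex.I‖ ^ (-(b + a * N))))
    rw [mul_right_comm _ (∫ τ : ℝ, ‖(c:ℂ) + τ * Complex.I‖ ^ (-(b + a * N))), ← integral_const_mul]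
    refine integral_mono (hint m).norm ((integrable_norm_w hc hN).const_mul _) fun τ => ?_
    simp only [F]
    have hG : 0 < Real.Gamma (m + (N + 1/2) + 1) := Real.Gamma_pos_of_pos (by positivity)
    rw [norm_mul, hbd, Complex.norm_real, norm_div, norm_pow, norm_neg, Real.norm_of_nonneg (by positivity),
      Real.norm_of_nonneg hG.le]
    have hw : 0 < ‖(c:ℂ) + τ * Complex.I‖ := hc.trans_le (norm_w_ge c τ)
    have h1 : ‖(c:ℂ) + τ * Complex.I‖ ^ (-(b + a * (N + m : ℕ))) ≤
        (c ^ (-a)) ^ m * ‖(c:ℂ) + τ * Complex.I‖ ^ (-(b + a * N)) := by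
      rw [← Real.rpow_mul_natCast hc.le]
      rw [show -(b + a * ((N + m : ℕ) : ℝ)) = -a * m + -(b + a * N) by push_cast; ring, Real.rpow_add hw]
      gcongr ?_ * _
      refine Real.rpow_le_rpow_of_nonpos hc (norm_w_ge c τ) ?_
      have : 0 ≤ a * m := by positivity
      linarith
    calc _ ≤ (R / a) ^ (N + m) / Real.Gamma (m + (N + 1/2) + 1) * (Real.exp (R * c) *
        ((c ^ (-a)) ^ m * ‖(c:ℂ) + τ * Complex.I‖ ^ (-(b + a * N)))) := by gcongr
      _ = _ := by rw [pow_add, mul_pow]; ring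
  have H := (hasSum_integral_of_summable_integral_norm hint hsum).mul_left
    (((R ^ (1 - b) / (2 * Real.pi) : ℝ) : ℂ))
  have e2 : ∀ τ, ∑' m, F m τ = Hf a b c R N τ := by
    intro τ
    have h := (hasSum_Ii hα (((R / a : ℝ) : ℂ) * qf a c τ)).mul_left
      (Complex.exp (R * ((c:ℂ) + τ * Complex.I)) * ((c:ℂ) + τ * Complex.I) ^ ((-b : ℝ) : ℂ) *
        ((((R / a : ℝ) : ℂ) * qf a c τ) ^ N))
    rw [Hf, ← mul_assoc, ← h.tsum_eq]
    congr 1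
    ext m
    simp only [F]
    have := wpow_q (a := a) (b := b) hc (N + m) τ
    rw [show Complex.exp (R * ((c:ℂ) + τ * Complex.I)) * ((c:ℂ) + τ * Complex.I) ^ ((-b : ℝ) : ℂ) *
        ((((R / a : ℝ) : ℂ) * qf a c τ) ^ N) * ((((R / a : ℝ) : ℂ) * qf a c τ) ^ m /
          ((Real.Gamma (m + (N + 1/2) + 1) : ℝ) : ℂ)) = Complex.exp (R * ((c:ℂ) + τ * Complex.I)) *
        (((c:ℂ) + τ * Complex.I) ^ ((-b : ℝ) : ℂ) * (qf a c τ) ^ (N + m)) * ((R / a : ℝ) : ℂ) ^ (N + m) /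
        ((Real.Gamma (m + (N + 1/2) + 1) : ℝ) : ℂ) by rw [mul_pow, mul_pow, pow_add, pow_add]; ring, this,
      Complex.ofReal_div, Complex.ofReal_pow, Complex.ofReal_neg, neg_pow ((R / a : ℝ) : ℂ)]
    ring
  simp_rw [e2] at H
  refine (congrArg (fun f => HasSum f _) (funext fun m => ?_)).mpr H
  simp only [F]
  rw [integral_const_mul, inv_laplace hc (hs m) hR, ← Complex.ofReal_mul, ← Complex.ofReal_mul,
    ← Complex.ofReal_neg, ← Complex.ofReal_pow, ← Complex.ofReal_mul, ← Complex.ofReal_div]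
  congr 1
  have hG1 : 0 < Real.Gamma (m + (N + 1/2) + 1) := Real.Gamma_pos_of_pos (by positivity)
  have hG2 : 0 < Real.Gamma (b + a * ((N + m : ℕ) : ℝ)) := Real.Gamma_pos_of_pos (by linarith [hs m])
  rw [show ((m + N : ℕ) : ℝ) + 3/2 = m + (N + 1/2) + 1 by push_cast; ring,
    show a * ((m + N : ℕ) : ℝ) + b = b + a * ((N + m : ℕ) : ℝ) by push_cast; ring]
  have hx : R ^ (1 - b) * R ^ (b + a * ((N + m : ℕ) : ℝ) - 1) = (R ^ a) ^ (N + m) := by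
    rw [← Real.rpow_add hR, ← Real.rpow_mul_natCast hR.le]
    congr 1; push_cast; ring
  rw [add_comm m N, neg_pow, neg_pow (R / a), Real.rpow_add hR, Real.rpow_one, mul_div_right_comm R (R ^ a) a, mul_pow, ← hx]
  field_simp


open MeasureTheory Set in
lemma measurable_Ii (α : ℝ) : Measurable (Ii α) := by
  have h : StronglyMeasurable (fun p : ℂ × ℝ => ((p.2 ^ (α - 1) : ℝ) : ℂ) * Complex.exp (-(p.1 * p.2))) := by
    apply Measurable.stronglyMeasurable
    fun_prop
  exact (h.integral_prod_right (ν := volume.restrict (Ioc (0:ℝ) 1))).measurable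

lemma cont_qf {a c : ℝ} (hc : 0 < c) : Continuous (qf a c) := (cont_wpow hc _).neg

lemma norm_qf {a c τ : ℝ} : ‖qf a c τ‖ = ‖(c:ℂ) + τ * Complex.I‖ ^ (-a) := by
  rw [qf, norm_neg, Complex.norm_cpow_real]

open MeasureTheory Set in
lemma meas_Hf {a b c R : ℝ} (hc : 0 < c) (N : ℕ) : Measurable (Hf a b c R N) := by
  unfold Hf
  have h1 := (cont_qf (a := a) hc).measurable
  have h2 := (cont_wpow hc ((-b : ℝ) : ℂ)).measurable
  have h3 := (measurable_Ii (N + 1/2)).comp (h1.const_mul (((R / a : ℝ) : ℂ)))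
  simp only [Function.comp_def] at h3
  fun_prop

open MeasureTheory Set in
lemma Hf_bound {a b c R : ℝ} (ha : 1 < a) (hc : 0 < c) (hR : 0 < R) (N : ℕ) (τ : ℝ) :
    ‖Hf a b c R N τ‖ ≤ (1 / ((N + 1/2) * Real.Gamma (N + 1/2))) * (R / a) ^ N *
      Real.exp (R * c + R / a * max (qf a c τ).re 0) * ‖(c:ℂ) + τ * Complex.I‖ ^ (-(b + a * N)) := by
  have hα : (0:ℝ) < N + 1/2 := by positivity
  have ha0 : 0 < a := by linarith
  have hw : 0 < ‖(c:ℂ) + τ * Complex.I‖ := hc.trans_le (norm_w_ge c τ)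
  have hG : 0 < Real.Gamma (N + 1/2) := Real.Gamma_pos_of_pos hα
  have hb := expIi_bound hα (((R / a : ℝ) : ℂ) * qf a c τ)
  rw [Complex.re_ofReal_mul, show max (R / a * (qf a c τ).re) 0 = R / a * max (qf a c τ).re 0 by
    rw [mul_max_of_nonneg _ _ (by positivity), mul_zero]] at hb
  rw [Hf, norm_mul, norm_mul, norm_mul, norm_pow, norm_mul, norm_div, Complex.norm_real, norm_qf,
    Complex.norm_real, Real.norm_of_nonneg (by positivity), Real.norm_of_nonneg hG.le,
    Complex.norm_cpow_real, Complex.norm_exp]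
  have h1 : ‖(c:ℂ) + τ * Complex.I‖ ^ (-(b + a * N)) =
      ‖(c:ℂ) + τ * Complex.I‖ ^ (-b) * (‖(c:ℂ) + τ * Complex.I‖ ^ (-a)) ^ N := by
    rw [← Real.rpow_mul_natCast hw.le, ← Real.rpow_add hw]; ring_nf
  rw [h1, Real.exp_add, Complex.re_ofReal_mul, w_re]
  calc _ ≤ Real.exp (R * c) * ‖(c:ℂ) + τ * Complex.I‖ ^ (-b) *
      ((R / a * ‖(c:ℂ) + τ * Complex.I‖ ^ (-a)) ^ N *
        ((Real.exp (R / a * max (qf a c τ).re 0) / (N + 1/2)) / Real.Gamma (N + 1/2))) := by gcongr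
    _ = _ := by rw [mul_pow]; field_simp

open MeasureTheory Set in
lemma integrable_Hf {a b c R : ℝ} {N : ℕ} (ha : 1 < a) (hc : 0 < c) (hR : 0 < R) (hN : 1 < b + a * N) :
    Integrable (Hf a b c R N) := by
  have hα : (0:ℝ) < N + 1/2 := by positivity
  have ha0 : 0 < a := by linarith
  have hG : 0 < Real.Gamma (N + 1/2) := Real.Gamma_pos_of_pos hα
  refine ((integrable_norm_w hc hN).const_mul ((1 / ((N + 1/2) * Real.Gamma (N + 1/2))) * (R / a) ^ N *
      Real.exp (R * c + R / a * c ^ (-a)))).mono' (meas_Hf hc N).aestronglyMeasurable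
      (Eventually.of_forall fun τ => (Hf_bound ha hc hR N τ).trans ?_)
  gcongr
  refine max_le ?_ (by positivity)
  refine (Complex.re_le_norm _).trans ?_
  rw [norm_qf]
  exact Real.rpow_le_rpow_of_nonpos hc (norm_w_ge c τ) (by linarith)

lemma w_neg (c τ : ℝ) : (c:ℂ) + ((-τ : ℝ) : ℂ) * Complex.I = starRingEnd ℂ ((c:ℂ) + τ * Complex.I) := by
  simp

lemma arg_ne {c : ℝ} (hc : 0 < c) (τ : ℝ) : ((c:ℂ) + τ * Complex.I).arg ≠ Real.pi :=
  Complex.slitPlane_arg_ne_pi (w_slit hc τ)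

lemma wpow_neg {c : ℝ} (hc : 0 < c) (τ s : ℝ) :
    ((c:ℂ) + ((-τ : ℝ) : ℂ) * Complex.I) ^ (s : ℂ) = starRingEnd ℂ (((c:ℂ) + τ * Complex.I) ^ (s:ℂ)) := by
  rw [w_neg, Complex.conj_cpow _ _ (arg_ne hc τ), Complex.conj_ofReal]

open MeasureTheory Set in
lemma Ii_conj (α : ℝ) (y : ℂ) : Ii α (starRingEnd ℂ y) = starRingEnd ℂ (Ii α y) := by
  rw [Ii, Ii, ← integral_conj]
  congr 1
  ext v
  rw [map_mul, Complex.conj_ofReal, ← Complex.exp_conj]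
  simp

lemma Hf_neg {a b c R : ℝ} (hc : 0 < c) (N : ℕ) (τ : ℝ) :
    Hf a b c R N (-τ) = starRingEnd ℂ (Hf a b c R N τ) := by
  have hq : qf a c (-τ) = starRingEnd ℂ (qf a c τ) := by
    rw [qf, qf, wpow_neg hc, map_neg]
  have hy : ((R / a : ℝ) : ℂ) * starRingEnd ℂ (qf a c τ) = starRingEnd ℂ (((R / a : ℝ) : ℂ) * qf a c τ) := by
    rw [map_mul, Complex.conj_ofReal]
  rw [Hf, Hf, hq, hy, wpow_neg hc, w_neg, Ii_conj]
  simp only [map_mul, map_div₀, map_pow, ← Complex.exp_conj, Complex.conj_ofReal]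

open MeasureTheory Set in
lemma integral_Hf {a b c R : ℝ} {N : ℕ} (ha : 1 < a) (hc : 0 < c) (hR : 0 < R) (hN : 1 < b + a * N) :
    ∫ τ, Hf a b c R N τ = ((2 * (∫ τ in Ioi (0:ℝ), Hf a b c R N τ).re : ℝ) : ℂ) := by
  have hi := integrable_Hf (c := c) ha hc hR hN
  rw [← intervalIntegral.integral_Iic_add_Ioi (b := 0) hi.integrableOn hi.integrableOn]
  have h := integral_comp_neg_Ioi 0 (Hf a b c R N)
  rw [neg_zero] at h
  rw [← h]
  simp_rw [Hf_neg hc N]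
  rw [integral_conj, add_comm, Complex.add_conj]


/-- auxiliary angular function -/
noncomputable def Pf (a θ : ℝ) : ℝ := -(Real.cos θ ^ a * Real.cos (a * θ))

lemma Pf_deriv {a θ : ℝ} (hθ : 0 < Real.cos θ) :
    HasDerivAt (Pf a) (a * Real.cos θ ^ (a - 1) * Real.sin ((1 + a) * θ)) θ := by
  have h1 := (Real.hasDerivAt_cos θ).rpow_const (p := a) (Or.inl hθ.ne')
  have h2 : HasDerivAt (fun θ => Real.cos (a * θ)) (-Real.sin (a * θ) * a) θ := by
    have := ((hasDerivAt_id' θ).const_mul a).cos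
    simpa using this
  have h3 := (h1.mul h2).neg
  refine h3.congr_deriv ?_
  rw [show (1 + a) * θ = θ + a * θ by ring, Real.sin_add,
    show Real.cos θ ^ a = Real.cos θ ^ (a - 1) * Real.cos θ by
      rw [← Real.rpow_add_one hθ.ne']; ring_nf]
  ring

lemma cos_aux {a : ℝ} (ha : 1 < a) : 0 < Real.cos (Real.pi / (1 + a)) := by
  have hpi := Real.pi_pos
  refine Real.cos_pos_of_mem_Ioo ⟨?_, ?_⟩
  · have : 0 < Real.pi / (1 + a) := by positivity
    linarith
  · rw [div_lt_div_iff₀ (by linarith) (by norm_num)]; nlinarith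

lemma Pf_zero {a : ℝ} (ha : 1 < a) :
    Pf a (Real.pi / (1 + a)) = Real.cos (Real.pi / (1 + a)) ^ a * Real.cos (Real.pi / (1 + a)) := by
  have : a * (Real.pi / (1 + a)) = Real.pi - Real.pi / (1 + a) := by
    have : (1 + a) ≠ 0 := by linarith
    field_simp; ring
  rw [Pf, this, Real.cos_pi_sub]; ring

open Set in
lemma Pf_lt {a θ : ℝ} (ha : 1 < a) (h0 : 0 ≤ θ) (h1 : θ < Real.pi / 2) (hne : θ ≠ Real.pi / (1 + a)) :
    Pf a θ < Real.cos (Real.pi / (1 + a)) ^ a * Real.cos (Real.pi / (1 + a)) := by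
  have hpi := Real.pi_pos
  have hκ : 0 < 1 + a := by linarith
  set θ0 := Real.pi / (1 + a) with hθ0
  have hθ0p : 0 < θ0 := by positivity
  have hθ0m : (1 + a) * θ0 = Real.pi := by rw [hθ0]; field_simp
  have hθ0l : θ0 < Real.pi / 2 := by
    rw [hθ0, div_lt_div_iff₀ (by linarith) (by norm_num)]; nlinarith
  have hcos : ∀ x, 0 ≤ x → x < Real.pi / 2 → 0 < Real.cos x := fun x hx hx' =>
    Real.cos_pos_of_mem_Ioo ⟨by linarith, hx'⟩
  rw [← Pf_zero ha, ← hθ0]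
  rcases lt_or_gt_of_ne hne with hlt | hgt
  · have hm : StrictMonoOn (Pf a) (Icc 0 θ0) := by
      refine strictMonoOn_of_deriv_pos (convex_Icc _ _) (fun x hx => ?_) (fun x hx => ?_)
      · exact (Pf_deriv (hcos x hx.1 (by linarith [hx.2]))).continuousAt.continuousWithinAt
      · rw [interior_Icc] at hx
        have hc := hcos x hx.1.le (by linarith [hx.2])
        rw [(Pf_deriv hc).deriv]
        have : 0 < Real.sin ((1 + a) * x) := by
          refine Real.sin_pos_of_pos_of_lt_pi (mul_pos hκ hx.1) ?_
          rw [← hθ0m]; exact mul_lt_mul_of_pos_left hx.2 hκ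
        positivity
    exact hm ⟨h0, hlt.le⟩ ⟨hθ0p.le, le_rfl⟩ hlt
  · rcases le_or_gt θ (2 * θ0) with hle | hgt2
    · have hm : StrictAntiOn (Pf a) (Icc θ0 θ) := by
        refine strictAntiOn_of_deriv_neg (convex_Icc _ _) (fun x hx => ?_) (fun x hx => ?_)
        · exact (Pf_deriv (hcos x (by linarith [hx.1]) (by linarith [hx.2]))).continuousAt.continuousWithinAt
        · rw [interior_Icc] at hx
          have hc := hcos x (by linarith [hx.1]) (by linarith [hx.2])
          rw [(Pf_deriv hc).deriv]
          have : Real.sin ((1 + a) * x) < 0 := by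
            have e : 0 < Real.sin ((1 + a) * x - Real.pi) := by
              apply Real.sin_pos_of_pos_of_lt_pi
              · rw [← hθ0m]; nlinarith [hx.1]
              · rw [← hθ0m]; nlinarith [hx.2]
            rw [Real.sin_sub_pi] at e; linarith
          have h2 : 0 < a * Real.cos x ^ (a - 1) := by positivity
          exact mul_neg_of_pos_of_neg h2 this
      exact hm ⟨le_rfl, hgt.le⟩ ⟨hgt.le, le_rfl⟩ hgt
    · rw [hθ0, Pf_zero ha, ← hθ0]
      have hc0 := hcos θ0 hθ0p.le hθ0l
      have hcθ := hcos θ h0 h1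
      have hc1 : Real.cos θ0 < 1 := by
        rw [← Real.cos_zero]; exact Real.cos_lt_cos_of_nonneg_of_le_pi_div_two le_rfl hθ0l.le hθ0p
      have h2 : Real.cos θ < Real.cos (2 * θ0) :=
        Real.cos_lt_cos_of_nonneg_of_le_pi_div_two (by linarith) h1.le hgt2
      have h3 : Real.cos (2 * θ0) ≤ Real.cos θ0 ^ 4 := by
        rw [Real.cos_two_mul]; nlinarith [sq_nonneg (Real.cos θ0 ^ 2 - 1)]
      calc Pf a θ ≤ Real.cos θ ^ a := by
            rw [Pf]
            have h4 := Real.neg_one_le_cos (a * θ)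
            have h5 : 0 < Real.cos θ ^ a := by positivity
            nlinarith
        _ < (Real.cos θ0 ^ 4) ^ a := Real.rpow_lt_rpow hcθ.le (by linarith) (by linarith)
        _ = Real.cos θ0 ^ (4 * a) := by
            rw [← Real.rpow_natCast, ← Real.rpow_mul hc0.le]; norm_num
        _ < Real.cos θ0 ^ (a + 1) := Real.rpow_lt_rpow_of_exponent_gt hc0 hc1 (by linarith)
        _ = _ := Real.rpow_add_one hc0.ne' a

lemma qf_re {a c : ℝ} (hc : 0 < c) (τ : ℝ) :
    (qf a c τ).re = c ^ (-a) * Pf a ((c:ℂ) + τ * Complex.I).arg := by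
  have hw : 0 < ‖(c:ℂ) + τ * Complex.I‖ := hc.trans_le (norm_w_ge c τ)
  have h1 : Real.cos ((c:ℂ) + τ * Complex.I).arg = c / ‖(c:ℂ) + τ * Complex.I‖ := by
    rw [Complex.cos_arg (w_ne hc τ), w_re]
  rw [qf, Complex.neg_re, Complex.cpow_ofReal_re, Pf, h1, Real.div_rpow hc.le hw.le,
    Real.rpow_neg hc.le, Real.rpow_neg hw.le, mul_neg (_ : ℝ) a, Real.cos_neg, mul_comm _ a]
  have : 0 < c ^ a := by positivity
  field_simp

lemma qf_re_lt {a τ : ℝ} (ha : 1 < a) (hτ : 0 ≤ τ) (hne : τ ≠ Real.sin (Real.pi / (1 + a))) :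
    (qf a (Real.cos (Real.pi / (1 + a))) τ).re < Real.cos (Real.pi / (1 + a)) := by
  have hc := cos_aux ha
  set c := Real.cos (Real.pi / (1 + a)) with hcdef
  have hw : 0 < ‖(c:ℂ) + τ * Complex.I‖ := hc.trans_le (norm_w_ge c τ)
  have h1 : Real.cos ((c:ℂ) + τ * Complex.I).arg = c / ‖(c:ℂ) + τ * Complex.I‖ := by
    rw [Complex.cos_arg (w_ne hc τ), w_re]
  have h2 : Real.sin ((c:ℂ) + τ * Complex.I).arg = τ / ‖(c:ℂ) + τ * Complex.I‖ := by
    rw [Complex.sin_arg, w_im]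
  have h3 : ((c:ℂ) + τ * Complex.I).arg ≠ Real.pi / (1 + a) := by
    intro h
    rw [h, ← hcdef] at h1
    rw [h] at h2
    have : ‖(c:ℂ) + τ * Complex.I‖ = 1 := by
      field_simp at h1; exact h1
    rw [this, div_one] at h2
    exact hne h2.symm
  have h4 : 0 ≤ ((c:ℂ) + τ * Complex.I).arg := by rw [Complex.arg_nonneg_iff, w_im]; exact hτ
  have h5 : ((c:ℂ) + τ * Complex.I).arg < Real.pi / 2 := by
    rw [Complex.arg_lt_pi_div_two_iff, w_re]; exact Or.inl hc
  have h6 := Pf_lt ha h4 h5 h3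
  rw [← hcdef] at h6
  rw [qf_re hc]
  have h7 : 0 < c ^ (-a) := by positivity
  calc _ < c ^ (-a) * (c ^ a * c) := mul_lt_mul_of_pos_left h6 h7
    _ = c := by rw [← mul_assoc, ← Real.rpow_add hc]; simp

open Set in
/-- uniform gap away from the saddle -/
lemma qf_gap {a δ : ℝ} (ha : 1 < a) (hδ : 0 < δ) :
    ∃ η, 0 < η ∧ η ≤ Real.cos (Real.pi / (1 + a)) ∧ ∀ τ, 0 ≤ τ → δ ≤ |τ - Real.sin (Real.pi / (1 + a))| →
      (qf a (Real.cos (Real.pi / (1 + a))) τ).re ≤ Real.cos (Real.pi / (1 + a)) - η := by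
  have hc := cos_aux ha
  set c := Real.cos (Real.pi / (1 + a)) with hcdef
  set τ0 := Real.sin (Real.pi / (1 + a))
  have hlim : Tendsto (fun τ : ℝ => τ ^ (-a)) atTop (𝓝 0) := tendsto_rpow_neg_atTop (by linarith)
  obtain ⟨M, hM⟩ := ((hlim.eventually (gt_mem_nhds (half_pos hc))).and (eventually_gt_atTop 0)).exists
  have hfar : ∀ τ, M ≤ τ → (qf a c τ).re ≤ c - c / 2 := by
    intro τ hτ
    refine (Complex.re_le_norm _).trans ?_
    rw [norm_qf]
    have h1 : ‖(c:ℂ) + τ * Complex.I‖ ^ (-a) ≤ M ^ (-a) := by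
      refine Real.rpow_le_rpow_of_nonpos hM.2 ?_ (by linarith)
      exact hτ.trans ((le_abs_self τ).trans (norm_w_ge' c τ))
    linarith [hM.1]
  have hK : IsCompact (Icc 0 M ∩ {τ | δ ≤ |τ - τ0|}) :=
    isCompact_Icc.inter_right (isClosed_le continuous_const (by fun_prop))
  have hcont : ContinuousOn (fun τ => (qf a c τ).re) (Icc 0 M ∩ {τ | δ ≤ |τ - τ0|}) :=
    (Complex.continuous_re.comp (cont_qf hc)).continuousOn
  rcases (Icc 0 M ∩ {τ | δ ≤ |τ - τ0|}).eq_empty_or_nonempty with he | hne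
  · refine ⟨c / 2, by linarith, by linarith, fun τ hτ hd => ?_⟩
    rcases le_total M τ with h | h
    · exact hfar τ h
    · exact absurd (show τ ∈ Icc 0 M ∩ {τ | δ ≤ |τ - τ0|} from ⟨⟨hτ, h⟩, hd⟩) (by rw [he]; simp)
  · obtain ⟨x, hx, hmax⟩ := hK.exists_isMaxOn hne hcont
    have hxne : x ≠ τ0 := by
      rintro rfl
      have := hx.2
      simp at this; linarith
    have hlt := qf_re_lt ha hx.1.1 hxne
    rw [← hcdef] at hlt
    refine ⟨min (c - (qf a c x).re) (c / 2), lt_min (by linarith) (by linarith),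
      (min_le_right _ _).trans (by linarith), fun τ hτ hd => ?_⟩
    rcases le_total M τ with h | h
    · exact (hfar τ h).trans (by linarith [min_le_right (c - (qf a c x).re) (c / 2)])
    · have := hmax (show τ ∈ Icc 0 M ∩ {τ | δ ≤ |τ - τ0|} from ⟨⟨hτ, h⟩, hd⟩)
      simp only [mem_ofPred_eq] at this
      linarith [min_le_left (c - (qf a c x).re) (c / 2)]


open MeasureTheory Set in
lemma laplace {ψ : ℝ → ℂ} {M : ℝ → ℝ → ℂ} {k0 M0 : ℂ} {δ m K : ℝ} (hδ : 0 < δ) (hm0 : 0 < m)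
    (hψc : Measurable ψ) (hMm : ∀ R, Measurable (M R))
    (hψ : Tendsto (fun s : ℝ => ψ s / (s:ℂ) ^ 2) (𝓝[≠] 0) (𝓝 k0))
    (hm : ∀ s, |s| ≤ δ → (ψ s).re ≤ -m * s ^ 2)
    (hK : ∀ᶠ R in atTop, ∀ s, |s| ≤ δ → ‖M R s‖ ≤ K)
    (hlim : Tendsto (fun p : ℝ × ℝ => M p.1 p.2) (atTop ×ˢ 𝓝 0) (𝓝 M0)) :
    Tendsto (fun R : ℝ => (Real.sqrt R : ℂ) * ∫ s in Ioc (-δ) δ, Complex.exp (R * ψ s) * M R s) atTop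
      (𝓝 ((∫ σ : ℝ, Complex.exp (k0 * (σ:ℂ) ^ 2)) * M0)) := by
  rw [← integral_mul_const]
  let f : ℝ → ℝ → ℂ := fun R => (Ioc (-δ) δ).indicator (fun s => Complex.exp (R * ψ s) * M R s)
  have hfm : ∀ R, Measurable (f R) := fun R => by
    refine Measurable.indicator ?_ measurableSet_Ioc
    have := hMm R
    fun_prop
  have hsq : Tendsto Real.sqrt atTop atTop := Real.tendsto_sqrt_atTop
  have key : ∀ᶠ R : ℝ in atTop, (Real.sqrt R : ℂ) * ∫ s in Ioc (-δ) δ, Complex.exp (R * ψ s) * M R s =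
      ∫ σ : ℝ, f R (σ / Real.sqrt R) := by
    filter_upwards [eventually_gt_atTop 0] with R hR
    rw [Measure.integral_comp_div, abs_of_nonneg (Real.sqrt_nonneg _), integral_indicator measurableSet_Ioc,
      Complex.real_smul]
  refine Tendsto.congr' (EventuallyEq.symm key) ?_
  refine tendsto_integral_filter_of_dominated_convergence (fun σ => Real.exp (-m * σ ^ 2) * K) ?_ ?_ ?_ ?_
  · exact Eventually.of_forall fun R => ((hfm R).comp (by fun_prop)).aestronglyMeasurable
  · filter_upwards [hK, eventually_gt_atTop 0] with R hR hR0
    refine Eventually.of_forall fun σ => ?_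
    have hK0 : 0 ≤ K := (norm_nonneg _).trans (hR 0 (by simpa using hδ.le))
    by_cases hs : σ / Real.sqrt R ∈ Ioc (-δ) δ
    · simp only [f]
      rw [indicator_of_mem hs, norm_mul, Complex.norm_exp, Complex.re_ofReal_mul]
      have habs : |σ / Real.sqrt R| ≤ δ := abs_le.2 ⟨hs.1.le, hs.2⟩
      have h1 := hm _ habs
      have h2 := hR _ habs
      have h3 : R * (ψ (σ / Real.sqrt R)).re ≤ -m * σ ^ 2 := by
        calc R * (ψ (σ / Real.sqrt R)).re ≤ R * (-m * (σ / Real.sqrt R) ^ 2) :=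
              mul_le_mul_of_nonneg_left h1 hR0.le
          _ = -m * σ ^ 2 := by
            rw [div_pow, Real.sq_sqrt hR0.le]; field_simp
      exact mul_le_mul (Real.exp_le_exp.2 h3) h2 (norm_nonneg _) (Real.exp_pos _).le
    · simp only [f]
      rw [indicator_of_notMem hs, norm_zero]
      positivity
  · exact (integrable_exp_neg_mul_sq hm0).mul_const K
  · have h0 : ∀ᵐ σ : ℝ, σ ≠ 0 := by
      simp [ae_iff]
    filter_upwards [h0] with σ hσ
    have hu : Tendsto (fun R : ℝ => σ / Real.sqrt R) atTop (𝓝 0) := hsq.const_div_atTop σ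
    have hu' : Tendsto (fun R : ℝ => σ / Real.sqrt R) atTop (𝓝[≠] 0) := by
      refine tendsto_nhdsWithin_iff.2 ⟨hu, ?_⟩
      filter_upwards [eventually_gt_atTop 0] with R hR
      have := Real.sqrt_pos.2 hR
      simp only [mem_compl_iff, mem_singleton_iff]
      positivity
    have h1 := hlim.comp (tendsto_id.prodMk hu)
    have h2 := ((hψ.comp hu').mul_const ((σ:ℂ) ^ 2)).cexp.mul h1
    refine h2.congr' ?_
    filter_upwards [eventually_gt_atTop 0, hu.eventually (Ioo_mem_nhds (neg_lt_zero.2 hδ) hδ)] with R hR hin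
    simp only [f]
    rw [indicator_of_mem (show σ / Real.sqrt R ∈ Ioc (-δ) δ from ⟨hin.1, hin.2.le⟩)]
    simp only [Function.comp, id]
    congr 2
    have h3 : ((Real.sqrt R : ℝ) : ℂ) ^ 2 = R := by
      rw [← Complex.ofReal_pow, Real.sq_sqrt hR.le]
    have h4 : (Real.sqrt R : ℂ) ≠ 0 := by exact_mod_cast (Real.sqrt_pos.2 hR).ne'
    have h5 : (σ : ℂ) ≠ 0 := by exact_mod_cast hσ
    rw [← h3]; push_cast; field_simp

/-- the exponent near the saddle -/
noncomputable def psi (a s : ℝ) : ℂ :=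
  ((Real.cos (Real.pi / (1 + a)) : ℂ) + ((Real.sin (Real.pi / (1 + a)) + s : ℝ) : ℂ) * Complex.I) +
    qf a (Real.cos (Real.pi / (1 + a))) (Real.sin (Real.pi / (1 + a)) + s) / a -
    ((1 + a) / a : ℝ) * Complex.exp ((Real.pi / (1 + a) : ℝ) * Complex.I)

lemma w0_eq (θ : ℝ) : (Real.cos θ : ℂ) + (Real.sin θ : ℝ) * Complex.I = Complex.exp (θ * Complex.I) := by
  rw [Complex.exp_mul_I]; push_cast; rfl

lemma exp_cpow {θ : ℝ} (h0 : -Real.pi < θ) (h1 : θ ≤ Real.pi) (s : ℂ) :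
    Complex.exp (θ * Complex.I) ^ s = Complex.exp (θ * Complex.I * s) := by
  rw [Complex.cpow_def_of_ne_zero (Complex.exp_ne_zero _), Complex.log_exp (by simpa using h0) (by simpa using h1)]

lemma theta_bounds {a : ℝ} (ha : 1 < a) : 0 < Real.pi / (1 + a) ∧ Real.pi / (1 + a) < Real.pi / 2 := by
  have hpi := Real.pi_pos
  refine ⟨by positivity, ?_⟩
  rw [div_lt_div_iff₀ (by linarith) (by norm_num)]; nlinarith

/-- q at the saddle equals w0 -/
lemma qf_saddle {a : ℝ} (ha : 1 < a) :
    qf a (Real.cos (Real.pi / (1 + a))) (Real.sin (Real.pi / (1 + a))) =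
      Complex.exp ((Real.pi / (1 + a) : ℝ) * Complex.I) := by
  obtain ⟨h1, h2⟩ := theta_bounds ha
  have hpi := Real.pi_pos
  rw [qf, w0_eq, exp_cpow (by linarith) (by linarith)]
  have : ((Real.pi / (1 + a) : ℝ) : ℂ) * Complex.I * ((-a : ℝ) : ℂ) =
      ((Real.pi / (1 + a) : ℝ) : ℂ) * Complex.I - Real.pi * Complex.I := by
    have h : (1 + a : ℂ) ≠ 0 := by
      have : (1 + a) ≠ 0 := by linarith
      exact_mod_cast this
    push_cast
    field_simp
    ring
  rw [this, Complex.exp_sub, Complex.exp_pi_mul_I, div_neg, div_one, neg_neg]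

lemma hasDerivAt_line (c τ0 s : ℝ) : HasDerivAt (fun s : ℝ => (c : ℂ) + ((τ0 + s : ℝ) : ℂ) * Complex.I) Complex.I s := by
  have h : HasDerivAt (fun s : ℝ => ((τ0 + s : ℝ) : ℂ)) 1 s := by
    have := ((hasDerivAt_id' s).const_add τ0).ofReal_comp
    simpa using this
  simpa using (h.mul_const Complex.I).const_add (c:ℂ)

lemma hasDerivAt_linepow {c : ℝ} (hc : 0 < c) (τ0 s : ℝ) (p : ℂ) :
    HasDerivAt (fun s : ℝ => ((c : ℂ) + ((τ0 + s : ℝ) : ℂ) * Complex.I) ^ p)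
      (p * ((c : ℂ) + ((τ0 + s : ℝ) : ℂ) * Complex.I) ^ (p - 1) * Complex.I) s := by
  have h1 := hasDerivAt_line c τ0 s
  have h2 : HasDerivAt (fun z : ℂ => z ^ p) (p * ((c : ℂ) + ((τ0 + s : ℝ) : ℂ) * Complex.I) ^ (p - 1)) 
      ((c : ℂ) + ((τ0 + s : ℝ) : ℂ) * Complex.I) := by
    simpa using (hasDerivAt_id' _).cpow_const (c := p) (w_slit hc (τ0 + s))
  exact h2.comp s h1

lemma psi_tendsto {a : ℝ} (ha : 1 < a) :
    Tendsto (fun s : ℝ => psi a s / (s:ℂ) ^ 2) (𝓝[≠] 0)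
      (𝓝 (-((1 + a : ℝ) / 2 : ℂ) * (Complex.exp ((Real.pi / (1 + a) : ℝ) * Complex.I))⁻¹)) := by
  have hc := cos_aux ha
  obtain ⟨ht1, ht2⟩ := theta_bounds ha
  have hpi := Real.pi_pos
  have hq := qf_saddle ha
  have hw0 := w0_eq (Real.pi / (1 + a))
  have haC : (a:ℂ) ≠ 0 := by
    have : a ≠ 0 := by linarith
    exact_mod_cast this
  set c := Real.cos (Real.pi / (1 + a)) with hcdef
  set τ0 := Real.sin (Real.pi / (1 + a)) with hτ0
  set w0 := Complex.exp ((Real.pi / (1 + a) : ℝ) * Complex.I) with hw0def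
  have hw0ne : w0 ≠ 0 := Complex.exp_ne_zero _
  let g : ℝ → ℂ := fun s => Complex.I * (1 + ((c : ℂ) + ((τ0 + s : ℝ) : ℂ) * Complex.I) ^ ((-a : ℝ) - 1 : ℂ))
  have hd1 : ∀ s, HasDerivAt (psi a) (g s) s := by
    intro s
    have h1 := hasDerivAt_line c τ0 s
    have h2 := (hasDerivAt_linepow hc τ0 s ((-a : ℝ) : ℂ)).neg.div_const (a:ℂ)
    refine ((h1.add h2).sub_const _).congr_deriv ?_
    simp only [g]
    push_cast
    field_simp
  have hqi : w0 ^ ((-a : ℝ) : ℂ) = -w0 := by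
    have h := hq
    rw [qf, hw0] at h
    linear_combination -h
  have hp1 : w0 ^ ((-a : ℝ) - 1 : ℂ) = -1 := by
    rw [Complex.cpow_sub _ _ hw0ne, hqi, Complex.cpow_one]; field_simp
  have hp2 : w0 ^ ((-a : ℝ) - 1 - 1 : ℂ) = -w0⁻¹ := by
    rw [Complex.cpow_sub _ _ hw0ne, hp1, Complex.cpow_one]; field_simp
  have hg0 : g 0 = 0 := by
    simp only [g, add_zero]
    rw [hw0, hp1]; ring
  have hd2 : HasDerivAt g (-((1 + a : ℝ) : ℂ) * w0⁻¹) 0 := by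
    have h2 := ((hasDerivAt_linepow hc τ0 0 ((-a : ℝ) - 1 : ℂ)).const_add 1).const_mul Complex.I
    refine h2.congr_deriv ?_
    rw [add_zero, hw0, hp2]
    push_cast
    linear_combination ((a:ℂ) + 1) * w0⁻¹ * Complex.I_sq
  have hpsi0 : psi a 0 = 0 := by
    simp only [psi, add_zero]
    rw [← hcdef, ← hτ0, hw0, hq, ← hw0def]
    push_cast
    field_simp
    ring
  have hlo := hd2.isLittleO
  have h3 := Convex.isLittleO_pow_succ_real (n := 1) (s := Set.univ) (x₀ := (0:ℝ))
    (f := fun s : ℝ => psi a s - (-((1 + a : ℝ) / 2 : ℂ) * w0⁻¹) * (s:ℂ) ^ 2)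
    (f' := fun s : ℝ => g s - (-((1 + a : ℝ) : ℂ) * w0⁻¹) * (s:ℂ)) convex_univ (Set.mem_univ _)
    (fun s _ => by
      refine HasDerivAt.hasDerivWithinAt ?_
      have h4 : HasDerivAt (fun s : ℝ => (s:ℂ)) 1 s := by simpa using (hasDerivAt_id' s).ofReal_comp
      refine ((hd1 s).sub ((h4.pow 2).const_mul (-((1 + a : ℝ) / 2 : ℂ) * w0⁻¹))).congr_deriv ?_
      push_cast
      ring)
    (by
      rw [nhdsWithin_univ]
      refine hlo.congr (fun s => ?_) (fun s => by simp)
      simp only [hg0, sub_zero, Complex.real_smul]; ring)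
  rw [nhdsWithin_univ] at h3
  simp only [hpsi0, Complex.ofReal_zero, sub_zero] at h3
  set k0 : ℂ := -((1 + a : ℝ) / 2 : ℂ) * w0⁻¹ with hk0
  have h6 : (fun x : ℝ => psi a x - k0 * (x:ℂ) ^ 2) =o[𝓝[≠] 0] fun x : ℝ => (x:ℂ) ^ 2 := by
    refine Asymptotics.IsLittleO.trans_isBigO (g := fun x : ℝ => x ^ (1 + 1)) ?_ ?_
    · refine (h3.mono nhdsWithin_le_nhds).congr_left fun x => ?_
      ring
    · refine Asymptotics.isBigO_of_le _ fun x => ?_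
      simp
  have h7 := h6.tendsto_div_nhds_zero.add_const k0
  rw [zero_add] at h7
  refine h7.congr' ?_
  filter_upwards [self_mem_nhdsWithin] with x hx
  have hx' : (x:ℂ) ≠ 0 := by exact_mod_cast hx
  field_simp
  ring

lemma psi_zero {a : ℝ} (ha : 1 < a) : psi a 0 = 0 := by
  have haC : (a:ℂ) ≠ 0 := by
    have : a ≠ 0 := by linarith
    exact_mod_cast this
  simp only [psi, add_zero]
  rw [w0_eq, qf_saddle ha]
  push_cast
  field_simp
  ring

lemma psi_re_le {a : ℝ} (ha : 1 < a) : ∃ δ, 0 < δ ∧ ∀ s, |s| ≤ δ →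
    (psi a s).re ≤ -((1 + a) * Real.cos (Real.pi / (1 + a)) / 4) * s ^ 2 := by
  have hc := cos_aux ha
  have h := (Complex.continuous_re.tendsto _).comp (psi_tendsto ha)
  have hk : (-((1 + a : ℝ) / 2 : ℂ) * (Complex.exp ((Real.pi / (1 + a) : ℝ) * Complex.I))⁻¹).re =
      -((1 + a) * Real.cos (Real.pi / (1 + a)) / 2) := by
    rw [← Complex.exp_neg, ← neg_mul, ← Complex.ofReal_neg]
    have : (-((1 + a : ℝ) / 2 : ℂ)) = ((-((1 + a) / 2) : ℝ) : ℂ) := by push_cast; rfl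
    rw [this, Complex.re_ofReal_mul, Complex.exp_ofReal_mul_I_re, Real.cos_neg]; ring
  rw [hk] at h
  have hlt : -((1 + a) * Real.cos (Real.pi / (1 + a)) / 2) < -((1 + a) * Real.cos (Real.pi / (1 + a)) / 4) := by
    have : 0 < (1 + a) * Real.cos (Real.pi / (1 + a)) := by positivity
    linarith
  have h2 := h.eventually (gt_mem_nhds hlt)
  rw [eventually_nhdsWithin_iff, Metric.eventually_nhds_iff] at h2
  obtain ⟨ε, hε, h2⟩ := h2
  refine ⟨ε / 2, by positivity, fun s hs => ?_⟩
  rcases eq_or_ne s 0 with rfl | h0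
  · simp [psi_zero ha]
  have h3 := h2 (show dist s 0 < ε by rw [Real.dist_eq, sub_zero]; linarith) h0
  simp only [Function.comp] at h3
  rw [← Complex.ofReal_pow, Complex.div_ofReal_re, div_lt_iff₀ (by positivity)] at h3
  exact h3.le


lemma nearconst {R a c' Q : ℝ} {q : ℂ} (hR : 0 < R) (ha : 0 < a) (hc : 0 < c') (h1 : c' ≤ q.re) (h2 : ‖q‖ ≤ Q)
    (N : ℕ) : Real.sqrt R * (‖((R / a : ℝ) : ℂ) * q‖ ^ N * (1 / (((R / a : ℝ) : ℂ) * q).re) ^ ((N : ℝ) + 1 / 2)) ≤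
      Q ^ N * (1 / c') ^ ((N : ℝ) + 1 / 2) * Real.sqrt a := by
  have hQ : 0 ≤ Q := (norm_nonneg _).trans h2
  have hq : 0 < q.re := hc.trans_le h1
  have hRa : 0 < R / a := by positivity
  rw [Complex.re_ofReal_mul, norm_mul, Complex.norm_of_nonneg hRa.le]
  calc Real.sqrt R * ((R / a * ‖q‖) ^ N * (1 / (R / a * q.re)) ^ ((N : ℝ) + 1 / 2))
      ≤ Real.sqrt R * ((R / a * Q) ^ N * (1 / (R / a * c')) ^ ((N : ℝ) + 1 / 2)) := by
        gcongr
    _ = _ := by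
        have e1 : 1 / (R / a * c') = (a / R) * (1 / c') := by field_simp
        rw [e1, Real.mul_rpow (by positivity) (by positivity), Real.rpow_add (by positivity) (N:ℝ) (1/2),
          Real.rpow_natCast, ← Real.sqrt_eq_rpow, Real.sqrt_div ha.le]
        have := Real.sqrt_pos.2 hR
        rw [mul_pow, div_pow, div_pow]
        field_simp

lemma near_bound {R a c' Q : ℝ} {q : ℂ} (hR : 0 < R) (ha : 0 < a) (hc : 0 < c') (h1 : c' ≤ q.re) (h2 : ‖q‖ ≤ Q)
    (N : ℕ) : ‖(Real.sqrt R : ℂ) * ((((R / a : ℝ) : ℂ) * q) ^ N * Ii (N + 1 / 2) (((R / a : ℝ) : ℂ) * q) /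
      (Real.Gamma (N + 1 / 2) : ℝ))‖ ≤ Q ^ N * (1 / c') ^ ((N : ℝ) + 1 / 2) * Real.sqrt a := by
  have hα : (0:ℝ) < N + 1 / 2 := by positivity
  have hG := Real.Gamma_pos_of_pos hα
  have hre : 0 < (((R / a : ℝ) : ℂ) * q).re := by
    rw [Complex.re_ofReal_mul]; exact mul_pos (by positivity) (hc.trans_le h1)
  refine le_trans ?_ (nearconst hR ha hc h1 h2 N)
  set y := ((R / a : ℝ) : ℂ) * q
  rw [norm_mul, norm_div, norm_mul, norm_pow, Complex.norm_of_nonneg (Real.sqrt_nonneg _),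
    Complex.norm_of_nonneg hG.le, mul_div_assoc]
  gcongr
  rw [div_le_iff₀ hG]
  exact Ii_bound hα hre

lemma near_asymp {R a c' Q : ℝ} {q : ℂ} (hR : 0 < R) (ha : 0 < a) (hc : 0 < c') (h1 : c' ≤ q.re) (h2 : ‖q‖ ≤ Q)
    (N : ℕ) : ‖(Real.sqrt R : ℂ) * ((((R / a : ℝ) : ℂ) * q) ^ N * Ii (N + 1 / 2) (((R / a : ℝ) : ℂ) * q) /
      (Real.Gamma (N + 1 / 2) : ℝ)) - (Real.sqrt a : ℂ) * q ^ (-(1/2) : ℂ)‖ ≤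
      Real.exp (-(R * (c' / (2 * a)))) * (2 ^ ((N : ℝ) + 1 / 2) * (Q ^ N * (1 / c') ^ ((N : ℝ) + 1 / 2) * Real.sqrt a)) := by
  have hα : (0:ℝ) < N + 1 / 2 := by positivity
  have hG := Real.Gamma_pos_of_pos hα
  have hRa : 0 < R / a := by positivity
  have hq : q ≠ 0 := fun h => by rw [h] at h1; simp at h1; linarith
  have hre : 0 < (((R / a : ℝ) : ℂ) * q).re := by
    rw [Complex.re_ofReal_mul]; exact mul_pos (by positivity) (hc.trans_le h1)
  have hge : R / a * c' ≤ (((R / a : ℝ) : ℂ) * q).re := by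
    rw [Complex.re_ofReal_mul]; gcongr
  have hnc := nearconst hR ha hc h1 h2 N
  have hy : ((R / a : ℝ) : ℂ) * q ≠ 0 := mul_ne_zero (by exact_mod_cast hRa.ne') hq
  have hs : (Real.sqrt a : ℂ) * q ^ (-(1/2) : ℂ) = (Real.sqrt R : ℂ) * (((R / a : ℝ) : ℂ) * q) ^ (-(1/2) : ℂ) := by
    rw [Complex.cpow_def_of_ne_zero hy, Complex.log_ofReal_mul hRa hq, add_mul, Complex.exp_add,
      ← Complex.cpow_def_of_ne_zero hq, ← mul_assoc]
    congr 1
    have : (Real.log (R / a) : ℂ) * (-(1/2)) = ((Real.log (R / a) * (-(1/2)) : ℝ) : ℂ) := by push_cast; rfl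
    rw [this, ← Complex.ofReal_exp, ← Real.rpow_def_of_pos hRa, ← Complex.ofReal_mul]
    congr 1
    rw [Real.rpow_neg hRa.le, ← Real.sqrt_eq_rpow, Real.sqrt_div hR.le]
    have := Real.sqrt_pos.2 hR
    have := Real.sqrt_pos.2 ha
    field_simp
  rw [hs]
  set y := ((R / a : ℝ) : ℂ) * q
  have hpow : y ^ (-(1/2) : ℂ) = y ^ N * y ^ (-(((N:ℝ) + 1 / 2 : ℝ) : ℂ)) := by
    rw [← Complex.cpow_natCast, ← Complex.cpow_add _ _ hy]
    congr 1; push_cast; ring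
  have hGC : ((Real.Gamma (N + 1 / 2) : ℝ) : ℂ) ≠ 0 := by exact_mod_cast hG.ne'
  have : (Real.sqrt R : ℂ) * (y ^ N * Ii (N + 1 / 2) y / (Real.Gamma (N + 1 / 2) : ℝ)) -
      (Real.sqrt R : ℂ) * y ^ (-(1/2) : ℂ) =
      -((Real.sqrt R : ℂ) * (y ^ N * ((y ^ (-(((N:ℝ) + 1 / 2 : ℝ) : ℂ)) * (Real.Gamma (N + 1 / 2) : ℝ) -
        Ii (N + 1 / 2) y) / (Real.Gamma (N + 1 / 2) : ℝ)))) := by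
    rw [hpow, sub_div, mul_div_cancel_right₀ _ hGC]; ring
  rw [this, norm_neg, norm_mul, norm_mul, norm_div, norm_pow, Complex.norm_of_nonneg (Real.sqrt_nonneg _),
    Complex.norm_of_nonneg hG.le]
  have hA := Ii_asymp hα hre
  have hexp : Real.exp (-(y.re / 2)) ≤ Real.exp (-(R * (c' / (2 * a)))) := by
    apply Real.exp_le_exp.2
    have : R * (c' / (2 * a)) = R / a * c' / 2 := by field_simp
    rw [this]; linarith
  have h2 : 1 / (y.re / 2) = 2 * (1 / y.re) := by field_simp
  rw [h2, Real.mul_rpow (by norm_num) (by positivity)] at hA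
  calc _ ≤ Real.sqrt R * (‖y‖ ^ N * (Real.exp (-(R * (c' / (2 * a)))) *
        (2 ^ ((N : ℝ) + 1 / 2) * (1 / y.re) ^ ((N : ℝ) + 1 / 2)))) := by
        gcongr
        rw [div_le_iff₀ hG]
        refine hA.trans ?_
        rw [mul_assoc (Real.exp _)]
        gcongr
    _ = Real.exp (-(R * (c' / (2 * a)))) * (2 ^ ((N : ℝ) + 1 / 2) *
        (Real.sqrt R * (‖y‖ ^ N * (1 / y.re) ^ ((N : ℝ) + 1 / 2)))) := by ring
    _ ≤ _ := by gcongr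

/-- the amplitude near the saddle -/
noncomputable def Mn (a b : ℝ) (N : ℕ) (R s : ℝ) : ℂ :=
  ((Real.cos (Real.pi / (1 + a)) : ℂ) + ((Real.sin (Real.pi / (1 + a)) + s : ℝ) : ℂ) * Complex.I) ^ ((-b : ℝ) : ℂ) *
    ((Real.sqrt R : ℂ) * ((((R / a : ℝ) : ℂ) * qf a (Real.cos (Real.pi / (1 + a))) (Real.sin (Real.pi / (1 + a)) + s)) ^ N *
      Ii (N + 1 / 2) (((R / a : ℝ) : ℂ) * qf a (Real.cos (Real.pi / (1 + a))) (Real.sin (Real.pi / (1 + a)) + s)) /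
      (Real.Gamma (N + 1 / 2) : ℝ)))

lemma near_eq {a b R : ℝ} (hR : 0 < R) (N : ℕ) (s : ℝ) :
    (R : ℂ) * Complex.exp (-(((1 + a) / a * R : ℝ) * Complex.exp ((Real.pi / (1 + a) : ℝ) * Complex.I))) *
      Hf a b (Real.cos (Real.pi / (1 + a))) R N (Real.sin (Real.pi / (1 + a)) + s) =
    (Real.sqrt R : ℂ) * (Complex.exp (R * psi a s) * Mn a b N R s) := by
  have h3 : ((Real.sqrt R : ℝ) : ℂ) * (Real.sqrt R : ℝ) = R := by
    rw [← Complex.ofReal_mul, Real.mul_self_sqrt hR.le]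
  have h4 : Complex.exp (R * psi a s) = Complex.exp (R * ((Real.cos (Real.pi / (1 + a)) : ℂ) +
        ((Real.sin (Real.pi / (1 + a)) + s : ℝ) : ℂ) * Complex.I)) *
      Complex.exp (((R / a : ℝ) : ℂ) * qf a (Real.cos (Real.pi / (1 + a))) (Real.sin (Real.pi / (1 + a)) + s)) *
      Complex.exp (-(((1 + a) / a * R : ℝ) * Complex.exp ((Real.pi / (1 + a) : ℝ) * Complex.I))) := by
    rw [← Complex.exp_add, ← Complex.exp_add, psi]
    congr 1
    push_cast
    ring
  rw [h4, Mn, Hf, ← h3]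
  ring

lemma qf_near {a : ℝ} (ha : 1 < a) : ∃ δ, 0 < δ ∧ ∀ s, |s| ≤ δ →
    Real.cos (Real.pi / (1 + a)) / 2 ≤ (qf a (Real.cos (Real.pi / (1 + a))) (Real.sin (Real.pi / (1 + a)) + s)).re := by
  have hc := cos_aux ha
  have hcont : Continuous fun s : ℝ => (qf a (Real.cos (Real.pi / (1 + a))) (Real.sin (Real.pi / (1 + a)) + s)).re :=
    Complex.continuous_re.comp ((cont_qf hc).comp (by fun_prop))
  have h := hcont.tendsto 0
  rw [add_zero, qf_saddle ha, Complex.exp_ofReal_mul_I_re] at h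
  have h2 := h.eventually (lt_mem_nhds (half_lt_self hc))
  rw [Metric.eventually_nhds_iff] at h2
  obtain ⟨ε, hε, h2⟩ := h2
  refine ⟨ε / 2, by positivity, fun s hs => ?_⟩
  exact (h2 (show dist s 0 < ε by rw [Real.dist_eq, sub_zero]; linarith)).le

lemma qf_le {a : ℝ} (ha : 1 < a) {c : ℝ} (hc : 0 < c) (τ : ℝ) : ‖qf a c τ‖ ≤ c ^ (-a) := by
  rw [norm_qf]
  exact Real.rpow_le_rpow_of_nonpos hc (norm_w_ge c τ) (by linarith)

lemma near_tendsto {a b : ℝ} (ha : 1 < a) (N : ℕ) : ∃ δ0, 0 < δ0 ∧ ∀ δ, 0 < δ → δ ≤ δ0 →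
    Tendsto (fun R : ℝ => ∫ s in Set.Ioc (-δ) δ, (R : ℂ) *
      Complex.exp (-(((1 + a) / a * R : ℝ) * Complex.exp ((Real.pi / (1 + a) : ℝ) * Complex.I))) *
      Hf a b (Real.cos (Real.pi / (1 + a))) R N (Real.sin (Real.pi / (1 + a)) + s)) atTop
      (𝓝 ((Real.sqrt (2 * Real.pi * a / (1 + a)) : ℂ) *
        Complex.exp ((Real.pi / (1 + a) * (-b) : ℝ) * Complex.I))) := by
  obtain ⟨δ1, hδ1, hpsi⟩ := psi_re_le ha
  obtain ⟨δ2, hδ2, hqn⟩ := qf_near ha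
  refine ⟨min δ1 δ2, lt_min hδ1 hδ2, fun δ hδ hδle => ?_⟩
  have hc := cos_aux ha
  obtain ⟨ht1, ht2⟩ := theta_bounds ha
  have hpi := Real.pi_pos
  have ha0 : 0 < a := by linarith
  have hψt := psi_tendsto ha
  have hqs := qf_saddle ha
  set θ := Real.pi / (1 + a) with hθ
  set c := Real.cos θ with hcd
  set τ0 := Real.sin θ with hτ0
  have hwc : Continuous fun s : ℝ => ((c : ℂ) + ((τ0 + s : ℝ) : ℂ) * Complex.I) ^ ((-b : ℝ) : ℂ) :=
    (cont_wpow hc ((-b : ℝ) : ℂ)).comp (by fun_prop : Continuous fun s : ℝ => τ0 + s)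
  have hqc : Continuous fun s : ℝ => qf a c (τ0 + s) := (cont_qf hc).comp (by fun_prop)
  obtain ⟨W, hW⟩ := (isCompact_Icc (a := -δ) (b := δ)).exists_bound_of_continuousOn hwc.continuousOn
  have hIm : Measurable (Ii (N + 1 / 2)) := measurable_Ii _
  have hL := laplace (ψ := psi a) (M := Mn a b N) (δ := δ) (m := (1 + a) * c / 4)
    (K := W * ((c ^ (-a)) ^ N * (1 / (c / 2)) ^ ((N : ℝ) + 1 / 2) * Real.sqrt a))
    (M0 := Complex.exp (θ * Complex.I) ^ ((-b : ℝ) : ℂ) * ((Real.sqrt a : ℂ) * Complex.exp (θ * Complex.I) ^ (-(1/2) : ℂ)))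
    hδ (by positivity) ?_ ?_ hψt (fun s hs => hpsi s (hs.trans (hδle.trans (min_le_left _ _)))) ?_ ?_
  · have hval : (∫ σ : ℝ, Complex.exp ((-((1 + a : ℝ) / 2 : ℂ) * (Complex.exp (θ * Complex.I))⁻¹) * (σ:ℂ) ^ 2)) *
        (Complex.exp (θ * Complex.I) ^ ((-b : ℝ) : ℂ) * ((Real.sqrt a : ℂ) * Complex.exp (θ * Complex.I) ^ (-(1/2) : ℂ)))
        = (Real.sqrt (2 * Real.pi * a / (1 + a)) : ℂ) * Complex.exp ((θ * (-b) : ℝ) * Complex.I) := by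
      have hbpos : 0 < (((1 + a : ℝ) / 2 : ℂ) * (Complex.exp (θ * Complex.I))⁻¹).re := by
        rw [← Complex.exp_neg, ← neg_mul, ← Complex.ofReal_neg]
        have : (((1 + a : ℝ) / 2 : ℂ)) = ((((1 + a) / 2) : ℝ) : ℂ) := by push_cast; rfl
        rw [this, Complex.re_ofReal_mul, Complex.exp_ofReal_mul_I_re, Real.cos_neg]
        positivity
      have hg := integral_gaussian_complex hbpos
      simp only [← neg_mul] at hg
      rw [hg]
      have e1 : (Real.pi : ℂ) / (((1 + a : ℝ) / 2 : ℂ) * (Complex.exp (θ * Complex.I))⁻¹) =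
          ((2 * Real.pi / (1 + a) : ℝ) : ℂ) * Complex.exp (θ * Complex.I) := by
        have : (1 + a : ℂ) ≠ 0 := by
          have : (1 + a) ≠ 0 := by linarith
          exact_mod_cast this
        have := Complex.exp_ne_zero (θ * Complex.I)
        push_cast
        field_simp
      have h2p : 0 < 2 * Real.pi / (1 + a) := by positivity
      rw [e1, Complex.cpow_def_of_ne_zero (mul_ne_zero (by exact_mod_cast h2p.ne') (Complex.exp_ne_zero _)),
        Complex.log_ofReal_mul h2p (Complex.exp_ne_zero _), add_mul, Complex.exp_add,
        ← Complex.cpow_def_of_ne_zero (Complex.exp_ne_zero _)]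
      have e2 : Complex.exp ((Real.log (2 * Real.pi / (1 + a)) : ℂ) * (1/2)) = (Real.sqrt (2 * Real.pi / (1 + a)) : ℂ) := by
        rw [Real.sqrt_eq_rpow, Real.rpow_def_of_pos h2p]; push_cast; rfl
      have e3 : Real.sqrt (2 * Real.pi * a / (1 + a)) = Real.sqrt (2 * Real.pi / (1 + a)) * Real.sqrt a := by
        rw [← Real.sqrt_mul h2p.le]; congr 1; ring
      have e4 : Complex.exp (θ * Complex.I) ^ (1/2 : ℂ) * Complex.exp (θ * Complex.I) ^ (-(1/2) : ℂ) = 1 := by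
        rw [← Complex.cpow_add _ _ (Complex.exp_ne_zero _)]; simp
      have e5 : Complex.exp (θ * Complex.I) ^ ((-b : ℝ) : ℂ) = Complex.exp ((θ * (-b) : ℝ) * Complex.I) := by
        rw [exp_cpow (by linarith) (by linarith)]; congr 1; push_cast; ring
      rw [e2, e3, ← e5, Complex.ofReal_mul]
      linear_combination ((Real.sqrt (2 * Real.pi / (1 + a)) : ℂ) * (Real.sqrt a : ℂ) *
        Complex.exp (θ * Complex.I) ^ ((-b : ℝ) : ℂ)) * e4
    rw [hval] at hL
    refine hL.congr' ?_
    filter_upwards [eventually_gt_atTop 0] with R hR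
    rw [← MeasureTheory.integral_const_mul]
    congr 1
    ext s
    exact (near_eq hR N s).symm
  · have : Continuous (psi a) := by
      have h1 : Continuous fun s : ℝ => ((c : ℂ) + ((τ0 + s : ℝ) : ℂ) * Complex.I) := by fun_prop
      exact (h1.add (hqc.div_const _)).sub continuous_const
    exact this.measurable
  · intro R
    have h1 : Measurable fun s : ℝ => ((R / a : ℝ) : ℂ) * qf a c (τ0 + s) := hqc.measurable.const_mul _
    exact hwc.measurable.mul ((((h1.pow_const N).mul (hIm.comp h1)).div_const _).const_mul _)
  · filter_upwards [eventually_gt_atTop 0] with R hR s hs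
    rw [Mn, norm_mul]
    have h1 := hW s ⟨(abs_le.1 hs).1, (abs_le.1 hs).2⟩
    have h2 := near_bound hR ha0 (half_pos hc) (hqn s (hs.trans (hδle.trans (min_le_right _ _))))
      (qf_le ha hc (τ0 + s)) N
    exact mul_le_mul h1 h2 (norm_nonneg _) ((norm_nonneg _).trans h1)
  · have hw0 : Tendsto (fun p : ℝ × ℝ => ((c : ℂ) + ((τ0 + p.2 : ℝ) : ℂ) * Complex.I) ^ ((-b : ℝ) : ℂ))
        (atTop ×ˢ 𝓝 0) (𝓝 (Complex.exp (θ * Complex.I) ^ ((-b : ℝ) : ℂ))) := by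
      have h := (hwc.tendsto 0).comp (tendsto_snd (f := (atTop : Filter ℝ)))
      rw [add_zero, w0_eq] at h
      exact h
    refine hw0.mul ?_
    have hq1 : Tendsto (fun p : ℝ × ℝ => (Real.sqrt a : ℂ) * (qf a c (τ0 + p.2)) ^ (-(1/2) : ℂ))
        (atTop ×ˢ 𝓝 0) (𝓝 ((Real.sqrt a : ℂ) * Complex.exp (θ * Complex.I) ^ (-(1/2) : ℂ))) := by
      have h := (hqc.tendsto 0).comp (tendsto_snd (f := (atTop : Filter ℝ)))
      rw [add_zero, hqs] at h
      refine Tendsto.const_mul _ ?_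
      refine Tendsto.cpow h tendsto_const_nhds ?_
      left
      rw [Complex.exp_ofReal_mul_I_re]; exact hc
    have hq2 : Tendsto (fun p : ℝ × ℝ => ((Real.sqrt p.1 : ℂ) * ((((p.1 / a : ℝ) : ℂ) * qf a c (τ0 + p.2)) ^ N *
        Ii (N + 1 / 2) (((p.1 / a : ℝ) : ℂ) * qf a c (τ0 + p.2)) / (Real.Gamma (N + 1 / 2) : ℝ))) -
        (Real.sqrt a : ℂ) * (qf a c (τ0 + p.2)) ^ (-(1/2) : ℂ)) (atTop ×ˢ 𝓝 0) (𝓝 0) := by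
      have hlim : Tendsto (fun p : ℝ × ℝ => Real.exp (-(p.1 * (c / 2 / (2 * a)))) *
          (2 ^ ((N : ℝ) + 1 / 2) * ((c ^ (-a)) ^ N * (1 / (c / 2)) ^ ((N : ℝ) + 1 / 2) * Real.sqrt a)))
          (atTop ×ˢ 𝓝 0) (𝓝 0) := by
        have h1 : Tendsto (fun p : ℝ × ℝ => p.1 * (c / 2 / (2 * a))) (atTop ×ˢ 𝓝 (0:ℝ)) atTop :=
          (tendsto_fst (f := (atTop : Filter ℝ))).atTop_mul_const (by positivity)
        have h2 := (Real.tendsto_exp_neg_atTop_nhds_zero.comp h1).mul_const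
          (2 ^ ((N : ℝ) + 1 / 2) * ((c ^ (-a)) ^ N * (1 / (c / 2)) ^ ((N : ℝ) + 1 / 2) * Real.sqrt a))
        rw [zero_mul] at h2
        exact h2
      refine squeeze_zero_norm' ?_ hlim
      have hev : ∀ᶠ p : ℝ × ℝ in atTop ×ˢ 𝓝 0, 0 < p.1 ∧ |p.2| ≤ δ := by
        have h1 : ∀ᶠ s : ℝ in 𝓝 0, |s| ≤ δ := by
          have := Metric.closedBall_mem_nhds (0:ℝ) hδ
          filter_upwards [this] with s hs
          simpa [Real.dist_eq] using hs
        exact (eventually_gt_atTop (0:ℝ)).prod_mk h1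
      filter_upwards [hev] with p hp
      exact near_asymp hp.1 ha0 (half_pos hc) (hqn p.2 (hp.2.trans (hδle.trans (min_le_right _ _))))
        (qf_le ha hc (τ0 + p.2)) N
    have := hq2.add hq1
    simpa using this


open MeasureTheory Set in
lemma far_tendsto {a b δ : ℝ} (ha : 1 < a) {N : ℕ} (hN : 1 < b + a * N) (hδ : 0 < δ) :
    Tendsto (fun R : ℝ => (R : ℂ) *
      Complex.exp (-(((1 + a) / a * R : ℝ) * Complex.exp ((Real.pi / (1 + a) : ℝ) * Complex.I))) *
      ∫ τ in Ioi 0 \ Ioc (Real.sin (Real.pi / (1 + a)) - δ) (Real.sin (Real.pi / (1 + a)) + δ),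
        Hf a b (Real.cos (Real.pi / (1 + a))) R N τ) atTop (𝓝 0) := by
  obtain ⟨η, hη, hηc, hgap⟩ := qf_gap ha hδ
  have hc := cos_aux ha
  have ha0 : 0 < a := by linarith
  set θ := Real.pi / (1 + a) with hθ
  set c := Real.cos θ with hcd
  set τ0 := Real.sin θ with hτ0
  have hint := integrable_norm_w hc hN
  set C := 1 / (((N:ℝ) + 1 / 2) * Real.Gamma (N + 1 / 2)) with hC
  have hC0 : 0 ≤ C := by
    have := Real.Gamma_pos_of_pos (show (0:ℝ) < N + 1 / 2 by positivity)
    positivity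
  set B := ∫ τ : ℝ, ‖(c : ℂ) + τ * Complex.I‖ ^ (-(b + a * N)) with hB
  have hlim : Tendsto (fun R : ℝ => R ^ ((N : ℝ) + 1) * Real.exp (-(η / a) * R) * (C * (1 / a) ^ N * B)) atTop (𝓝 0) := by
    have := (tendsto_rpow_mul_exp_neg_mul_atTop_nhds_zero ((N:ℝ) + 1) (η / a) (by positivity)).mul_const (C * (1 / a) ^ N * B)
    rwa [zero_mul] at this
  refine squeeze_zero_norm' ?_ hlim
  filter_upwards [eventually_gt_atTop 0] with R hR
  have hS : MeasurableSet (Ioi (0:ℝ) \ Ioc (τ0 - δ) (τ0 + δ)) := measurableSet_Ioi.diff measurableSet_Ioc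
  have hbd : ‖∫ τ in Ioi 0 \ Ioc (τ0 - δ) (τ0 + δ), Hf a b c R N τ‖ ≤
      C * (R / a) ^ N * Real.exp (R * c + R / a * (c - η)) * B := by
    calc _ ≤ ∫ τ in Ioi 0 \ Ioc (τ0 - δ) (τ0 + δ), C * (R / a) ^ N * Real.exp (R * c + R / a * (c - η)) *
          ‖(c : ℂ) + τ * Complex.I‖ ^ (-(b + a * N)) := by
          refine norm_integral_le_of_norm_le (hint.const_mul _).integrableOn ?_
          refine (ae_restrict_iff' hS).2 (Eventually.of_forall fun τ hτ => ?_)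
          refine (Hf_bound ha hc hR N τ).trans ?_
          have h1 : (qf a c τ).re ≤ c - η := by
            refine hgap τ (le_of_lt hτ.1) ?_
            by_contra hcon
            push Not at hcon
            rw [abs_lt] at hcon
            exact hτ.2 ⟨by linarith, by linarith⟩
          have h2 : max (qf a c τ).re 0 ≤ c - η := max_le h1 (by linarith)
          gcongr
      _ ≤ ∫ τ : ℝ, C * (R / a) ^ N * Real.exp (R * c + R / a * (c - η)) *
          ‖(c : ℂ) + τ * Complex.I‖ ^ (-(b + a * N)) := by
          refine setIntegral_le_integral (hint.const_mul _) (Eventually.of_forall fun τ => ?_)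
          simp only [Pi.zero_apply]
          positivity
      _ = _ := by rw [integral_const_mul]
  rw [norm_mul, norm_mul, Complex.norm_of_nonneg hR.le, Complex.norm_exp, Complex.neg_re, Complex.re_ofReal_mul,
    Complex.exp_ofReal_mul_I_re]
  calc _ ≤ R * Real.exp (-((1 + a) / a * R * c)) * (C * (R / a) ^ N * Real.exp (R * c + R / a * (c - η)) * B) := by
        gcongr
    _ = R * R ^ N * (Real.exp (-((1 + a) / a * R * c)) * Real.exp (R * c + R / a * (c - η))) * (C * (1 / a) ^ N * B) := by
        rw [div_pow, div_pow, one_pow]; ring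
    _ = _ := by
        rw [← Real.exp_add, Real.rpow_add hR, Real.rpow_natCast, Real.rpow_one]
        have : -((1 + a) / a * R * c) + (R * c + R / a * (c - η)) = -(η / a) * R := by field_simp; ring
        rw [this]; ring

open MeasureTheory Set in
lemma J_tendsto {a b : ℝ} (ha : 1 < a) {N : ℕ} (hN : 1 < b + a * N) :
    Tendsto (fun R : ℝ => (R : ℂ) *
      Complex.exp (-(((1 + a) / a * R : ℝ) * Complex.exp ((Real.pi / (1 + a) : ℝ) * Complex.I))) *
      ∫ τ in Ioi 0, Hf a b (Real.cos (Real.pi / (1 + a))) R N τ) atTop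
      (𝓝 ((Real.sqrt (2 * Real.pi * a / (1 + a)) : ℂ) *
        Complex.exp ((Real.pi / (1 + a) * (-b) : ℝ) * Complex.I))) := by
  obtain ⟨δ0, hδ0, hnear⟩ := near_tendsto (b := b) ha N
  have hc := cos_aux ha
  obtain ⟨ht1, ht2⟩ := theta_bounds ha
  have hs : 0 < Real.sin (Real.pi / (1 + a)) := Real.sin_pos_of_pos_of_lt_pi ht1 (by linarith [Real.pi_pos])
  set δ := min δ0 (Real.sin (Real.pi / (1 + a))) with hδd
  have hδ : 0 < δ := lt_min hδ0 hs
  have h1 := hnear δ hδ (min_le_left _ _)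
  have h2 := far_tendsto (b := b) ha hN hδ
  have h3 := h1.add h2
  rw [add_zero] at h3
  refine h3.congr' ?_
  filter_upwards [eventually_gt_atTop 0] with R hR
  rw [integral_const_mul]
  have hle : δ ≤ Real.sin (Real.pi / (1 + a)) := min_le_right _ _
  set τ0 := Real.sin (Real.pi / (1 + a))
  have hsub : Ioc (τ0 - δ) (τ0 + δ) ⊆ Ioi 0 := fun x hx => by
    have := hx.1
    simp only [mem_Ioi]; linarith
  have hI := (integrable_Hf (b := b) ha hc hR hN)
  have hshift : ∫ s in Ioc (-δ) δ, Hf a b (Real.cos (Real.pi / (1 + a))) R N (τ0 + s) =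
      ∫ τ in Ioc (τ0 - δ) (τ0 + δ), Hf a b (Real.cos (Real.pi / (1 + a))) R N τ := by
    rw [← intervalIntegral.integral_of_le (by linarith), ← intervalIntegral.integral_of_le (by linarith),
      intervalIntegral.integral_comp_add_left (fun x => Hf a b (Real.cos (Real.pi / (1 + a))) R N x), sub_eq_add_neg]
  rw [hshift, ← mul_add]
  congr 1
  have := setIntegral_union (μ := volume) (f := fun τ => Hf a b (Real.cos (Real.pi / (1 + a))) R N τ)
    (s := Ioc (τ0 - δ) (τ0 + δ)) (t := Ioi 0 \ Ioc (τ0 - δ) (τ0 + δ)) disjoint_sdiff_right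
    (measurableSet_Ioi.diff measurableSet_Ioc) hI.integrableOn hI.integrableOn
  rw [← this, union_sdiff_cancel hsub]


/-- the n-th term of the series in the variable R -/
noncomputable def Tn (a b R : ℝ) (n : ℕ) : ℂ :=
  (-((R ^ (1 + a) / a : ℝ) : ℂ)) ^ n /
      (((Real.Gamma ((n : ℝ) + 3 / 2) : ℝ) : ℂ) * ((Real.Gamma (a * (n : ℝ) + b) : ℝ) : ℂ))

lemma head_tendsto {a b : ℝ} (ha : 1 < a) (n : ℕ) :
    Tendsto (fun R : ℝ => Tn a b R n * ((((1 + a) / a * R) ^ b : ℝ) : ℂ) *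
      ((Real.exp (-((1 + a) / a * R) * Real.cos (Real.pi / (1 + a))) : ℝ) : ℂ)) atTop (𝓝 0) := by
  have hc := cos_aux ha
  have ha0 : 0 < a := by linarith
  set c := Real.cos (Real.pi / (1 + a))
  have h := tendsto_rpow_mul_exp_neg_mul_atTop_nhds_zero ((1 + a) * n + b) ((1 + a) / a * c) (by positivity)
  have h2 := ((Complex.continuous_ofReal.tendsto _).comp h).const_mul
    ((-((1 / a : ℝ) : ℂ)) ^ n / (((Real.Gamma ((n : ℝ) + 3 / 2) : ℝ) : ℂ) * ((Real.Gamma (a * (n : ℝ) + b) : ℝ) : ℂ)) *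
      ((((1 + a) / a) ^ b : ℝ) : ℂ))
  rw [Complex.ofReal_zero, mul_zero] at h2
  refine h2.congr' ?_
  filter_upwards [eventually_gt_atTop 0] with R hR
  simp only [Function.comp]
  rw [Tn, Real.mul_rpow (by positivity) hR.le, Real.rpow_add hR, Real.rpow_mul hR.le, Real.rpow_natCast]
  have e1 : (-((R ^ (1 + a) / a : ℝ) : ℂ)) ^ n = (-((1 / a : ℝ) : ℂ)) ^ n * (((R ^ (1 + a)) ^ n : ℝ) : ℂ) := by
    rw [Complex.ofReal_pow, ← mul_pow]; congr 1; push_cast; ring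
  have e2 : -((1 + a) / a * R) * c = -((1 + a) / a * c) * R := by ring
  rw [e1, e2]
  push_cast
  ring

lemma main_R {a b : ℝ} (ha : 1 < a) :
    Tendsto (fun R : ℝ => (∑' n, Tn a b R n) * ((((1 + a) / a * R) ^ b : ℝ) : ℂ) *
      ((Real.exp (-((1 + a) / a * R) * Real.cos (Real.pi / (1 + a))) : ℝ) : ℂ) -
      ((2 * (((1 + a) / a) ^ (b - 1 / 2) / Real.sqrt (2 * Real.pi)) *
        Real.cos ((1 + a) / a * R * Real.sin (Real.pi / (1 + a)) + Real.pi * (-b) / (1 + a)) : ℝ) : ℂ)) atTop (𝓝 0) := by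
  have ha0 : 0 < a := by linarith
  have hpi := Real.pi_pos
  obtain ⟨N, hN'⟩ := exists_nat_gt ((1 - b) / a)
  have hN : 1 < b + a * N := by
    rw [div_lt_iff₀ ha0] at hN'; linarith
  have hc := cos_aux ha
  have hhead := tendsto_finsetSum (Finset.range N) fun n _ => head_tendsto (b := b) ha n
  rw [Finset.sum_const_zero] at hhead
  have hJ := J_tendsto ha hN
  set ℓ := (Real.sqrt (2 * Real.pi * a / (1 + a)) : ℂ) *
        Complex.exp ((Real.pi / (1 + a) * (-b) : ℝ) * Complex.I) with hℓ
  have hZ := (hJ.sub_const ℓ).norm.const_mul (((1 + a) / a) ^ b / Real.pi)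
  rw [sub_self, norm_zero, mul_zero] at hZ
  have htail : Tendsto (fun R : ℝ => (((R ^ (1 - b) / (2 * Real.pi) : ℝ) : ℂ) *
      ∫ τ : ℝ, Hf a b (Real.cos (Real.pi / (1 + a))) R N τ) * ((((1 + a) / a * R) ^ b : ℝ) : ℂ) *
      ((Real.exp (-((1 + a) / a * R) * Real.cos (Real.pi / (1 + a))) : ℝ) : ℂ) -
      ((2 * (((1 + a) / a) ^ (b - 1 / 2) / Real.sqrt (2 * Real.pi)) *
        Real.cos ((1 + a) / a * R * Real.sin (Real.pi / (1 + a)) + Real.pi * (-b) / (1 + a)) : ℝ) : ℂ)) atTop (𝓝 0) := by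
    refine squeeze_zero_norm' ?_ hZ
    filter_upwards [eventually_gt_atTop 0] with R hR
    rw [integral_Hf ha hc hR hN]
    set J := ∫ τ in Set.Ioi 0, Hf a b (Real.cos (Real.pi / (1 + a))) R N τ
    set θ := Real.pi / (1 + a) with hθ
    set X := (1 + a) / a * R with hX
    have hXpos : 0 < X := by positivity
    have hkpos : 0 < (1 + a) / a := by positivity
    set Z := (R : ℂ) * Complex.exp (-((X : ℝ) * Complex.exp (θ * Complex.I))) * J with hZd
    have e1 : ((R * Real.exp (-X * Real.cos θ) : ℝ) : ℂ) * J = Complex.exp ((X * Real.sin θ : ℝ) * Complex.I) * Z := by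
      have : ((Real.exp (-X * Real.cos θ) : ℝ) : ℂ) = Complex.exp ((X * Real.sin θ : ℝ) * Complex.I) *
          Complex.exp (-((X : ℝ) * Complex.exp (θ * Complex.I))) := by
        rw [← Complex.exp_add, Complex.ofReal_exp, ← w0_eq]; congr 1; push_cast; ring
      rw [Complex.ofReal_mul, this, hZd]; ring
    have e2 : (Complex.exp ((X * Real.sin θ : ℝ) * Complex.I) * ℓ).re =
        Real.sqrt (2 * Real.pi * a / (1 + a)) * Real.cos (X * Real.sin θ + Real.pi * (-b) / (1 + a)) := by
      have : Complex.exp ((X * Real.sin θ : ℝ) * Complex.I) * ℓ = (Real.sqrt (2 * Real.pi * a / (1 + a)) : ℂ) *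
          Complex.exp ((X * Real.sin θ + Real.pi * (-b) / (1 + a) : ℝ) * Complex.I) := by
        rw [hℓ, mul_left_comm, ← Complex.exp_add]; congr 2; rw [hθ]; push_cast; ring
      rw [this, Complex.re_ofReal_mul, Complex.exp_ofReal_mul_I_re]
    have e3 : 2 * (((1 + a) / a) ^ (b - 1 / 2) / Real.sqrt (2 * Real.pi)) =
        ((1 + a) / a) ^ b / Real.pi * Real.sqrt (2 * Real.pi * a / (1 + a)) := by
      have h1 : 2 * Real.pi * a / (1 + a) = 2 * Real.pi / ((1 + a) / a) := by field_simp
      rw [h1, Real.sqrt_div (by positivity), Real.rpow_sub hkpos, ← Real.sqrt_eq_rpow]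
      have h2 := Real.sq_sqrt (show 0 ≤ 2 * Real.pi by positivity)
      have h3 : 0 < Real.sqrt (2 * Real.pi) := Real.sqrt_pos.2 (by positivity)
      have h4 : 0 < Real.sqrt ((1 + a) / a) := Real.sqrt_pos.2 hkpos
      set u := Real.sqrt (2 * Real.pi)
      set v := Real.sqrt ((1 + a) / a)
      rw [show Real.pi = u ^ 2 / 2 by linarith]
      field_simp
    have e4 : R ^ (1 - b) / (2 * Real.pi) * (2 * J.re) * X ^ b * Real.exp (-X * Real.cos θ) =
        ((1 + a) / a) ^ b / Real.pi * (Complex.exp ((X * Real.sin θ : ℝ) * Complex.I) * Z).re := by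
      rw [← e1, Complex.re_ofReal_mul, hX, Real.mul_rpow hkpos.le hR.le, Real.rpow_sub hR, Real.rpow_one]
      have := Real.rpow_pos_of_pos hR b
      field_simp
    have e5 : ((R ^ (1 - b) / (2 * Real.pi) : ℝ) : ℂ) * ((2 * J.re : ℝ) : ℂ) * ((X ^ b : ℝ) : ℂ) *
        ((Real.exp (-X * Real.cos θ) : ℝ) : ℂ) - ((2 * (((1 + a) / a) ^ (b - 1 / 2) / Real.sqrt (2 * Real.pi)) *
        Real.cos (X * Real.sin θ + Real.pi * (-b) / (1 + a)) : ℝ) : ℂ) =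
        ((((1 + a) / a) ^ b / Real.pi * (Complex.exp ((X * Real.sin θ : ℝ) * Complex.I) * (Z - ℓ)).re : ℝ) : ℂ) := by
      rw [← Complex.ofReal_mul, ← Complex.ofReal_mul, ← Complex.ofReal_mul, ← Complex.ofReal_sub, e4, e3,
        mul_assoc _ (Real.sqrt _), ← e2, mul_sub, Complex.sub_re, mul_sub]
    rw [e5, Complex.norm_real, norm_mul, Real.norm_of_nonneg (by positivity)]
    gcongr
    refine (Complex.abs_re_le_norm _).trans ?_
    rw [norm_mul, Complex.norm_exp_ofReal_mul_I, one_mul]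
  have := hhead.add htail
  rw [add_zero] at this
  refine this.congr' ?_
  filter_upwards [eventually_gt_atTop 0] with R hR
  have hs := tail_hasSum (b := b) ha hc hR hN
  have hs2 := (hasSum_nat_add_iff (f := Tn a b R) N).1 hs
  rw [hs2.tsum_eq, ← Finset.sum_mul, ← Finset.sum_mul]
  ring

lemma R_tendsto {a : ℝ} (ha : 1 < a) : Tendsto (fun t : ℝ => (a * t ^ 2 / 4) ^ (1 / (1 + a))) atTop atTop := by
  have ha0 : 0 < a := by linarith
  refine (tendsto_rpow_atTop (by positivity)).comp ?_
  have := (tendsto_pow_atTop (α := ℝ) (n := 2) (by norm_num)).const_mul_atTop (show 0 < a / 4 by positivity)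
  refine this.congr fun t => ?_
  ring

/-- Oscillatory exponential asymptotics of `L_ν(it;a)` on the imaginary axis
for `a > 1` (`κ = 1 + a > 2`): with `ϑ = −ν−3/2`, `A₀ = (κ/a)^{ν+1}/√(2π)`,
`(it/2)^{−ν−1} L_ν(it;a) X^{ν+3/2} e^{−X cos(π/κ)} − 2A₀ cos(X sin(π/κ) + πϑ/κ) → 0`
as `t → +∞`. -/
theorem struveL_imaginary_axis_exponential (ν a : ℝ) (ha : 1 < a) :
    Tendsto (fun t : ℝ =>
      (Complex.I * (t : ℂ) / 2) ^ (-(ν : ℂ) - 1) *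
          struveL ν a (Complex.I * (t : ℂ)) *
          ((struveX a t ^ (ν + 3 / 2) : ℝ) : ℂ) *
          ((Real.exp (-struveX a t * Real.cos (Real.pi / (1 + a))) : ℝ) : ℂ) -
        ((2 * (((1 + a) / a) ^ (ν + 1) / Real.sqrt (2 * Real.pi)) *
          Real.cos (struveX a t * Real.sin (Real.pi / (1 + a)) +
            Real.pi * (-ν - 3 / 2) / (1 + a)) : ℝ) : ℂ))
      atTop (𝓝 0) := by
  have ha0 : 0 < a := by linarith
  have h := (main_R (b := ν + 3 / 2) ha).comp (R_tendsto ha)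
  refine h.congr' ?_
  filter_upwards [eventually_gt_atTop 0] with t ht
  simp only [Function.comp]
  set R := (a * t ^ 2 / 4) ^ (1 / (1 + a)) with hR
  have hX : struveX a t = (1 + a) / a * R := by
    rw [struveX, hR]
    have e1 : a ^ (-a) * t ^ 2 / 4 = a ^ (-(1 + a)) * (a * t ^ 2 / 4) := by
      rw [show -a = -(1 + a) + 1 by ring, Real.rpow_add ha0, Real.rpow_one]; ring
    have e2 : -(1 + a) * (1 / (1 + a)) = -1 := by field_simp
    rw [e1, Real.mul_rpow (by positivity) (by positivity), ← Real.rpow_mul ha0.le, e2, Real.rpow_neg_one]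
    ring
  have hRk : R ^ (1 + a) / a = t ^ 2 / 4 := by
    have e2 : 1 / (1 + a) * (1 + a) = 1 := by field_simp
    rw [hR, ← Real.rpow_mul (by positivity), e2, Real.rpow_one]
    field_simp
  have hz : Complex.I * (t : ℂ) / 2 ≠ 0 := by
    have : (t : ℂ) ≠ 0 := by exact_mod_cast ht.ne'
    simp [this]
  have hpow : (Complex.I * (t : ℂ) / 2) ^ (-(ν : ℂ) - 1) * (Complex.I * (t : ℂ) / 2) ^ ((ν : ℂ) + 1) = 1 := by
    rw [← Complex.cpow_add _ _ hz]
    ring_nf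
    simp
  have hsum : (Complex.I * (t : ℂ) / 2) ^ (-(ν : ℂ) - 1) * struveL ν a (Complex.I * (t : ℂ)) =
      ∑' n, Tn a (ν + 3 / 2) R n := by
    rw [struveL, ← mul_assoc, hpow, one_mul]
    refine tsum_congr fun n => ?_
    rw [Tn, hRk, ← Complex.Gamma_ofReal, ← Complex.Gamma_ofReal, pow_mul]
    have e3 : (Complex.I * (t : ℂ) / 2) ^ 2 = -((t ^ 2 / 4 : ℝ) : ℂ) := by
      push_cast
      linear_combination ((t : ℂ) ^ 2 / 4) * Complex.I_sq
    rw [e3]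
    push_cast
    rw [add_assoc ((a : ℂ) * n)]
  rw [hsum, hX]
  have e4 : ν + 3 / 2 - 1 / 2 = ν + 1 := by ring
  have e5 : -(ν + 3 / 2) = -ν - 3 / 2 := by ring
  rw [e4, e5]
end

section
/- Let 0 < σ < 1 and let ν be real such that σn − ν − 1/2 is not a nonpositive integer for any natural number n. Define Ψ(x) = Σ_{n=0}^∞ Γ(σn − ν − 1/2) x^n / Γ(n + 3/2), set κ = 1 − σ, h = σ^σ, and X(x) = κ (h x)^{1/κ} for x > 0. Then, as x → +∞ through positive real values, Ψ(x) · X(x)^{ν+3/2} · e^{−X(x)} → √(2π) (κ/σ)^{ν+1}. -/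
open Filter Topology

/-- The Wright function `₂Ψ₁(w) = Σ_{n≥0} Γ(σn−ν−1/2) wⁿ / Γ(n+3/2)`. -/
noncomputable def wrightPsi21 (σ ν : ℝ) (w : ℂ) : ℂ :=
  ∑' n : ℕ, Complex.Gamma ((σ : ℂ) * (n : ℂ) - (ν : ℂ) - 1 / 2) * w ^ n /
    Complex.Gamma ((n : ℂ) + 3 / 2)

lemma ws_nat : Tendsto (fun m : ℕ => Real.log (Real.Gamma m) -
    (((m : ℝ) - 1/2) * Real.log m - m)) atTop (𝓝 (Real.log (2 * Real.pi) / 2)) := by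
  have h := Stirling.tendsto_stirlingSeq_sqrt_pi
  have h2 : Tendsto (fun n => Real.log (Stirling.stirlingSeq n) + Real.log 2 / 2) atTop
      (𝓝 (Real.log (√Real.pi) + Real.log 2 / 2)) :=
    (h.log (by positivity)).add_const _
  have e : Real.log (√Real.pi) + Real.log 2 / 2 = Real.log (2 * Real.pi) / 2 := by
    rw [Real.log_sqrt Real.pi_pos.le, Real.log_mul (by norm_num) Real.pi_pos.ne']; ring
  rw [e] at h2
  refine h2.congr' ?_
  filter_upwards [eventually_ge_atTop 1] with m hm
  have hm0 : (m : ℝ) ≠ 0 := by positivity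
  rw [Stirling.log_stirlingSeq_formula]
  have hg : Real.Gamma (m + 1) = m * Real.Gamma m := Real.Gamma_add_one hm0
  rw [Real.Gamma_nat_eq_factorial] at hg
  have hgp : 0 < Real.Gamma m := Real.Gamma_pos_of_pos (by positivity)
  rw [hg, Real.log_mul hm0 hgp.ne', Real.log_mul (by norm_num) hm0,
    Real.log_div hm0 (Real.exp_pos _).ne', Real.log_exp]
  ring

lemma ws_bound (y : ℝ) (hy : 3 ≤ y) :
    |(Real.log (Real.Gamma y) - ((y - 1/2) * Real.log y - y)) -
      (Real.log (Real.Gamma (⌊y⌋₊ : ℝ)) -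
    (((⌊y⌋₊ : ℝ) - 1/2) * Real.log (⌊y⌋₊ : ℝ) - ⌊y⌋₊))| ≤ 2 / ((⌊y⌋₊ : ℝ) - 1) := by
  have hm1 : (⌊y⌋₊ : ℝ) ≤ y := Nat.floor_le (by linarith)
  have hm2 : y < (⌊y⌋₊ : ℝ) + 1 := Nat.lt_floor_add_one y
  have hm3 : 3 ≤ ⌊y⌋₊ := Nat.le_floor (by exact_mod_cast hy)
  generalize ⌊y⌋₊ = m at *
  have hm3' : (3 : ℝ) ≤ m := by exact_mod_cast hm3
  obtain ⟨x, rfl⟩ : ∃ x, y = m + x := ⟨y - m, by ring⟩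
  have hx0 : 0 ≤ x := by linarith
  have hx1 : x < 1 := by linarith
  have hfeq : ∀ {y : ℝ}, 0 < y → (Real.log ∘ Real.Gamma) (y + 1) =
      (Real.log ∘ Real.Gamma) y + Real.log y := by
    intro y hy
    simp only [Function.comp]
    rw [Real.Gamma_add_one hy.ne', Real.log_mul hy.ne' (Real.Gamma_pos_of_pos hy).ne', add_comm]
  have hup : Real.log (Real.Gamma (m + x)) ≤ Real.log (Real.Gamma m) + x * Real.log m := by
    rcases hx0.eq_or_lt with h | h
    · simp [← h]
    · exact Real.BohrMollerup.f_add_nat_le Real.convexOn_log_Gamma hfeq (by omega) h hx1.le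
  have hlo : Real.log (Real.Gamma m) + x * Real.log (m - 1) ≤ Real.log (Real.Gamma (m + x)) := by
    rcases hx0.eq_or_lt with h | h
    · simp [← h]
    · exact Real.BohrMollerup.f_add_nat_ge Real.convexOn_log_Gamma hfeq (by omega) h
  -- log bounds
  have hA : Real.log (m + x) - Real.log m ≤ x / m := by
    rw [← Real.log_div (by linarith) (by linarith)]
    have := Real.log_le_sub_one_of_pos (x := (m + x) / m) (by positivity)
    have e : (m + x) / m - 1 = x / m := by field_simp; ring
    linarith
  have hB : x / (m + x) ≤ Real.log (m + x) - Real.log m := by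
    rw [← Real.log_div (by linarith) (by linarith)]
    have := Real.one_sub_inv_le_log_of_pos (x := (m + x) / m) (by positivity)
    have e : 1 - ((m + x) / m)⁻¹ = x / (m + x) := by
      have : (m : ℝ) + x ≠ 0 := by linarith
      field_simp; ring
    linarith
  have hC : Real.log m - Real.log (m - 1) ≤ 1 / (m - 1 : ℝ) := by
    rw [← Real.log_div (by linarith) (by linarith)]
    have h0 : (0 : ℝ) < m - 1 := by linarith
    have := Real.log_le_sub_one_of_pos (x := (m : ℝ) / (m - 1)) (by positivity)
    have e : (m : ℝ) / (m - 1) - 1 = 1 / (m - 1) := by field_simp; ring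
    linarith
  have hC0 : 0 ≤ Real.log m - Real.log (m - 1) := by
    have := Real.log_le_log (x := (m : ℝ) - 1) (y := m) (by linarith) (by linarith)
    linarith
  have hC' : x * (Real.log m - Real.log (m - 1)) ≤ 1 / (m - 1 : ℝ) := by nlinarith
  have hE1 : (m + x - 1/2) * (Real.log (m + x) - Real.log m) - x ≤ 1 / (m - 1 : ℝ) := by
    have h1 : (m + x - 1/2) * (Real.log (m + x) - Real.log m) ≤ (m + x - 1/2) * (x / m) :=
      mul_le_mul_of_nonneg_left hA (by linarith)
    have e : (m + x - 1/2) * (x / m) - x = (x - 1/2) * x / m := by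
      field_simp; ring
    have h2 : (x - 1/2) * x / m ≤ 1 / (m - 1 : ℝ) := by
      apply div_le_div₀ <;> nlinarith
    linarith
  have hE2 : -(1 / (m - 1 : ℝ)) ≤ (m + x - 1/2) * (Real.log (m + x) - Real.log m) - x := by
    have h1 : (m + x - 1/2) * (x / (m + x)) ≤ (m + x - 1/2) * (Real.log (m + x) - Real.log m) :=
      mul_le_mul_of_nonneg_left hB (by linarith)
    have e : (m + x - 1/2) * (x / (m + x)) - x = -((x / 2) / (m + x)) := by
      have : (m : ℝ) + x ≠ 0 := by linarith
      field_simp; ring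
    have h2 : (x / 2) / (m + x) ≤ 1 / (m - 1 : ℝ) := by
      apply div_le_div₀ <;> linarith
    linarith
  have e2 : 2 / (m - 1 : ℝ) = 1 / (m - 1 : ℝ) + 1 / (m - 1 : ℝ) := by ring
  rw [abs_le, e2]
  constructor <;> nlinarith

lemma ws_real : Tendsto (fun y : ℝ => Real.log (Real.Gamma y) -
    ((y - 1/2) * Real.log y - y)) atTop (𝓝 (Real.log (2 * Real.pi) / 2)) := by
  have hfl : Tendsto (fun y : ℝ => ⌊y⌋₊) atTop atTop := tendsto_nat_floor_atTop
  have h1 := ws_nat.comp hfl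
  have hz : Tendsto (fun y : ℝ => 2 / ((⌊y⌋₊ : ℝ) - 1)) atTop (𝓝 0) := by
    apply Tendsto.const_div_atTop
    exact tendsto_atTop_add_const_right _ (-1) (tendsto_natCast_atTop_atTop.comp hfl)
  have h2 := squeeze_zero_norm' (a := fun y : ℝ => 2 / ((⌊y⌋₊ : ℝ) - 1))
    (f := fun y : ℝ => (Real.log (Real.Gamma y) - ((y - 1/2) * Real.log y - y)) -
      (Real.log (Real.Gamma (⌊y⌋₊ : ℝ)) -
    (((⌊y⌋₊ : ℝ) - 1/2) * Real.log (⌊y⌋₊ : ℝ) - ⌊y⌋₊)))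
    (by filter_upwards [eventually_ge_atTop 3] with y hy; exact ws_bound y hy) hz
  have := h2.add h1
  simpa [Function.comp_def] using this

lemma ws_shift (a : ℝ) : Tendsto (fun s : ℝ => Real.log (Real.Gamma (s + a)) -
    ((s + a - 1/2) * Real.log s - s)) atTop (𝓝 (Real.log (2 * Real.pi) / 2)) := by
  have h1 := ws_real.comp (tendsto_atTop_add_const_right atTop a tendsto_id)
  have h2 := Real.tendsto_mul_log_one_add_div_atTop a
  have h3 : Tendsto (fun s : ℝ => Real.log (1 + a / s)) atTop (𝓝 0) := by
    have : Tendsto (fun s : ℝ => 1 + a / s) atTop (𝓝 (1 + 0)) :=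
      (tendsto_const_nhds.div_atTop tendsto_id).const_add 1
    simpa using this.log (by norm_num)
  have h4 := (h1.add h2).add (h3.const_mul (a - 1/2)) |>.sub_const a
  have e : Real.log (2 * Real.pi) / 2 + a + (a - 1/2) * 0 - a = Real.log (2 * Real.pi) / 2 := by ring
  rw [e] at h4
  refine h4.congr' ?_
  filter_upwards [eventually_gt_atTop 0, eventually_gt_atTop (-a)] with s hs hsa
  have : 1 + a / s = (s + a) / s := by field_simp
  rw [this, Real.log_div (by linarith) hs.ne']
  simp only [Function.comp, id]
  ring

lemma ws_coeff (σ a : ℝ) (hσ : 0 < σ) :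
    Tendsto (fun n : ℕ => Real.Gamma (σ * n + a) / Real.Gamma (n + 3/2) /
      (σ ^ (a - 1/2) * ((n : ℝ) + 1) ^ (a - 3/2) *
        Real.exp (σ * n * Real.log σ - (1 - σ) * (n * Real.log n) + (1 - σ) * n))) atTop (𝓝 1) := by
  have hn : Tendsto (fun n : ℕ => (n : ℝ)) atTop atTop := tendsto_natCast_atTop_atTop
  have hσn : Tendsto (fun n : ℕ => σ * (n : ℝ)) atTop atTop := hn.const_mul_atTop hσ
  have h1 := (ws_shift a).comp hσn
  have h2 := (ws_shift (3/2)).comp hn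
  have h3 : Tendsto (fun n : ℕ => Real.log (1 + 1 / (n : ℝ))) atTop (𝓝 0) := by
    have : Tendsto (fun n : ℕ => 1 + 1 / (n : ℝ)) atTop (𝓝 (1 + 0)) :=
      (tendsto_const_nhds.div_atTop hn).const_add 1
    simpa using this.log (by norm_num)
  have h4 := ((h1.sub h2).sub (h3.const_mul (a - 3/2))).rexp
  simp only [sub_self, mul_zero, Real.exp_zero] at h4
  refine h4.congr' ?_
  filter_upwards [eventually_gt_atTop 0, hσn.eventually_gt_atTop (-a)] with n hn0 hna
  have hnp : (0 : ℝ) < n := by exact_mod_cast hn0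
  have hG1 : 0 < Real.Gamma (σ * n + a) := Real.Gamma_pos_of_pos (by linarith)
  have hG2 : 0 < Real.Gamma (n + 3/2) := Real.Gamma_pos_of_pos (by linarith)
  simp only [Function.comp]
  rw [Real.rpow_def_of_pos hσ, Real.rpow_def_of_pos (by positivity : (0:ℝ) < n + 1),
    ← Real.exp_log hG1, ← Real.exp_log hG2, Real.log_exp, Real.log_exp, ← Real.exp_sub,
    ← Real.exp_add, ← Real.exp_add, ← Real.exp_sub]
  have : 1 + 1 / (n : ℝ) = (n + 1) / n := by field_simp
  rw [this, Real.log_div (by positivity) hnp.ne', Real.log_mul hσ.ne' hnp.ne']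
  congr 1
  ring

open MeasureTheory in
lemma ws_tsum_eq_integral (f : ℕ → ℝ)
    (hi : Integrable (fun y : ℝ => if 0 ≤ y then f ⌊y⌋₊ else 0)) :
    ∑' n, f n = ∫ y : ℝ, if 0 ≤ y then f ⌊y⌋₊ else 0 := by
  set H : ℝ → ℝ := fun y : ℝ => if 0 ≤ y then f ⌊y⌋₊ else 0 with hH
  have hU : (⋃ n : ℕ, Set.Ico (n : ℝ) (n + 1)) = Set.Ici 0 := by
    ext y
    simp only [Set.mem_iUnion, Set.mem_Ico, Set.mem_Ici]
    constructor
    · rintro ⟨n, h1, h2⟩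
      exact le_trans (Nat.cast_nonneg n) h1
    · intro h
      exact ⟨⌊y⌋₊, Nat.floor_le h, Nat.lt_floor_add_one y⟩
  have hd : Pairwise (Function.onFun Disjoint fun n : ℕ => Set.Ico (n : ℝ) (n + 1)) := by
    intro m n hmn
    rw [Function.onFun, Set.disjoint_left]
    rintro y ⟨h1, h2⟩ ⟨h3, h4⟩
    apply hmn
    have a1 : (m : ℝ) < n + 1 := by linarith
    have a2 : (n : ℝ) < m + 1 := by linarith
    have b1 : m < n + 1 := by exact_mod_cast a1
    have b2 : n < m + 1 := by exact_mod_cast a2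
    omega
  have h1 := integral_iUnion (μ := volume) (f := H) (fun n : ℕ => measurableSet_Ico) hd
    hi.integrableOn
  rw [hU] at h1
  have h2 : ∫ y in Set.Ici 0, H y = ∫ y, H y := by
    apply setIntegral_eq_integral_of_forall_compl_eq_zero
    intro y hy
    simp only [Set.mem_Ici] at hy
    simp [hH, hy]
  rw [← h2, h1]
  congr 1
  ext n
  have : ∫ y in Set.Ico (n : ℝ) (n + 1), H y = ∫ y in Set.Ico (n : ℝ) (n + 1), f n := by
    apply setIntegral_congr_fun measurableSet_Ico
    intro y hy
    have h0 : (0 : ℝ) ≤ y := le_trans (Nat.cast_nonneg n) hy.1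
    have hf : ⌊y⌋₊ = n := (Nat.floor_eq_iff h0).2 hy
    simp [hH, h0, hf]
  rw [this]
  simp

open MeasureTheory in
lemma ws_tsum_scaled (f : ℕ → ℝ) (N r : ℝ) (hr : 0 < r)
    (hi : Integrable (fun t : ℝ => if 0 ≤ N + t * r then f ⌊N + t * r⌋₊ else 0)) :
    (∑' n, f n) / r = ∫ t : ℝ, if 0 ≤ N + t * r then f ⌊N + t * r⌋₊ else 0 := by
  set H : ℝ → ℝ := fun y : ℝ => if 0 ≤ y then f ⌊y⌋₊ else 0 with hH
  have hi1 : Integrable (fun t => (fun y => H (N + y)) (t * r)) := hi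
  have hi2 : Integrable (fun y => H (N + y)) :=
    (integrable_comp_mul_right_iff _ hr.ne').1 hi1
  have hi3 : Integrable H := by
    have := hi2.comp_add_left (-N)
    simpa using this
  rw [ws_tsum_eq_integral f hi3]
  have h1 := Measure.integral_comp_mul_right (fun y => H (N + y)) r
  have h2 := integral_add_left_eq_self (μ := volume) H N
  rw [h2] at h1
  change _ = ∫ t, H (N + t * r)
  rw [h1, abs_of_pos (by positivity), smul_eq_mul]
  change (∫ y, H y) / r = _
  ring

lemma ws_phi_lower (m N : ℝ) (hm : 0 ≤ m) (hN : 1 ≤ N) :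
    |m - N| / √N - 1 ≤ m * Real.log m - m * Real.log N - m + N := by
  have hN0 : 0 < N := by linarith
  have hs : 1 ≤ √N := Real.one_le_sqrt.2 hN
  have hss : √N * √N = N := Real.mul_self_sqrt hN0.le
  have key : ∀ r : ℝ, r * m - N * (Real.exp r - 1) ≤ m * Real.log m - m * Real.log N - m + N := by
    intro r
    rcases hm.eq_or_lt with h | h
    · subst h
      have := Real.exp_pos r
      simp
      nlinarith
    · have := Real.log_le_sub_one_of_pos (x := N * Real.exp r / m) (by positivity)
      rw [Real.log_div (by positivity) h.ne', Real.log_mul hN0.ne' (Real.exp_pos r).ne',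
        Real.log_exp] at this
      have h3 := mul_le_mul_of_nonneg_left this hm
      have e : m * (N * Real.exp r / m - 1) = N * Real.exp r - m := by field_simp
      rw [e] at h3
      linarith
  have key2 : ∀ r : ℝ, |r| ≤ 1 → r * (m - N) - N * r ^ 2 ≤
      m * Real.log m - m * Real.log N - m + N := by
    intro r hr
    have h1 := key r
    have h2 := (abs_le.1 (Real.abs_exp_sub_one_sub_id_le hr)).2
    nlinarith
  have hq : N * (1 / √N) ^ 2 = 1 := by
    field_simp
    exact (Real.sq_sqrt hN0.le).symm
  have hq1 : 1 / √N ≤ 1 := by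
    rw [div_le_one (by positivity)]; exact hs
  have hq0 : 0 ≤ 1 / √N := by positivity
  rcases abs_cases (m - N) with ⟨h, _⟩ | ⟨h, _⟩
  · have := key2 (1 / √N) (by rw [abs_of_nonneg hq0]; exact hq1)
    rw [hq] at this
    rw [h]
    have e : (m - N) / √N = 1 / √N * (m - N) := by ring
    linarith
  · have := key2 (-(1 / √N)) (by rw [abs_neg, abs_of_nonneg hq0]; exact hq1)
    rw [neg_sq, hq] at this
    rw [h]
    have e : -(m - N) / √N = -(1 / √N) * (m - N) := by ring
    linarith

lemma ws_phi_taylor (e : ℝ) (he : |e| ≤ 1/2) :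
    |(1 + e) * Real.log (1 + e) - e - e ^ 2 / 2| ≤ 4 * |e| ^ 3 := by
  have h := Real.abs_log_sub_add_sum_range_le (x := -e) (by rw [abs_neg]; linarith) 2
  simp only [Finset.sum_range_succ, Finset.sum_range_zero, abs_neg, sub_neg_eq_add] at h
  norm_num at h
  have h2 : |e| ^ 3 / (1 - |e|) ≤ 2 * |e| ^ 3 := by
    rw [div_le_iff₀ (by linarith)]
    have : 0 ≤ |e| ^ 3 := by positivity
    nlinarith
  set R := -e + e ^ 2 / 2 + Real.log (1 + e) with hR
  have eq : (1 + e) * Real.log (1 + e) - e - e ^ 2 / 2 = (1 + e) * R - e ^ 3 / 2 := by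
    rw [hR]; ring
  rw [eq]
  have h3 : |(1 + e) * R - e ^ 3 / 2| ≤ |1 + e| * |R| + |e| ^ 3 / 2 := by
    refine (abs_sub _ _).trans ?_
    rw [abs_mul, abs_div, abs_pow]; norm_num
  have h4 : |1 + e| ≤ 3/2 := by
    rw [abs_le] at he ⊢; constructor <;> linarith
  have h5 : |R| ≤ 2 * |e| ^ 3 := h.trans h2
  have h6 : |1 + e| * |R| ≤ 3/2 * (2 * |e| ^ 3) := mul_le_mul h4 h5 (abs_nonneg _) (by norm_num)
  have : 0 ≤ |e| ^ 3 := by positivity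
  linarith

lemma ws_poly (p : ℝ) (κ : ℝ) (hκ : 0 < κ) : ∃ K : ℝ, 0 < K ∧ ∀ t : ℝ,
    (4 * (1 + t ^ 2)) ^ |p| ≤ K * Real.exp (κ / 2 * |t|) := by
  set δ := κ / (2 * (|p| + 1)) with hδ
  have hp := abs_nonneg p
  have hδ0 : 0 < δ := by positivity
  refine ⟨(4 + 8 / δ ^ 2) ^ |p|, by positivity, fun t => ?_⟩
  have h1 : 4 * (1 + t ^ 2) ≤ (4 + 8 / δ ^ 2) * Real.exp (δ * |t|) := by
    have hx : 0 ≤ δ * |t| := by positivity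
    have h2 := Real.quadratic_le_exp_of_nonneg hx
    have h3 : (δ * |t|) ^ 2 = δ ^ 2 * t ^ 2 := by rw [mul_pow, sq_abs]
    rw [h3] at h2
    have h4 : 1 ≤ Real.exp (δ * |t|) := Real.one_le_exp hx
    have h5 : δ ^ 2 * t ^ 2 / 2 ≤ Real.exp (δ * |t|) := by linarith
    have h6 : 8 / δ ^ 2 * (δ ^ 2 * t ^ 2 / 2) ≤ 8 / δ ^ 2 * Real.exp (δ * |t|) :=
      mul_le_mul_of_nonneg_left h5 (by positivity)
    have e : 8 / δ ^ 2 * (δ ^ 2 * t ^ 2 / 2) = 4 * t ^ 2 := by field_simp; ring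
    nlinarith
  calc (4 * (1 + t ^ 2)) ^ |p| ≤ ((4 + 8 / δ ^ 2) * Real.exp (δ * |t|)) ^ |p| :=
        Real.rpow_le_rpow (by positivity) h1 hp
    _ = (4 + 8 / δ ^ 2) ^ |p| * Real.exp (δ * |t| * |p|) := by
        rw [Real.mul_rpow (by positivity) (by positivity), ← Real.exp_mul]
    _ ≤ _ := by
        apply mul_le_mul_of_nonneg_left _ (by positivity)
        apply Real.exp_le_exp.2
        have : δ * |p| ≤ κ / 2 := by
          rw [hδ, div_mul_eq_mul_div, div_le_div_iff₀ (by positivity) (by norm_num)]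
          nlinarith
        nlinarith [abs_nonneg t]

lemma ws_rpow_bound (v Q p : ℝ) (hv : 0 < v) (h1 : v ≤ Q) (h2 : v⁻¹ ≤ Q) :
    v ^ p ≤ Q ^ |p| := by
  rcases le_total 0 p with h | h
  · rw [abs_of_nonneg h]; exact Real.rpow_le_rpow hv.le h1 h
  · rw [abs_of_nonpos h]
    have : v ^ p = (v⁻¹) ^ (-p) := by
      rw [Real.inv_rpow hv.le, Real.rpow_neg hv.le, inv_inv]
    rw [this]
    exact Real.rpow_le_rpow (by positivity) h2 (by linarith)

open MeasureTheory in
lemma ws_integrable_exp_abs (k : ℝ) (hk : 0 < k) :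
    Integrable (fun t : ℝ => Real.exp (-k * |t|)) := by
  have h := integrableOn_exp_mul_Iic hk 0
  have h' := integrableOn_exp_mul_Ioi (a := -k) (by linarith) 0
  rw [← integrableOn_univ, ← Set.Iic_union_Ioi (a := (0:ℝ))]
  refine IntegrableOn.union ?_ ?_
  · refine h.congr_fun (fun t ht => ?_) measurableSet_Iic
    simp only [Set.mem_Iic] at ht
    simp [abs_of_nonpos ht]
  · refine h'.congr_fun (fun t ht => ?_) measurableSet_Ioi
    simp only [Set.mem_Ioi] at ht
    simp [abs_of_pos ht]

/-- Normalized Laplace weight. -/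
noncomputable def wsT (κ p N : ℝ) (m : ℕ) : ℝ :=
  (((m : ℝ) + 1) / N) ^ p *
    Real.exp (-(κ * ((m : ℝ) * Real.log m - m * Real.log N - m + N)))

lemma wsT_bound (κ p N t : ℝ) (hκ : 0 < κ) (hN : 1 ≤ N) (ht : 0 ≤ N + t * √N) :
    |wsT κ p N ⌊N + t * √N⌋₊| ≤
      (4 * (1 + t ^ 2)) ^ |p| * (Real.exp (2 * κ) * Real.exp (-κ * |t|)) := by
  have hm1 : (⌊N + t * √N⌋₊ : ℝ) ≤ N + t * √N := Nat.floor_le ht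
  have hm2 : N + t * √N < (⌊N + t * √N⌋₊ : ℝ) + 1 := Nat.lt_floor_add_one _
  generalize ⌊N + t * √N⌋₊ = m at *
  have hm0 : (0 : ℝ) ≤ m := Nat.cast_nonneg m
  have hN0 : 0 < N := by linarith
  have hs : 1 ≤ √N := Real.one_le_sqrt.2 hN
  have hss : √N * √N = N := Real.mul_self_sqrt hN0.le
  have hv : 0 < ((m : ℝ) + 1) / N := by positivity
  unfold wsT
  rw [abs_of_nonneg (by positivity)]
  apply mul_le_mul _ _ (by positivity) (by positivity)
  · apply ws_rpow_bound _ _ _ hv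
    · rw [div_le_iff₀ hN0]
      have h1 : t * √N ≤ |t| * N := by
        have : t ≤ |t| := le_abs_self t
        have h0 := abs_nonneg t
        have h5 : √N ≤ N := by nlinarith
        exact (mul_le_mul_of_nonneg_right this (by linarith)).trans
          (mul_le_mul_of_nonneg_left h5 h0)
      have h2 : |t| ≤ 1 + t ^ 2 := by
        rw [← sq_abs]; nlinarith [sq_nonneg (|t| - 1), abs_nonneg t]
      have h3 : |t| * N ≤ (1 + t ^ 2) * N := mul_le_mul_of_nonneg_right h2 hN0.le
      nlinarith [sq_nonneg t]
    · rw [inv_div, div_le_iff₀ (by positivity)]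
      by_cases hc : N / 2 ≤ (m : ℝ) + 1
      · nlinarith [sq_nonneg t]
      · push Not at hc
        have h1 : √N / 2 < -t := by nlinarith
        have h2 : N < 4 * t ^ 2 := by nlinarith
        nlinarith [sq_nonneg t]
  · rw [← Real.exp_add]
    apply Real.exp_le_exp.2
    have h := ws_phi_lower m N hm0 hN
    have h2 : |t| - 1 ≤ |m - N| / √N := by
      rw [le_div_iff₀ (by linarith)]
      have h3 : |t| * √N = |t * √N| := by rw [abs_mul, abs_of_nonneg (Real.sqrt_nonneg N)]
      have h4 : |t * √N| ≤ |m - N| + 1 := by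
        have : t * √N = (m - N) + (N + t * √N - m) := by ring
        rw [this]
        refine (abs_add_le _ _).trans ?_
        have : |N + t * √N - m| ≤ 1 := by rw [abs_le]; constructor <;> linarith
        linarith
      nlinarith
    nlinarith

lemma ws_floor_dev (t : ℝ) : Tendsto (fun N : ℝ => ((⌊N + t * √N⌋₊ : ℝ) - N) / √N) atTop (𝓝 t) := by
  have hsq : Tendsto (fun N : ℝ => √N) atTop atTop := Real.tendsto_sqrt_atTop
  have h1 : Tendsto (fun N : ℝ => t - ((⌊N + t * √N⌋₊ : ℝ) - N) / √N) atTop (𝓝 0) := by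
    apply squeeze_zero_norm' (a := fun N : ℝ => 1 / √N) _ (tendsto_const_nhds.div_atTop hsq)
    filter_upwards [eventually_gt_atTop 0, hsq.eventually_ge_atTop |t|] with N hN hNt
    have hs : 0 < √N := Real.sqrt_pos.2 hN
    have hss : √N * √N = N := Real.mul_self_sqrt hN.le
    have hy : 0 ≤ N + t * √N := by
      have := neg_abs_le t
      nlinarith
    have hm1 : (⌊N + t * √N⌋₊ : ℝ) ≤ N + t * √N := Nat.floor_le hy
    have hm2 : N + t * √N < (⌊N + t * √N⌋₊ : ℝ) + 1 := Nat.lt_floor_add_one _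
    have e : t - ((⌊N + t * √N⌋₊ : ℝ) - N) / √N = (N + t * √N - ⌊N + t * √N⌋₊) / √N := by
      field_simp; ring
    rw [e, Real.norm_eq_abs, abs_div, abs_of_pos hs]
    apply div_le_div_of_nonneg_right _ hs.le
    rw [abs_le]; constructor <;> linarith
  have := h1.const_sub t
  simpa using this

lemma wsT_lim (κ p t : ℝ) : Tendsto (fun N : ℝ => wsT κ p N ⌊N + t * √N⌋₊) atTop
    (𝓝 (Real.exp (-(κ / 2) * t ^ 2))) := by
  have hsq : Tendsto (fun N : ℝ => √N) atTop atTop := Real.tendsto_sqrt_atTop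
  have hdev := ws_floor_dev t
  set s : ℝ → ℝ := fun N : ℝ => ((⌊N + t * √N⌋₊ : ℝ) - N) / √N with hs
  have heps : Tendsto (fun N : ℝ => s N / √N) atTop (𝓝 0) := hdev.div_atTop hsq
  have hmN : ∀ N : ℝ, 0 < N → (⌊N + t * √N⌋₊ : ℝ) = N * (1 + s N / √N) := by
    intro N hN
    have h0 : 0 < √N := Real.sqrt_pos.2 hN
    have hss : √N ^ 2 = N := Real.sq_sqrt hN.le
    simp only [hs]
    field_simp
    rw [hss]; ring
  have hratio : Tendsto (fun N : ℝ => ((⌊N + t * √N⌋₊ : ℝ) + 1) / N) atTop (𝓝 1) := by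
    have h1 : Tendsto (fun N : ℝ => 1 + s N / √N + 1 / N) atTop (𝓝 (1 + 0 + 0)) :=
      (heps.const_add 1).add (tendsto_const_nhds.div_atTop tendsto_id)
    simp only [add_zero] at h1
    refine h1.congr' ?_
    filter_upwards [eventually_gt_atTop 0] with N hN
    rw [hmN N hN]; field_simp
  have hpow : Tendsto (fun N : ℝ => (((⌊N + t * √N⌋₊ : ℝ) + 1) / N) ^ p) atTop (𝓝 1) := by
    have := hratio.rpow_const (p := p) (Or.inl one_ne_zero)
    simpa using this
  have hphi : Tendsto (fun N : ℝ => (⌊N + t * √N⌋₊ : ℝ) * Real.log ⌊N + t * √N⌋₊ -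
      ⌊N + t * √N⌋₊ * Real.log N - ⌊N + t * √N⌋₊ + N) atTop (𝓝 (t ^ 2 / 2)) := by
    have herr : Tendsto (fun N : ℝ => ((⌊N + t * √N⌋₊ : ℝ) * Real.log ⌊N + t * √N⌋₊ -
      ⌊N + t * √N⌋₊ * Real.log N - ⌊N + t * √N⌋₊ + N) - s N ^ 2 / 2) atTop (𝓝 0) := by
      have hb : Tendsto (fun N : ℝ => 4 * |s N| ^ 3 / √N) atTop (𝓝 0) :=
        ((hdev.abs.pow 3).const_mul 4).div_atTop hsq
      apply squeeze_zero_norm' _ hb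
      have hsmall : ∀ᶠ N in atTop, |s N / √N| < 1/2 := by
        have := heps.abs
        rw [abs_zero] at this
        exact this.eventually_lt_const (by norm_num)
      filter_upwards [eventually_gt_atTop 0, hsmall] with N hN hsm
      have h0 : 0 < √N := Real.sqrt_pos.2 hN
      have hss : √N ^ 2 = N := Real.sq_sqrt hN.le
      have ht := ws_phi_taylor (s N / √N) hsm.le
      have hpos : 0 < 1 + s N / √N := by
        have := (abs_lt.1 hsm).1; linarith
      rw [hmN N hN, Real.log_mul hN.ne' hpos.ne']
      generalize s N = z at *
      have e : N * (1 + z / √N) * (Real.log N + Real.log (1 + z / √N)) -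
          N * (1 + z / √N) * Real.log N - N * (1 + z / √N) + N - z ^ 2 / 2 =
          N * ((1 + z / √N) * Real.log (1 + z / √N) - z / √N - (z / √N) ^ 2 / 2) := by
        have : N * (z / √N) ^ 2 = z ^ 2 := by rw [div_pow, hss]; field_simp
        linear_combination (1/2) * this
      rw [e, Real.norm_eq_abs, abs_mul, abs_of_pos hN]
      have e2 : 4 * |z| ^ 3 / √N = N * (4 * |z / √N| ^ 3) := by
        rw [abs_div, abs_of_pos h0, div_pow]
        nth_rewrite 2 [← hss]
        field_simp
      rw [e2]
      exact mul_le_mul_of_nonneg_left ht hN.le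
    have := herr.add ((hdev.pow 2).div_const 2)
    simpa using this
  have hexp := ((hphi.const_mul κ).neg).rexp
  have := hpow.mul hexp
  have e : Real.exp (-(κ / 2) * t ^ 2) = 1 * Real.exp (-(κ * (t ^ 2 / 2))) := by
    rw [one_mul]; congr 1; ring
  rw [e]
  exact this

open MeasureTheory in
lemma ws_laplace (κ p : ℝ) (hκ : 0 < κ) (c : ℕ → ℝ) (hc : Tendsto c atTop (𝓝 1)) :
    Tendsto (fun N : ℝ => (∑' n, c n * wsT κ p N n) / √N) atTop (𝓝 √(2 * Real.pi / κ)) := by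
  obtain ⟨M, hM⟩ : ∃ M, ∀ n, |c n| ≤ M := by
    obtain ⟨M, hM⟩ := hc.abs.bddAbove_range
    exact ⟨M, fun n => hM ⟨n, rfl⟩⟩
  have hM0 : 0 ≤ M := (abs_nonneg _).trans (hM 0)
  obtain ⟨K, hK, hKb⟩ := ws_poly p κ hκ
  set G : ℝ → ℝ → ℝ := fun N t =>
    if 0 ≤ N + t * √N then (fun n => c n * wsT κ p N n) ⌊N + t * √N⌋₊ else 0 with hG
  set B : ℝ → ℝ := fun t => M * K * Real.exp (2 * κ) * Real.exp (-(κ / 2) * |t|) with hB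
  have hBint : Integrable B := (ws_integrable_exp_abs (κ / 2) (by linarith)).const_mul _
  have hmeas : ∀ N, Measurable (G N) := by
    intro N
    have hy : Measurable (fun t : ℝ => N + t * √N) := by fun_prop
    refine Measurable.ite (measurableSet_le measurable_const hy) ?_ measurable_const
    exact (measurable_from_top (f := fun n => c n * wsT κ p N n)).comp
      (Nat.measurable_floor.comp hy)
  have hbd : ∀ N, 1 ≤ N → ∀ t, ‖G N t‖ ≤ B t := by
    intro N hN t
    have hB0 : 0 ≤ B t := by positivity
    simp only [hG]
    split_ifs with h
    · rw [Real.norm_eq_abs, abs_mul]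
      have h1 := wsT_bound κ p N t hκ hN h
      have h2 : (4 * (1 + t ^ 2)) ^ |p| * (Real.exp (2 * κ) * Real.exp (-κ * |t|)) ≤
          K * Real.exp (κ / 2 * |t|) * (Real.exp (2 * κ) * Real.exp (-κ * |t|)) :=
        mul_le_mul_of_nonneg_right (hKb t) (by positivity)
      have h3 := mul_le_mul (hM ⌊N + t * √N⌋₊) (h1.trans h2) (abs_nonneg _) hM0
      refine h3.trans (le_of_eq ?_)
      have : Real.exp (-(κ / 2) * |t|) = Real.exp (κ / 2 * |t|) * Real.exp (-κ * |t|) := by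
        rw [← Real.exp_add]; congr 1; ring
      simp only [hB]
      rw [this]; ring
    · simpa using hB0
  have hlim : ∀ t, Tendsto (fun N => G N t) atTop (𝓝 (Real.exp (-(κ / 2) * t ^ 2))) := by
    intro t
    have hsq : Tendsto (fun N : ℝ => √N) atTop atTop := Real.tendsto_sqrt_atTop
    have hy : Tendsto (fun N : ℝ => N + t * √N) atTop atTop := by
      have h1 : Tendsto (fun N : ℝ => √N * (√N + t)) atTop atTop :=
        hsq.atTop_mul_atTop₀ (tendsto_atTop_add_const_right _ t hsq)
      refine h1.congr' ?_
      filter_upwards [eventually_ge_atTop 0] with N hN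
      have hss : √N * √N = N := Real.mul_self_sqrt hN
      linear_combination hss
    have h1 := (hc.comp (tendsto_nat_floor_atTop.comp hy)).mul (wsT_lim κ p t)
    rw [one_mul] at h1
    refine h1.congr' ?_
    filter_upwards [hy.eventually_ge_atTop 0] with N hN
    simp only [hG, if_pos hN, Function.comp]
  have hD : Tendsto (fun N => ∫ t, G N t) atTop (𝓝 (∫ t, Real.exp (-(κ / 2) * t ^ 2))) := by
    apply tendsto_integral_filter_of_dominated_convergence B
    · exact Eventually.of_forall fun N => (hmeas N).aestronglyMeasurable
    · filter_upwards [eventually_ge_atTop 1] with N hN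
      exact ae_of_all _ (hbd N hN)
    · exact hBint
    · exact ae_of_all _ hlim
  rw [integral_gaussian] at hD
  have e : Real.pi / (κ / 2) = 2 * Real.pi / κ := by field_simp
  rw [e] at hD
  refine hD.congr' ?_
  filter_upwards [eventually_ge_atTop 1] with N hN
  have hs : 0 < √N := Real.sqrt_pos.2 (by linarith)
  exact (ws_tsum_scaled (fun n => c n * wsT κ p N n) N (√N) hs
    (hBint.mono' (hmeas N).aestronglyMeasurable (ae_of_all _ (hbd N hN)))).symm

/-- Leading exponential asymptotics of `₂Ψ₁(x)` on the positive real axis: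
with `κ = 1 − σ`, `h = σ^σ`, `X = κ(hx)^{1/κ}`,
`Ψ(x) X^{ν+3/2} e^{−X} → √(2π)(κ/σ)^{ν+1}` as `x → +∞`. -/
theorem wrightPsi21_exponential_asymptotics (σ ν : ℝ) (hσ0 : 0 < σ)
    (hσ1 : σ < 1)
    (hreg : ∀ n m : ℕ, σ * (n : ℝ) - ν - 1 / 2 ≠ -(m : ℝ)) :
    Tendsto (fun x : ℝ =>
      wrightPsi21 σ ν (x : ℂ) *
        ((((1 - σ) * (σ ^ σ * x) ^ (1 / (1 - σ))) ^ (ν + 3 / 2) : ℝ) : ℂ) *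
        ((Real.exp (-((1 - σ) * (σ ^ σ * x) ^ (1 / (1 - σ)))) : ℝ) : ℂ))
      atTop
      (𝓝 ((Real.sqrt (2 * Real.pi) * ((1 - σ) / σ) ^ (ν + 1) : ℝ) : ℂ)) := by
  set κ : ℝ := 1 - σ with hκdef
  have hκ : 0 < κ := by linarith
  set c : ℕ → ℝ := fun n : ℕ => Real.Gamma (σ * n + (-ν - 1/2)) / Real.Gamma (n + 3/2) /
      (σ ^ (-ν - 1/2 - 1/2 : ℝ) * ((n : ℝ) + 1) ^ (-ν - 1/2 - 3/2 : ℝ) *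
        Real.exp (σ * n * Real.log σ - (1 - σ) * (n * Real.log n) + (1 - σ) * n)) with hc
  have hc1 : Tendsto c atTop (𝓝 1) := ws_coeff σ (-ν - 1/2) hσ0
  have hL := ws_laplace κ (-ν - 2) hκ c hc1
  have hσσ : 0 < σ ^ σ := Real.rpow_pos_of_pos hσ0 _
  have hNt : Tendsto (fun x : ℝ => (σ ^ σ * x) ^ (1 / κ)) atTop atTop :=
    (tendsto_rpow_atTop (by positivity)).comp (tendsto_id.const_mul_atTop hσσ)
  have hL2 := (hL.comp hNt).const_mul (σ ^ (-ν - 1) * κ ^ (ν + 3/2))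
  have elim : σ ^ (-ν - 1) * κ ^ (ν + 3/2) * √(2 * Real.pi / κ) =
      Real.sqrt (2 * Real.pi) * (κ / σ) ^ (ν + 1) := by
    rw [Real.sqrt_div (by positivity), Real.div_rpow hκ.le hσ0.le,
      show -ν - 1 = -(ν + 1) by ring, Real.rpow_neg hσ0.le,
      show ν + 3/2 = (ν + 1) + 1/2 by ring, Real.rpow_add hκ, ← Real.sqrt_eq_rpow]
    have : √κ ≠ 0 := by positivity
    have : σ ^ (ν + 1) ≠ 0 := by positivity
    field_simp
  rw [elim] at hL2
  have hL3 := (Complex.continuous_ofReal.tendsto _).comp hL2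
  refine hL3.congr' ?_
  filter_upwards [eventually_gt_atTop 0] with x hx
  have hNpos : 0 < (σ ^ σ * x) ^ (1 / κ) := by positivity
  have hlogN : κ * Real.log ((σ ^ σ * x) ^ (1 / κ)) = σ * Real.log σ + Real.log x := by
    rw [Real.log_rpow (by positivity), Real.log_mul hσσ.ne' hx.ne', Real.log_rpow hσ0]
    field_simp
  simp only [Function.comp]
  generalize (σ ^ σ * x) ^ (1 / κ) = N at *
  have hterm : ∀ n : ℕ, Complex.Gamma ((σ : ℂ) * (n : ℂ) - (ν : ℂ) - 1 / 2) * (x : ℂ) ^ n /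
      Complex.Gamma ((n : ℂ) + 3 / 2) =
      ((σ ^ (-ν - 1) * N ^ (-ν - 2) * Real.exp (κ * N) * (c n * wsT κ (-ν - 2) N n) : ℝ) : ℂ) := by
    intro n
    have e1 : (σ : ℂ) * (n : ℂ) - (ν : ℂ) - 1 / 2 = ((σ * n + (-ν - 1/2) : ℝ) : ℂ) := by
      push_cast; ring
    have e2 : (n : ℂ) + 3 / 2 = ((n + 3/2 : ℝ) : ℂ) := by push_cast; ring
    rw [e1, e2, Complex.Gamma_ofReal, Complex.Gamma_ofReal, ← Complex.ofReal_pow,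
      ← Complex.ofReal_mul, ← Complex.ofReal_div]
    congr 1
    have hn1 : (0 : ℝ) < n + 1 := by positivity
    have hexp : Real.exp (κ * N) * Real.exp (-(κ * ((n : ℝ) * Real.log n - n * Real.log N - n + N))) =
        x ^ n * Real.exp (σ * n * Real.log σ - (1 - σ) * (n * Real.log n) + (1 - σ) * n) := by
      have hxn : x ^ n = Real.exp (n * Real.log x) := by
        rw [mul_comm, Real.exp_mul, Real.exp_log hx, Real.rpow_natCast]
      rw [hxn, ← Real.exp_add, ← Real.exp_add]
      congr 1
      rw [← hκdef]
      linear_combination (n : ℝ) * hlogN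
    have hGp : 0 < Real.Gamma (n + 3/2) := Real.Gamma_pos_of_pos (by positivity)
    simp only [hc, wsT]
    rw [Real.div_rpow hn1.le hNpos.le, show (-ν - 1/2 - 1/2 : ℝ) = -ν - 1 by ring,
      show (-ν - 1/2 - 3/2 : ℝ) = -ν - 2 by ring]
    have p1 : 0 < σ ^ (-ν - 1) := by positivity
    have p2 : 0 < N ^ (-ν - 2) := by positivity
    have p3 : 0 < ((n : ℝ) + 1) ^ (-ν - 2) := by positivity
    have p4 := Real.exp_pos (σ * n * Real.log σ - (1 - σ) * (n * Real.log n) + (1 - σ) * n)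
    generalize Real.exp (σ * n * Real.log σ - (1 - σ) * (n * Real.log n) + (1 - σ) * n) = E at *
    generalize Real.exp (-(κ * ((n : ℝ) * Real.log n - n * Real.log N - n + N))) = F at *
    generalize Real.exp (κ * N) = D at *
    generalize σ ^ (-ν - 1) = u1 at *
    generalize N ^ (-ν - 2) = u2 at *
    generalize ((n : ℝ) + 1) ^ (-ν - 2) = u3 at *
    generalize Real.Gamma (σ * n + (-ν - 1/2)) = G1 at *
    field_simp
    linear_combination (-G1) * hexp
  unfold wrightPsi21
  rw [tsum_congr hterm, ← Complex.ofReal_tsum, ← Complex.ofReal_mul, ← Complex.ofReal_mul,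
    tsum_mul_left]
  congr 1
  generalize ∑' n, c n * wsT κ (-ν - 2) N n = S
  have hsN : √N = N ^ (1/2 : ℝ) := Real.sqrt_eq_rpow N
  have h1 : N ^ (-ν - 2) * N ^ (ν + 3/2) = (√N)⁻¹ := by
    rw [hsN, ← Real.rpow_add hNpos, ← Real.rpow_neg hNpos.le]; congr 1; ring
  have h2 : Real.exp (κ * N) * Real.exp (-(κ * N)) = 1 := by
    rw [← Real.exp_add]; simp
  rw [Real.mul_rpow hκ.le hNpos.le, div_eq_mul_inv S, ← h1]
  linear_combination (-(σ ^ (-ν - 1) * κ ^ (ν + 3/2) * S * N ^ (-ν - 2) * N ^ (ν + 3/2))) * h2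
end
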